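/- arXiv:2503.07335 — 4 statements merged into one kernel-verified Lean document; each statement's English description precedes it below -/
import Mathlib

section
/- For every ε > 0, the probability that a uniformly random 3-regular simple graph G on vertex set {1,…,n} satisfies s(G) ≤ (1/3 + ε)·n tends to 1 as n → ∞ through even integers (for even n ≥ 4 the set of 3-regular simple graphs on {1,…,n} is nonempty, and G is chosen uniformly from it). -/
/-- `S` is a Sudoku set for `G`: there is some partial colouring of `S` with `χ(G)`
colours which extends to exactly one proper `χ(G)`-colouring of all of `G`. -/
def IsSudokuSet {V : Type*} (G : SimpleGraph V) (S : Finset V) : Prop :=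
  ∃ c₀ : V → Fin G.chromaticNumber.toNat,
    ∃! c : G.Coloring (Fin G.chromaticNumber.toNat), ∀ v ∈ S, c v = c₀ v

/-- The Sudoku number of `G`: the smallest possible size of a Sudoku set. -/
noncomputable def sudokuNumber {V : Type*} (G : SimpleGraph V) : ℕ :=
  sInf {k | ∃ S : Finset V, IsSudokuSet G S ∧ S.card = k}



open SimpleGraph Finset

namespace Sud

/-- cubic -/
def Cub {V : Type*} (G : SimpleGraph V) : Prop := ∀ v, (G.neighborSet v).ncard = 3

def Wi {V : Type*} (G : SimpleGraph V) (k : ℕ) (a b : V) : Prop := ∃ w : G.Walk a b, w.length ≤ k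

def WA {V : Type*} (G : SimpleGraph V) (v : V) (k : ℕ) (a b : V) : Prop :=
  ∃ w : G.Walk a b, v ∉ w.support ∧ w.length ≤ k

def Bad {V : Type*} (G : SimpleGraph V) (L : ℕ) (v : V) : Prop :=
  ∃ c : G.Walk v v, c.IsCycle ∧ c.length ≤ L

section
variable {V : Type*} {G : SimpleGraph V}

lemma Cub.exists3 (h : Cub G) (v : V) : ∃ x y z, x ≠ y ∧ x ≠ z ∧ y ≠ z ∧
    (∀ w, G.Adj v w ↔ w = x ∨ w = y ∨ w = z) := by
  obtain ⟨x, y, z, h1, h2, h3, h4⟩ := Set.ncard_eq_three.1 (h v)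
  refine ⟨x, y, z, h1, h2, h3, fun w => ?_⟩
  have : w ∈ G.neighborSet v ↔ w ∈ ({x, y, z} : Set V) := by rw [h4]
  simpa using this

lemma Wi.refl (k : ℕ) (a : V) : Wi G k a a := ⟨Walk.nil, by simp⟩
lemma Wi.symm {k : ℕ} {a b : V} (h : Wi G k a b) : Wi G k b a := by
  obtain ⟨w, hw⟩ := h; exact ⟨w.reverse, by simpa⟩
lemma Wi.trans {k l : ℕ} {a b c : V} (h : Wi G k a b) (h2 : Wi G l b c) : Wi G (k + l) a c := by
  obtain ⟨w, hw⟩ := h; obtain ⟨w2, hw2⟩ := h2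
  exact ⟨w.append w2, by simp; omega⟩
lemma Wi.mono {k l : ℕ} {a b : V} (h : Wi G k a b) (hk : k ≤ l) : Wi G l a b := by
  obtain ⟨w, hw⟩ := h; exact ⟨w, hw.trans hk⟩
lemma Wi.of_adj {a b : V} (h : G.Adj a b) : Wi G 1 a b := ⟨h.toWalk, by simp⟩
lemma Wi.monoG {G' : SimpleGraph V} (hG : G ≤ G') {k : ℕ} {a b : V} (h : Wi G k a b) :
    Wi G' k a b := by
  obtain ⟨w, hw⟩ := h; exact ⟨w.mapLe hG, by simpa using hw⟩
lemma Wi_zero {a b : V} : Wi G 0 a b ↔ a = b := by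
  constructor
  · rintro ⟨w, hw⟩; exact Walk.eq_of_length_eq_zero (p := w) (by omega)
  · rintro rfl; exact Wi.refl _ _
lemma Wi_succ {k : ℕ} {a b : V} : Wi G (k + 1) a b ↔ a = b ∨ ∃ x, G.Adj a x ∧ Wi G k x b := by
  constructor
  · rintro ⟨w, hw⟩
    cases w with
    | nil => exact Or.inl rfl
    | cons h p => exact Or.inr ⟨_, h, p, by simpa using hw⟩
  · rintro (rfl | ⟨x, h, w, hw⟩)
    · exact Wi.refl _ _
    · exact ⟨Walk.cons h w, by simpa using hw⟩
lemma Wi_succ_r {k : ℕ} {a b : V} : Wi G (k + 1) a b ↔ a = b ∨ ∃ x, Wi G k a x ∧ G.Adj x b := by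
  constructor
  · intro h
    rcases Wi_succ.1 h.symm with h | ⟨x, h1, h2⟩
    · exact Or.inl h.symm
    · exact Or.inr ⟨x, h2.symm, h1.symm⟩
  · rintro (rfl | ⟨x, h, h2⟩)
    · exact Wi.refl _ _
    · exact h.trans (Wi.of_adj h2)

lemma WA.wi {v : V} {k : ℕ} {a b : V} (h : WA G v k a b) : Wi G k a b := by
  obtain ⟨w, _, hw⟩ := h; exact ⟨w, hw⟩
lemma WA.symm {v : V} {k : ℕ} {a b : V} (h : WA G v k a b) : WA G v k b a := by
  obtain ⟨w, h1, hw⟩ := h; exact ⟨w.reverse, by simpa, by simpa⟩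
lemma WA.trans {v : V} {k l : ℕ} {a b c : V} (h : WA G v k a b) (h2 : WA G v l b c) :
    WA G v (k + l) a c := by
  obtain ⟨w, h, hw⟩ := h; obtain ⟨w2, h2, hw2⟩ := h2
  exact ⟨w.append w2, by simp [Walk.mem_support_append_iff, h, h2], by simp; omega⟩

lemma Bad.mono {L L' : ℕ} {v : V} (h : Bad G L v) (hL : L ≤ L') : Bad G L' v := by
  obtain ⟨c, h1, h2⟩ := h; exact ⟨c, h1, h2.trans hL⟩

lemma bad_of_WA {v u w : V} {k : ℕ} (hu : G.Adj v u) (hw : G.Adj v w) (hne : u ≠ w)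
    (h : WA G v k u w) : Bad G (k + 2) v := by
  classical
  obtain ⟨p, hp, hl⟩ := h
  have hs : v ∉ p.bypass.support := fun h => hp (p.support_bypass_subset_support h)
  refine ⟨Walk.cons hu (p.bypass.concat hw.symm), ?_, ?_⟩
  · rw [Walk.cons_isCycle_iff]
    refine ⟨?_, ?_⟩
    · exact (p.bypass_isPath).concat hs hw.symm
    · rw [Walk.edges_concat]
      simp only [List.concat_eq_append, List.mem_append, List.mem_singleton]
      rintro (h | h)
      · exact hs (Walk.fst_mem_support_of_mem_edges _ h)
      · rw [Sym2.eq_iff] at h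
        rcases h with ⟨h1, h2⟩ | ⟨h1, h2⟩
        · subst h2; exact hu.ne rfl
        · exact hne h2
  · simp [Walk.length_concat]
    have := p.length_bypass_le_length
    omega

lemma WA_of_rtg {E : V → V → Prop} {rk : V → ℕ} (hE : ∀ a b, E a b → G.Adj a b ∧ rk a < rk b)
    {a b v : V} (h : Relation.ReflTransGen E a b) (hb : rk b < rk v) : WA G v (rk b) a b := by
  induction h with
  | refl => exact ⟨Walk.nil, by simp; rintro rfl; omega, by simp⟩
  | tail h1 h2 ih =>
    rename_i b c
    obtain ⟨h3, h4⟩ := hE _ _ h2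
    obtain ⟨w, h5, h6⟩ := ih (by omega)
    refine ⟨w.concat h3, ?_, by simp [Walk.length_concat]; omega⟩
    rw [Walk.support_concat]
    simp [h5]
    rintro rfl; omega

section fin
variable [Fintype V]
open Classical in
noncomputable def Ball (G : SimpleGraph V) (k : ℕ) (v : V) : Finset V :=
  Finset.univ.filter (fun w => Wi G k v w)

lemma mem_Ball {k : ℕ} {v w : V} : w ∈ Ball G k v ↔ Wi G k v w := by simp [Ball]

lemma Ball_card (hG : Cub G) (k : ℕ) (v : V) : (Ball G k v).card ≤ 4 ^ k := by
  classical
  induction k generalizing v with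
  | zero =>
    have : Ball G 0 v = {v} := by ext w; simp [mem_Ball, Wi_zero, eq_comm]
    simp [this]
  | succ k ih =>
    obtain ⟨x, y, z, _, _, _, h⟩ := hG.exists3 v
    have : Ball G (k+1) v ⊆ (Ball G k v ∪ Ball G k x) ∪ (Ball G k y ∪ Ball G k z) := by
      intro w hw
      rw [mem_Ball, Wi_succ] at hw
      simp only [mem_union, mem_Ball]
      rcases hw with rfl | ⟨u, hu, hw⟩
      · exact Or.inl (Or.inl (Wi.refl _ _))
      · rcases (h u).1 hu with rfl | rfl | rfl <;> tauto
    have h1 := card_le_card this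
    have h2 := card_union_le (Ball G k v ∪ Ball G k x) (Ball G k y ∪ Ball G k z)
    have h3 := card_union_le (Ball G k v) (Ball G k x)
    have h4 := card_union_le (Ball G k y) (Ball G k z)
    have := ih v; have := ih x; have := ih y; have := ih z
    rw [pow_succ]; omega

/-- greedy colouring for a symmetric relation. -/
lemma greedy (E : V → V → Prop) (hs : ∀ a b, E a b → E b a) (hi : ∀ a, ¬ E a a) (Δ : ℕ)
    (hd : ∀ v, {w | E v w}.ncard ≤ Δ) : ∃ c : V → ℕ, (∀ v, c v ≤ Δ) ∧ ∀ a b, E a b → c a ≠ c b := by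
  classical
  suffices H : ∀ s : Finset V, ∃ c : V → ℕ, (∀ v, c v ≤ Δ) ∧ ∀ a ∈ s, ∀ b ∈ s, E a b → c a ≠ c b by
    obtain ⟨c, h1, h2⟩ := H univ
    exact ⟨c, h1, fun a b => h2 a (mem_univ _) b (mem_univ _)⟩
  intro s
  induction s using Finset.induction_on with
  | empty => exact ⟨fun _ => 0, by simp, by simp⟩
  | insert x s hx ih =>
    obtain ⟨c, h1, h2⟩ := ih
    have : ∃ k ∈ Finset.range (Δ + 1), k ∉ (univ.filter (fun w => E x w)).image c := by
      by_contra hcon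
      push Not at hcon
      have h3 : Finset.range (Δ+1) ⊆ (univ.filter (fun w => E x w)).image c := hcon
      have h4 := card_le_card h3
      have h5 := card_image_le (s := univ.filter (fun w => E x w)) (f := c)
      have h6 : (univ.filter (fun w => E x w)).card ≤ Δ := by
        have := hd x
        rw [Set.ncard_eq_toFinset_card', Set.toFinset_setOf] at this
        exact this
      simp only [card_range] at h4
      omega
    obtain ⟨k, hk, hk2⟩ := this
    simp at hk hk2
    refine ⟨Function.update c x k, ?_, ?_⟩
    · intro v
      by_cases h : v = x
      · subst h; simp; omega
      · simp [h, h1]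
    · intro a ha b hb hE
      by_cases h : a = x
      · subst h
        have : b ≠ a := by rintro rfl; exact hi _ hE
        simp [this]
        exact fun h => hk2 b hE h.symm
      · by_cases h' : b = x
        · subst h'
          simp [h]
          exact hk2 a (hs _ _ hE)
        · simp [h, h']
          simp [h] at ha; simp [h'] at hb
          exact h2 a ha b hb hE
end fin
end
end Sud

open SimpleGraph Finset

namespace Sud

structure Sys {V : Type*} (G : SimpleGraph V) where
  X : Finset V
  m : V → V
  nx : V → V
  pv : V → V
  rk : V → ℕ
  β : V → ℕ
  R : ℕ
  hm : ∀ v, m (m v) = v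
  adj : ∀ v, v ∉ X → ∀ w, G.Adj v w ↔ w = m v ∨ w = nx v ∨ w = pv v
  ne1 : ∀ v, v ∉ X → m v ≠ nx v
  ne2 : ∀ v, v ∉ X → m v ≠ pv v
  ne3 : ∀ v, v ∉ X → nx v ≠ pv v
  hnx : ∀ v, v ∉ X → nx v ∉ X → rk v < rk (nx v)
  hnxb : ∀ v, v ∉ X → nx v ∉ X → β (nx v) = β v
  hpv : ∀ v, v ∉ X → pv v ∉ X → β (pv v) = β v
  hdist : ∀ v w, v ∉ X → w ∉ X → G.Adj v w → rk v ≠ rk w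
  hch : ∀ v, v ∉ X → m v ∉ X → rk (m v) < rk v → β (m v) < β v
  rkR : ∀ v, rk v ≤ R
  hbad : ∀ v, Bad G (2 * R + 2) v → v ∈ X

abbrev Z3 := ZMod 3
abbrev ST := Z3 × Option Z3

def good (s : ST) : Prop := s.2 ≠ some s.1
instance : DecidablePred good := fun s => by unfold good; infer_instance
def crit (s : ST) : Z3 := s.2.getD s.1
def shf (t : Z3) (s : ST) : ST := (s.1 + t, s.2.map (· + t))

def stepC (s : ST) (α : Z3) : ST :=
  match s.2 with
  | none => if s.1 ≠ α then (-s.1 - α, none) else (α + 1, some (α - 1))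
  | some d => if d ≠ α then (d, some (-d - α)) else (-s.1 - α, none)
def stepO (s : ST) : ST :=
  match s.2 with
  | none => (s.1 + 1, some (s.1 - 1))
  | some d => (d, none)

lemma stepC_good : ∀ s α, good s → good (stepC s α) := by decide
lemma stepO_good : ∀ s, good s → good (stepO s) := by decide
lemma stepC_ne1 : ∀ s α, good s → (stepC s α).1 ≠ α := by decide
lemma stepC_ne2 : ∀ s α, good s → (stepC s α).1 ≠ s.1 := by decide
lemma stepO_ne : ∀ s, good s → (stepO s).1 ≠ s.1 := by decide
lemma stepC_shf : ∀ t s α, stepC (shf t s) (α + t) = shf t (stepC s α) := by decide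
lemma stepO_shf : ∀ t s, stepO (shf t s) = shf t (stepO s) := by decide

section
variable {V : Type*} {G : SimpleGraph V} (S : Sys G)

def Sys.early (a b : V) : Prop := a ∉ S.X ∧ S.rk a < S.rk b

open Classical in
noncomputable def Sys.st (ω : V → Z3) (v : V) : ST :=
  if h1 : S.early (S.pv v) v then
    if h2 : S.early (S.m v) v then stepC (Sys.st ω (S.pv v)) (Sys.st ω (S.m v)).1
    else stepO (Sys.st ω (S.pv v))
  else if h2 : S.early (S.m v) v then ((Sys.st ω (S.m v)).1 + 1, none)
  else (ω v, none)
termination_by S.rk v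
decreasing_by
  · exact h1.2
  · exact h2.2
  · exact h1.2
  · exact h2.2

variable {S}
lemma st_cc {ω : V → Z3} {v : V} (h1 : S.early (S.pv v) v) (h2 : S.early (S.m v) v) :
    S.st ω v = stepC (S.st ω (S.pv v)) (S.st ω (S.m v)).1 := by
  rw [Sys.st]; simp [h1, h2]
lemma st_co {ω : V → Z3} {v : V} (h1 : S.early (S.pv v) v) (h2 : ¬ S.early (S.m v) v) :
    S.st ω v = stepO (S.st ω (S.pv v)) := by
  rw [Sys.st]; simp [h1, h2]
lemma st_sc {ω : V → Z3} {v : V} (h1 : ¬ S.early (S.pv v) v) (h2 : S.early (S.m v) v) :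
    S.st ω v = ((S.st ω (S.m v)).1 + 1, none) := by
  rw [Sys.st]; simp [h1, h2]
lemma st_so {ω : V → Z3} {v : V} (h1 : ¬ S.early (S.pv v) v) (h2 : ¬ S.early (S.m v) v) :
    S.st ω v = (ω v, none) := by
  rw [Sys.st]; simp [h1, h2]
lemma st_s {ω : V → Z3} {v : V} (h1 : ¬ S.early (S.pv v) v) : (S.st ω v).2 = none := by
  by_cases h2 : S.early (S.m v) v
  · rw [st_sc h1 h2]
  · rw [st_so h1 h2]

lemma rk_ind (S : Sys G) {P : V → Prop} (h : ∀ v, (∀ w, S.rk w < S.rk v → P w) → P v) (v : V) : P v := by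
  induction hn : S.rk v using Nat.strong_induction_on generalizing v with
  | _ n ih => exact h v (fun w hw => ih (S.rk w) (hn ▸ hw) w rfl)

lemma st_good (ω : V → Z3) (v : V) : good (S.st ω v) := by
  induction v using rk_ind S with
  | h v ih =>
  by_cases h1 : S.early (S.pv v) v
  · by_cases h2 : S.early (S.m v) v
    · rw [st_cc h1 h2]; exact stepC_good _ _ (ih _ h1.2)
    · rw [st_co h1 h2]; exact stepO_good _ (ih _ h1.2)
  · unfold good; rw [st_s h1]; simp

lemma nx_not_early {v : V} (hv : v ∉ S.X) : ¬ S.early (S.nx v) v := by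
  rintro ⟨h1, h2⟩; have := S.hnx v hv h1; omega

lemma st_ne_pv (ω : V → Z3) {v : V} (h1 : S.early (S.pv v) v) :
    (S.st ω v).1 ≠ (S.st ω (S.pv v)).1 := by
  by_cases h2 : S.early (S.m v) v
  · rw [st_cc h1 h2]; exact stepC_ne2 _ _ (st_good _ _)
  · rw [st_co h1 h2]; exact stepO_ne _ (st_good _ _)

lemma st_ne_m (ω : V → Z3) {v : V} (h2 : S.early (S.m v) v) :
    (S.st ω v).1 ≠ (S.st ω (S.m v)).1 := by
  by_cases h1 : S.early (S.pv v) v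
  · rw [st_cc h1 h2]; exact stepC_ne1 _ _ (st_good _ _)
  · rw [st_sc h1 h2]; simp

lemma st_proper (ω : V → Z3) {v w : V} (hv : v ∉ S.X) (hw : w ∉ S.X) (h : G.Adj v w) :
    (S.st ω v).1 ≠ (S.st ω w).1 := by
  wlog hlt : S.rk w < S.rk v generalizing v w
  · exact (this hw hv h.symm (lt_of_le_of_ne (not_lt.1 hlt) (S.hdist _ _ hv hw h))).symm
  have he : S.early w v := ⟨hw, hlt⟩
  rcases (S.adj v hv w).1 h with rfl | rfl | rfl
  · exact st_ne_m ω he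
  · exact absurd he (nx_not_early hv)
  · exact st_ne_pv ω he

/-- the dependency relation -/
def Sys.E1 (S : Sys G) (a b : V) : Prop := b ∉ S.X ∧ S.early a b ∧ (a = S.pv b ∨ a = S.m b)
def Sys.cone (S : Sys G) (v : V) (a : V) : Prop := Relation.ReflTransGen S.E1 a v

lemma E1_adj {a b : V} (h : S.E1 a b) : G.Adj a b ∧ S.rk a < S.rk b := by
  obtain ⟨h1, h2, h3⟩ := h
  refine ⟨?_, h2.2⟩
  have := S.adj b h1 a
  exact (this.2 (by tauto)).symm

lemma cone_down {v a b : V} (h : S.cone v b) (h' : S.E1 a b) : S.cone v a :=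
  Relation.ReflTransGen.head h' h

lemma cone_notX {v a : V} (hv : v ∉ S.X) (h : S.cone v a) : a ∉ S.X := by
  induction h using Relation.ReflTransGen.head_induction_on with
  | refl => exact hv
  | head h1 _ _ => exact h1.2.1.1

lemma cone_wi {v a : V} (h : S.cone v a) : Wi G S.R a v := by
  have : Wi G (S.rk v) a v := by
    induction h with
    | refl => exact Wi.refl _ _
    | tail h1 h2 ih =>
      exact (ih.trans (Wi.of_adj (E1_adj h2).1)).mono (E1_adj h2).2
  exact this.mono (S.rkR v)

lemma cone_disj {v a : V} (hv : v ∉ S.X) (h1 : S.early (S.pv v) v) (h2 : S.early (S.m v) v)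
    (ha : S.cone (S.pv v) a) (hb : S.cone (S.m v) a) : False := by
  have w1 := WA_of_rtg (G := G) (rk := S.rk) (fun _ _ => E1_adj) ha h1.2
  have w2 := WA_of_rtg (G := G) (rk := S.rk) (fun _ _ => E1_adj) hb h2.2
  have w3 := w1.symm.trans w2
  have := bad_of_WA ((S.adj v hv _).2 (by tauto)) ((S.adj v hv _).2 (by tauto)) (S.ne2 v hv).symm w3
  have h3 := S.rkR v
  have := h1.2; have := h2.2
  exact hv (S.hbad v (Bad.mono ‹_› (by omega)))

lemma cone_disj_root {r p q a : V} (hr : r ∈ S.X) (hp : p ∉ S.X) (hq : q ∉ S.X) (hrp : G.Adj r p)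
    (hrq : G.Adj r q) (hpq : p ≠ q) (hrb : ¬ Bad G (2 * S.R + 2) r)
    (ha : S.cone p a) (hb : S.cone q a) : False := by
  classical
  have key : ∀ p, p ∉ S.X → S.cone p a → WA G r S.R a p := by
    intro p hp ha
    have := WA_of_rtg (G := G) (E := S.E1) (rk := fun v => if v ∈ S.X then S.R + 1 else S.rk v) (v := r)
      (a := a) (b := p) ?_ ha ?_
    · obtain ⟨w, h1, h2⟩ := this
      refine ⟨w, h1, ?_⟩
      simp only [hp, if_false] at h2
      exact h2.trans (S.rkR p)
    · intro a b h
      have := E1_adj h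
      simp only [h.1, h.2.1.1, if_false]; exact this
    · simp only [hp, hr, if_false, if_true]
      have := S.rkR p; omega
  have := bad_of_WA hrp hrq hpq ((key p hp ha).symm.trans (key q hq hb))
  exact hrb (this.mono (by omega))

lemma st_indep {ω ω' : V → Z3} {v : V} (hv : v ∉ S.X) (h : ∀ a, S.cone v a → ω a = ω' a) :
    S.st ω v = S.st ω' v := by
  induction v using rk_ind S with
  | h v ih =>
  have a1 : S.early (S.pv v) v → S.st ω (S.pv v) = S.st ω' (S.pv v) := fun h1 =>
    ih _ h1.2 h1.1 (fun a ha => h a (Relation.ReflTransGen.tail ha ⟨hv, h1, by tauto⟩))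
  have a2 : S.early (S.m v) v → S.st ω (S.m v) = S.st ω' (S.m v) := fun h1 =>
    ih _ h1.2 h1.1 (fun a ha => h a (Relation.ReflTransGen.tail ha ⟨hv, h1, by tauto⟩))
  by_cases h1 : S.early (S.pv v) v <;> by_cases h2 : S.early (S.m v) v
  · rw [st_cc h1 h2, st_cc h1 h2, a1 h1, a2 h2]
  · rw [st_co h1 h2, st_co h1 h2, a1 h1]
  · rw [st_sc h1 h2, st_sc h1 h2, a2 h2]
  · rw [st_so h1 h2, st_so h1 h2, h v Relation.ReflTransGen.refl]

lemma st_shift {Z : V → Prop} (hZ : ∀ a b, Z b → S.E1 a b → Z a) {ω ω' : V → Z3} (t : Z3)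
    (h : ∀ a, Z a → ω' a = ω a + t) {v : V} (hv : v ∉ S.X) (hvZ : Z v) :
    S.st ω' v = shf t (S.st ω v) := by
  induction v using rk_ind S with
  | h v ih =>
  have a1 : S.early (S.pv v) v → S.st ω' (S.pv v) = shf t (S.st ω (S.pv v)) := fun h1 =>
    ih _ h1.2 h1.1 (hZ _ _ hvZ ⟨hv, h1, by tauto⟩)
  have a2 : S.early (S.m v) v → S.st ω' (S.m v) = shf t (S.st ω (S.m v)) := fun h1 =>
    ih _ h1.2 h1.1 (hZ _ _ hvZ ⟨hv, h1, by tauto⟩)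
  by_cases h1 : S.early (S.pv v) v <;> by_cases h2 : S.early (S.m v) v
  · rw [st_cc h1 h2, st_cc h1 h2, a1 h1, a2 h2, ← stepC_shf]; rfl
  · rw [st_co h1 h2, st_co h1 h2, a1 h1, stepO_shf]
  · rw [st_sc h1 h2, st_sc h1 h2, a2 h2]; simp [shf]; ring
  · rw [st_so h1 h2, st_so h1 h2, h v hvZ]; simp [shf]

lemma pv_nx {v : V} (hv : v ∉ S.X) (hn : S.nx v ∉ S.X) : S.pv (S.nx v) = v := by
  have hadj : G.Adj (S.nx v) v := ((S.adj v hv _).2 (by tauto)).symm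
  rcases (S.adj _ hn v).1 hadj with h | h | h
  · have := congrArg S.m h
    rw [S.hm] at this
    exact absurd this (S.ne1 v hv)
  · have h1 := S.hnx v hv hn
    have h2 := S.hnx _ hn (h ▸ hv)
    rw [← h] at h2; omega
  · exact h.symm

lemma early_pv_nx {v : V} (hv : v ∉ S.X) (hn : S.nx v ∉ S.X) : S.early (S.pv (S.nx v)) (S.nx v) := by
  rw [pv_nx hv hn]; exact ⟨hv, S.hnx v hv hn⟩

lemma nx_pv {v : V} (hv : v ∉ S.X) (h1 : S.early (S.pv v) v) (h2 : S.early (S.pv (S.pv v)) (S.pv v)) :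
    S.nx (S.pv v) = v := by
  have hadj : G.Adj (S.pv v) v := ((S.adj v hv _).2 (by tauto)).symm
  rcases (S.adj _ h1.1 v).1 hadj with h | h | h
  · have := congrArg S.m h
    rw [S.hm] at this
    exact absurd this (S.ne2 v hv)
  · exact h.symm
  · have := h2.2; rw [← h] at this
    have := h1.2; omega
end
end Sud

open SimpleGraph Finset

namespace Sud

lemma dA1 : ∀ s α, good s → s.2 ≠ none → (stepC s α).2 = none → s.2 ≠ some (stepC s α).1 := by decide
lemma dA2 : ∀ s α, good s → (stepC s α).2 = none → s.1 ≠ α := by decide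
lemma dA3 : ∀ s, (stepO s).2 = none → s.2 ≠ none := by decide
lemma dB1 : ∀ s α d, good s → (stepC s α).2 = some d → d ≠ α := by decide
lemma dB2 : ∀ s d, (stepO s).2 = some d → s.2 = none ∧ s.1 ≠ d := by decide
lemma third0 : ∀ a b x y : Z3, (a ≠ b ∧ x ≠ a ∧ x ≠ b ∧ y ≠ a ∧ y ≠ b) → y = x := by decide
lemma third (a b x y : Z3) (h1 : a ≠ b) (h2 : x ≠ a) (h3 : x ≠ b) (h4 : y ≠ a) (h5 : y ≠ b) : y = x :=
  third0 a b x y ⟨h1, h2, h3, h4, h5⟩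

section
variable {V : Type*} {G : SimpleGraph V} {S : Sys G} 

lemma forced (ω : V → Z3) (c1 c2 : V → Z3) (h1 : ∀ v w, G.Adj v w → c1 v ≠ c1 w)
    (h2 : ∀ v w, G.Adj v w → c2 v ≠ c2 w) (hc : ∀ v, v ∉ S.X → c1 v = (S.st ω v).1)
    (hX : ∀ v ∈ S.X, c2 v = c1 v)
    (hsrc : ∀ v, v ∉ S.X → ¬ S.early (S.pv v) v → c2 v = c1 v)
    (hO : ∀ v, v ∉ S.X → S.early (S.pv v) v → ¬ S.early (S.m v) v → (S.st ω (S.pv v)).2 ≠ none →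
      c2 v = c1 v)
    (hE : ∀ v, v ∉ S.X → (S.st ω v).2 ≠ none → S.nx v ∈ S.X → c2 v = c1 v)
    (hF : ∀ v, v ∉ S.X → (S.st ω v).2 ≠ none → S.nx v ∉ S.X →
      (S.st ω v).2 ≠ some (S.st ω (S.nx v)).1 → c2 v = c1 v) : ∀ v, c2 v = c1 v := by
  have two : ∀ v u w, G.Adj v u → G.Adj v w → c2 u = c1 u → c2 w = c1 w → c1 u ≠ c1 w →
      c2 v = c1 v := by
    intro v u w hu hw e1 e2 hne
    refine third (c1 u) (c1 w) _ _ hne (h1 _ _ hu) (h1 _ _ hw) ?_ ?_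
    · rw [← e1]; exact h2 _ _ hu
    · rw [← e2]; exact h2 _ _ hw
  suffices H : ∀ n v, v ∉ S.X → S.β v = n → c2 v = c1 v by
    intro v
    by_cases hv : v ∈ S.X
    · exact hX v hv
    · exact H _ v hv rfl
  intro n
  induction n using Nat.strong_induction_on with
  | _ n IH =>
  have am : ∀ v, v ∉ S.X → G.Adj v (S.m v) := fun v hv => (S.adj v hv _).2 (by tauto)
  have ap : ∀ v, v ∉ S.X → G.Adj v (S.pv v) := fun v hv => (S.adj v hv _).2 (by tauto)
  have an : ∀ v, v ∉ S.X → G.Adj v (S.nx v) := fun v hv => (S.adj v hv _).2 (by tauto)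
  have km : ∀ v, v ∉ S.X → S.β v = n → S.early (S.m v) v → c2 (S.m v) = c1 (S.m v) := by
    intro v hv hb he
    exact IH _ (hb ▸ S.hch v hv he.1 he.2) _ he.1 rfl
  have A : ∀ v, v ∉ S.X → S.β v = n → (S.st ω v).2 = none → c2 v = c1 v := by
    intro v
    induction v using rk_ind S with
    | h v ih =>
    intro hv hb hs
    by_cases e1 : S.early (S.pv v) v
    · have hbp : S.β (S.pv v) = n := by rw [S.hpv v hv e1.1, hb]
      by_cases e2 : S.early (S.m v) v
      · rw [st_cc e1 e2] at hs
        have kp : c2 (S.pv v) = c1 (S.pv v) := by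
          by_cases hp : (S.st ω (S.pv v)).2 = none
          · exact ih _ e1.2 e1.1 hbp hp
          · have e3 : S.early (S.pv (S.pv v)) (S.pv v) := by
              by_contra h; exact hp (st_s h)
            have hn := nx_pv hv e1 e3
            refine hF _ e1.1 hp (by rw [hn]; exact hv) ?_
            rw [hn, st_cc e1 e2]
            exact dA1 _ _ (st_good _ _) hp hs
        refine two v _ _ (ap v hv) (am v hv) kp (km v hv hb e2) ?_
        rw [hc _ e1.1, hc _ e2.1]
        exact dA2 _ _ (st_good _ _) hs
      · rw [st_co e1 e2] at hs
        exact hO v hv e1 e2 (dA3 _ hs)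
    · exact hsrc v hv e1
  suffices B : ∀ k v, v ∉ S.X → S.β v = n → S.R - S.rk v = k → c2 v = c1 v by
    intro v hv hb; exact B _ v hv hb rfl
  intro k
  induction k using Nat.strong_induction_on with
  | _ k IHk =>
  intro v hv hb hk
  rcases hs : (S.st ω v).2 with _ | d
  · exact A v hv hb hs
  have hs' : (S.st ω v).2 ≠ none := by simp [hs]
  have e1 : S.early (S.pv v) v := by
    by_contra h; exact hs' (st_s h)
  by_cases hn : S.nx v ∈ S.X
  · exact hE v hv hs' hn
  by_cases hf : (S.st ω v).2 = some (S.st ω (S.nx v)).1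
  swap
  · exact hF v hv hs' hn hf
  have hd : d = (S.st ω (S.nx v)).1 := by rw [hs] at hf; simpa using hf
  have hnb : S.β (S.nx v) = n := by rw [S.hnxb v hv hn, hb]
  have hrk := S.hnx v hv hn
  have hR := S.rkR (S.nx v)
  have kn : c2 (S.nx v) = c1 (S.nx v) := IHk (S.R - S.rk (S.nx v)) (by omega) _ hn hnb rfl
  by_cases e2 : S.early (S.m v) v
  · refine two v _ _ (an v hv) (am v hv) kn (km v hv hb e2) ?_
    rw [hc _ hn, hc _ e2.1, ← hd]
    rw [st_cc e1 e2] at hs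
    exact dB1 _ _ _ (st_good _ _) hs
  · rw [st_co e1 e2] at hs
    obtain ⟨h3, h4⟩ := dB2 _ _ hs
    have kp := A _ e1.1 (by rw [S.hpv v hv e1.1, hb]) h3
    refine two v _ _ (an v hv) (ap v hv) kn kp ?_
    rw [hc _ hn, hc _ e1.1, ← hd]
    exact h4.symm
end
end Sud

open SimpleGraph Finset

namespace Sud
lemma dF1 : ∀ s α, (stepC s α).2 = none → s.2 ≠ none → α = crit s := by decide
lemma dF2 : ∀ s α, (stepC s α).2 ≠ none → s.2 = none → α = crit s := by decide
lemma dF3 : ∀ s, s.2 ≠ none → s.2 = some (stepO s).1 := by decide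
lemma dF4 : ∀ s α, s.2 ≠ none → (stepC s α).2 ≠ none → s.2 = some (stepC s α).1 := by decide
lemma dF5 : ∀ s, s.2 ≠ none → (stepO s).2 = none := by decide
lemma dF6 : ∀ t s, crit (shf t s) = crit s + t := by decide
section
open Classical
variable {V : Type*} [Fintype V] {G : SimpleGraph V} (S : Sys G) 

noncomputable def Sys.src : Finset V := univ.filter (fun v => v ∉ S.X ∧ ¬ S.early (S.pv v) v)
noncomputable def Sys.cl : Finset V := univ.filter (fun v => v ∉ S.X ∧ S.early (S.m v) v)
noncomputable def Sys.op : Finset V := univ.filter (fun v => v ∉ S.X ∧ ¬ S.early (S.m v) v)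
noncomputable def Sys.nX : Finset V := univ.filter (fun v => v ∉ S.X ∧ S.nx v ∈ S.X)
noncomputable def Sys.Os (ω : V → Z3) : Finset V := univ.filter (fun v => v ∉ S.X ∧
  S.early (S.pv v) v ∧ ¬ S.early (S.m v) v ∧ (S.st ω (S.pv v)).2 ≠ none)
noncomputable def Sys.Es (ω : V → Z3) : Finset V := univ.filter (fun v => v ∉ S.X ∧
  (S.st ω v).2 ≠ none ∧ S.nx v ∈ S.X)
noncomputable def Sys.Fl (ω : V → Z3) : Finset V := univ.filter (fun v => v ∉ S.X ∧
  (S.st ω v).2 ≠ none ∧ S.nx v ∉ S.X ∧ (S.st ω v).2 ≠ some (S.st ω (S.nx v)).1)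
noncomputable def Sys.LR (ω : V → Z3) : Finset V := univ.filter (fun v => v ∉ S.X ∧
  S.early (S.pv v) v ∧ (S.st ω (S.pv v)).2 ≠ none ∧ (S.st ω v).2 = none)
noncomputable def Sys.RL (ω : V → Z3) : Finset V := univ.filter (fun v => v ∉ S.X ∧
  S.early (S.pv v) v ∧ (S.st ω (S.pv v)).2 = none ∧ (S.st ω v).2 ≠ none)
noncomputable def Sys.fa (ω : V → Z3) : Finset V := univ.filter (fun v => v ∉ S.X ∧
  S.early (S.pv v) v ∧ S.early (S.m v) v ∧ (S.st ω (S.m v)).1 = crit (S.st ω (S.pv v)))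
variable {S}

lemma card_nX (hG : Cub G) : S.nX.card ≤ 3 * S.X.card := by
  have : S.nX ⊆ S.X.biUnion (fun x => univ.filter (fun v => G.Adj x v)) := by
    intro v hv
    simp [Sys.nX] at hv ⊢
    exact ⟨S.nx v, hv.2, ((S.adj v hv.1 _).2 (by tauto)).symm⟩
  refine (card_le_card this).trans (card_biUnion_le.trans ?_)
  rw [mul_comm]
  refine sum_le_card_nsmul _ _ _ (fun x _ => ?_)
  have := hG x
  rw [Set.ncard_eq_toFinset_card'] at this
  rw [← this]
  apply card_le_card
  intro y; simp

lemma card_src (hG : Cub G) : S.src.card ≤ S.nX.card := by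
  have h1 : (univ.filter (fun v => v ∉ S.X ∧ S.nx v ∉ S.X)).card ≤
      (univ.filter (fun v => v ∉ S.X ∧ S.early (S.pv v) v)).card := by
    apply card_le_card_of_injOn S.nx
    · intro v hv
      simp at hv ⊢
      exact ⟨hv.2, early_pv_nx hv.1 hv.2⟩
    · intro v hv w hw h
      simp at hv hw
      rw [← pv_nx hv.1 hv.2, h, pv_nx hw.1 hw.2]
  have h2 := card_filter_add_card_filter_not (s := univ.filter (fun v => v ∉ S.X)) (fun v => S.nx v ∈ S.X)
  have h3 := card_filter_add_card_filter_not (s := univ.filter (fun v => v ∉ S.X)) (fun v => S.early (S.pv v) v)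
  simp only [filter_filter] at h2 h3
  unfold Sys.src Sys.nX
  omega

lemma card_cl : 2 * S.cl.card ≤ Fintype.card V := by
  have h1 : S.cl.card ≤ S.clᶜ.card := by
    apply card_le_card_of_injOn S.m
    · intro v hv
      simp [Sys.cl] at hv ⊢
      intro _ h
      rw [S.hm] at h
      have := h.2; have := hv.2.2; omega
    · intro v hv w hw h
      rw [← S.hm v, h, S.hm]
  have h2 := card_add_card_compl S.cl
  omega

lemma card_op : S.op.card ≤ S.cl.card + S.X.card := by
  have : S.op.card ≤ (S.cl ∪ S.X).card := by
    apply card_le_card_of_injOn S.m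
    · intro v hv
      simp [Sys.op, Sys.cl] at hv ⊢
      by_cases h : S.m v ∈ S.X
      · exact Or.inr h
      · refine Or.inl ⟨h, ?_⟩
        rw [S.hm]
        refine ⟨hv.1, ?_⟩
        have h1 := S.hdist v _ hv.1 h ((S.adj v hv.1 _).2 (by tauto))
        have h2 : ¬ S.rk (S.m v) < S.rk v := fun h' => hv.2 ⟨h, h'⟩
        omega
    · intro v hv w hw h
      rw [← S.hm v, h, S.hm]
  exact this.trans (card_union_le _ _)

lemma card_LR_RL (ω : V → Z3) : (S.LR ω).card ≤ (S.RL ω).card := by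
  have h1 : (univ.filter (fun v => v ∉ S.X ∧ S.early (S.pv v) v ∧ (S.st ω (S.pv v)).2 ≠ none)).card
      ≤ (univ.filter (fun v => v ∉ S.X ∧ S.early (S.pv v) v ∧ (S.st ω v).2 ≠ none)).card := by
    have key : ∀ v, v ∉ S.X → S.early (S.pv v) v → (S.st ω (S.pv v)).2 ≠ none →
        S.early (S.pv (S.pv v)) (S.pv v) := by
      intro v _ _ h; by_contra h'; exact h (st_s h')
    apply card_le_card_of_injOn S.pv
    · intro v hv
      simp only [coe_filter, mem_univ, true_and, Set.mem_ofPred_eq] at hv ⊢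
      exact ⟨hv.2.1.1, key v hv.1 hv.2.1 hv.2.2, hv.2.2⟩
    · intro v hv w hw h
      simp only [coe_filter, mem_univ, true_and, Set.mem_ofPred_eq] at hv hw
      rw [← nx_pv hv.1 hv.2.1 (key v hv.1 hv.2.1 hv.2.2), h,
        nx_pv hw.1 hw.2.1 (key w hw.1 hw.2.1 hw.2.2)]
  have h2 := card_filter_add_card_filter_not (s := univ.filter (fun v => v ∉ S.X ∧ S.early (S.pv v) v ∧ (S.st ω (S.pv v)).2 ≠ none)) (fun v => (S.st ω v).2 = none)
  have h3 := card_filter_add_card_filter_not (s := univ.filter (fun v => v ∉ S.X ∧ S.early (S.pv v) v ∧ (S.st ω v).2 ≠ none)) (fun v => (S.st ω (S.pv v)).2 = none)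
  simp only [filter_filter] at h2 h3
  have e1 : (S.LR ω) = univ.filter (fun v => (v ∉ S.X ∧ S.early (S.pv v) v ∧ (S.st ω (S.pv v)).2 ≠ none) ∧ (S.st ω v).2 = none) := by
    unfold Sys.LR; congr 1; ext; tauto
  have e2 : (S.RL ω) = univ.filter (fun v => (v ∉ S.X ∧ S.early (S.pv v) v ∧ (S.st ω v).2 ≠ none) ∧ (S.st ω (S.pv v)).2 = none) := by
    unfold Sys.RL; congr 1; ext; tauto
  have e3 : univ.filter (fun v => (v ∉ S.X ∧ S.early (S.pv v) v ∧ (S.st ω (S.pv v)).2 ≠ none) ∧ ¬ (S.st ω v).2 = none) = univ.filter (fun v => (v ∉ S.X ∧ S.early (S.pv v) v ∧ (S.st ω v).2 ≠ none) ∧ ¬ (S.st ω (S.pv v)).2 = none) := by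
    congr 1; ext; tauto
  rw [e1, e2]
  rw [e3] at h2
  omega

lemma card_LR2 (ω : V → Z3) : 2 * (S.LR ω).card ≤ S.op.card + (S.fa ω).card := by
  have h1 := card_LR_RL (S := S) ω
  have hd : Disjoint (S.LR ω) (S.RL ω) := by
    rw [Finset.disjoint_left]
    intro v; simp [Sys.LR, Sys.RL]; intros; tauto
  have h2 := card_union_of_disjoint hd
  have h3 : S.LR ω ∪ S.RL ω ⊆ S.op ∪ S.fa ω := by
    intro v hv
    simp only [mem_union, Sys.LR, Sys.RL, Sys.op, Sys.fa, mem_filter, mem_univ, true_and] at hv ⊢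
    by_cases h : S.early (S.m v) v
    · right
      rcases hv with ⟨a, b, d, e⟩ | ⟨a, b, d, e⟩
      · rw [st_cc b h] at e; exact ⟨a, b, h, dF1 _ _ e d⟩
      · rw [st_cc b h] at e; exact ⟨a, b, h, dF2 _ _ e d⟩
    · left; exact ⟨by tauto, h⟩
  have h4 := (card_le_card h3).trans (card_union_le _ _)
  omega

lemma card_OF (ω : V → Z3) : (S.Os ω).card + (S.Fl ω).card ≤ (S.LR ω).card := by
  have h1 : (S.Fl ω).card ≤ ((S.LR ω).filter (fun v => S.early (S.m v) v)).card := by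
    apply card_le_card_of_injOn S.nx
    · intro v hv
      simp only [Sys.Fl, Sys.LR, coe_filter, mem_filter, mem_univ, true_and, Set.mem_ofPred_eq] at hv ⊢
      obtain ⟨a, b, d, e⟩ := hv
      have h2 := early_pv_nx a d
      have h3 := pv_nx a d
      by_cases h : S.early (S.m (S.nx v)) (S.nx v)
      · refine ⟨⟨d, h2, by rw [h3]; exact b, ?_⟩, h⟩
        by_contra h'
        rw [st_cc h2 h, h3] at h' e
        exact e (dF4 _ _ b h')
      · rw [st_co h2 h, h3] at e
        exact absurd (dF3 _ b) e
    · intro v hv w hw h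
      simp only [Sys.Fl, coe_filter, mem_univ, true_and, Set.mem_ofPred_eq] at hv hw
      rw [← pv_nx hv.1 hv.2.2.1, h, pv_nx hw.1 hw.2.2.1]
  have h2 : (S.Os ω).card ≤ ((S.LR ω).filter (fun v => ¬ S.early (S.m v) v)).card := by
    apply card_le_card
    intro v hv
    simp only [Sys.Os, Sys.LR, mem_filter, mem_univ, true_and] at hv ⊢
    obtain ⟨a, b, d, e⟩ := hv
    refine ⟨⟨a, b, e, ?_⟩, d⟩
    rw [st_co b d]; exact dF5 _ e
  have h3 := card_filter_add_card_filter_not (s := S.LR ω) (fun v => S.early (S.m v) v)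
  omega

noncomputable def Sys.T (S : Sys G) (ω : V → Z3) : Finset V := S.X ∪ S.src ∪ S.Es ω ∪ (S.Os ω ∪ S.Fl ω)

lemma card_T (hG : Cub G) (ω : V → Z3) : 2 * (S.T ω).card ≤ 15 * S.X.card + S.cl.card + (S.fa ω).card := by
  have h1 := card_nX (S := S) hG
  have h2 := card_src (S := S) hG
  have h3 := card_op (S := S)
  have h4 := card_LR2 (S := S) ω
  have h5 := card_OF (S := S) ω
  have h6 : (S.Es ω).card ≤ S.nX.card := by
    apply card_le_card; intro v; simp [Sys.Es, Sys.nX]; tauto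
  have := card_union_le (S.X ∪ S.src ∪ S.Es ω) (S.Os ω ∪ S.Fl ω)
  have := card_union_le (S.X ∪ S.src) (S.Es ω)
  have := card_union_le S.X S.src
  have := card_union_le (S.Os ω) (S.Fl ω)
  unfold Sys.T
  omega

lemma forcedT (ω : V → Z3) (c1 c2 : V → Z3) (h1 : ∀ v w, G.Adj v w → c1 v ≠ c1 w)
    (h2 : ∀ v w, G.Adj v w → c2 v ≠ c2 w) (hc : ∀ v, v ∉ S.X → c1 v = (S.st ω v).1)
    (hT : ∀ v ∈ S.T ω, c2 v = c1 v) : ∀ v, c2 v = c1 v := by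
  simp only [Sys.T, mem_union, Sys.src, Sys.Es, Sys.Os, Sys.Fl, mem_filter, mem_univ, true_and] at hT
  apply forced ω c1 c2 h1 h2 hc
  · intro v h; apply hT; tauto
  · intro v _ _; apply hT; tauto
  · intro v _ _ _ _; apply hT; tauto
  · intro v _ _ _; apply hT; tauto
  · intro v _ _ _ _; apply hT; tauto
end
end Sud

open SimpleGraph Finset

namespace Sud
section
open Classical
variable {V : Type*} [Fintype V] {G : SimpleGraph V} {S : Sys G} 

noncomputable def shZ (Z : V → Prop) (t : Z3) (ω : V → Z3) : V → Z3 := fun a => if Z a then ω a + t else ω a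

lemma shZ_in {v : V} (hv : v ∉ S.X) (t : Z3) (ω : V → Z3) :
    S.st (shZ (S.cone v) t ω) v = shf t (S.st ω v) := by
  apply st_shift (Z := S.cone v) (fun a b h h' => cone_down h h') t _ hv Relation.ReflTransGen.refl
  intro a ha; simp [shZ, ha]

lemma shZ_out {v w : V} (hw : w ∉ S.X) (t : Z3) (ω : V → Z3)
    (h : ∀ a, S.cone v a → S.cone w a → False) :
    S.st (shZ (S.cone v) t ω) w = S.st ω w := by
  apply st_indep hw
  intro a ha
  have : ¬ S.cone v a := fun h' => h a h' ha
  simp [shZ, this]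

noncomputable def Om (S : Sys G) (p q : V) : Finset (V → Z3) :=
  univ.filter (fun ω => (S.st ω p).1 = (S.st ω q).1)

lemma Om_ne {p q : V} (hp : p ∉ S.X) (hq : q ∉ S.X) (h : ∀ a, S.cone p a → S.cone q a → False) :
    (Om S p q).Nonempty := by
  refine ⟨shZ (S.cone p) ((S.st (fun _ => 0) q).1 - (S.st (fun _ => 0) p).1) (fun _ => 0), ?_⟩
  simp only [Om, mem_filter, mem_univ, true_and]
  rw [shZ_in hp, shZ_out hq _ _ h]
  simp [shf]

lemma fail_count {p q v : V} (hp : p ∉ S.X) (hq : q ∉ S.X) (hv : v ∉ S.X) (h1 : S.early (S.pv v) v)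
    (h2 : S.early (S.m v) v) (hdp : ∀ a, S.cone (S.m v) a → S.cone p a → False)
    (hdq : ∀ a, S.cone (S.m v) a → S.cone q a → False) :
    ((Om S p q).filter (fun ω => v ∈ S.fa ω)).card * 3 ≤ (Om S p q).card := by
  have h3 : (((Om S p q).filter (fun ω => v ∈ S.fa ω)) ×ˢ (univ : Finset Z3)).card ≤ (Om S p q).card := by
    apply card_le_card_of_injOn (fun x => shZ (S.cone (S.m v)) x.2 x.1)
    · rintro ⟨ω, t⟩ h
      simp only [coe_product, Set.mem_prod, mem_coe, Om, mem_filter, mem_univ, true_and] at h ⊢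
      rw [shZ_out hp _ _ hdp, shZ_out hq _ _ hdq]
      exact h.1.1
    · rintro ⟨ω, t⟩ h ⟨ω', t'⟩ h' heq
      simp only [coe_product, Set.mem_prod, mem_coe, Om, mem_filter, mem_univ, true_and, Sys.fa] at h h'
      simp only at heq
      have hpv : ∀ a, S.cone (S.m v) a → S.cone (S.pv v) a → False := fun a b c => cone_disj hv h1 h2 c b
      have e1 := shZ_out h1.1 t ω hpv
      have e2 := shZ_out h1.1 t' ω' hpv
      rw [heq, e2] at e1
      have e3 := shZ_in h2.1 t ω
      have e4 := shZ_in h2.1 t' ω'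
      rw [heq, e4] at e3
      have e5 := congrArg Prod.fst e3
      simp only [shf] at e5
      rw [h.1.2.2.2.2, h'.1.2.2.2.2, e1] at e5
      have e6 : t' = t := by simpa using e5
      subst e6
      have : ω = ω' := by
        funext a
        have := congrFun heq a
        by_cases hc : S.cone (S.m v) a <;> simpa [shZ, hc] using this
      rw [this]
  simpa using h3

lemma exists_omega (hG : Cub G) {p q : V} (hp : p ∉ S.X) (hq : q ∉ S.X)
    (hd : ∀ a, S.cone p a → S.cone q a → False) :
    ∃ ω, (S.st ω p).1 = (S.st ω q).1 ∧ 3 * (S.fa ω).card ≤ S.cl.card + 6 * 4 ^ (2 * S.R + 1) := by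
  by_contra hcon
  push Not at hcon
  have hne := Om_ne hp hq hd
  have h1 : ∀ ω ∈ Om S p q, S.cl.card + 6 * 4 ^ (2 * S.R + 1) < 3 * (S.fa ω).card := by
    intro ω hω; exact hcon ω (by simpa [Om] using hω)
  have h2 := sum_lt_sum_of_nonempty hne h1
  simp only [sum_const, smul_eq_mul] at h2
  have h3 : ∑ ω ∈ Om S p q, 3 * (S.fa ω).card = ∑ v : V, 3 * ((Om S p q).filter (fun ω => v ∈ S.fa ω)).card := by
    rw [← mul_sum, ← mul_sum]
    congr 1
    have := sum_card_bipartiteAbove_eq_sum_card_bipartiteBelow (s := Om S p q) (t := (univ : Finset V)) (fun ω v => v ∈ S.fa ω)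
    simp only [bipartiteAbove, bipartiteBelow] at this
    rw [← this]
    refine sum_congr rfl (fun ω _ => ?_)
    congr 1; ext; simp
  set Bd := Ball G (2 * S.R + 1) p ∪ Ball G (2 * S.R + 1) q with hBd
  have h4 : ∀ v : V, 3 * ((Om S p q).filter (fun ω => v ∈ S.fa ω)).card ≤
      (if v ∈ S.cl then (Om S p q).card else 0) + (if v ∈ Bd then 3 * (Om S p q).card else 0) := by
    intro v
    by_cases hv : v ∈ Bd
    · simp only [hv, if_true]
      have := card_filter_le (Om S p q) (fun ω => v ∈ S.fa ω)
      omega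
    · by_cases hc : v ∉ S.X ∧ S.early (S.pv v) v ∧ S.early (S.m v) v
      · obtain ⟨a, b, c⟩ := hc
        have : v ∈ S.cl := by simp [Sys.cl, a, c]
        simp only [this, if_true, hv, if_false]
        have am : Wi G 1 (S.m v) v := (Wi.of_adj ((S.adj v a _).2 (by tauto))).symm
        rw [hBd, mem_union, mem_Ball, mem_Ball] at hv
        have := fail_count hp hq a b c (fun x hx hx' => hv (Or.inl ?_)) (fun x hx hx' => hv (Or.inr ?_))
        · omega
        · exact (((cone_wi hx').symm.trans (cone_wi hx)).trans am).mono (by omega)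
        · exact (((cone_wi hx').symm.trans (cone_wi hx)).trans am).mono (by omega)
      · have : (Om S p q).filter (fun ω => v ∈ S.fa ω) = ∅ := by
          apply filter_eq_empty_iff.2
          intro ω _ h
          simp only [Sys.fa, mem_filter, mem_univ, true_and] at h
          tauto
        rw [this]; simp
  have h5 := sum_le_sum (s := (univ : Finset V)) (fun v _ => h4 v)
  rw [← h3, sum_add_distrib, ← sum_filter, ← sum_filter] at h5
  simp only [sum_const, smul_eq_mul, filter_mem_eq_inter, univ_inter] at h5
  have h6 : Bd.card ≤ 2 * 4 ^ (2 * S.R + 1) := by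
    rw [hBd]
    have := card_union_le (Ball G (2 * S.R + 1) p) (Ball G (2 * S.R + 1) q)
    have := Ball_card hG (2 * S.R + 1) p
    have := Ball_card hG (2 * S.R + 1) q
    omega
  have h7 : Bd.card * (3 * (Om S p q).card) ≤ (2 * 4 ^ (2 * S.R + 1)) * (3 * (Om S p q).card) := by gcongr
  nlinarith

theorem core (S : Sys G) (hG : Cub G) {r p q : V} (hr : r ∈ S.X) (hp : p ∉ S.X) (hq : q ∉ S.X) (hrp : G.Adj r p)
    (hrq : G.Adj r q) (hpq : p ≠ q) (hrb : ¬ Bad G (2 * S.R + 2) r) :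
    ∃ c : V → Z3, c p = c q ∧ (∀ v w, v ∉ S.X → w ∉ S.X → G.Adj v w → c v ≠ c w) ∧
      ∃ T : Finset V, 12 * T.card ≤ 4 * Fintype.card V + 90 * S.X.card + 12 * 4 ^ (2 * S.R + 1) ∧
      ∀ c1 c2 : V → Z3, (∀ v w, G.Adj v w → c1 v ≠ c1 w) → (∀ v w, G.Adj v w → c2 v ≠ c2 w) →
        (∀ v, v ∉ S.X → c1 v = c v) → (∀ v ∈ T, c2 v = c1 v) → ∀ v, c2 v = c1 v := by
  obtain ⟨ω, h1, h2⟩ := exists_omega (S := S) hG hp hq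
    (fun a ha hb => cone_disj_root hr hp hq hrp hrq hpq hrb ha hb)
  refine ⟨fun v => (S.st ω v).1, h1, fun v w hv hw h => st_proper ω hv hw h, S.T ω, ?_, ?_⟩
  · have := card_T (S := S) hG ω
    have := card_cl (S := S)
    omega
  · intro c1 c2 a b c d
    exact forcedT ω c1 c2 a b c d
end
end Sud

open SimpleGraph Finset

namespace Sud
lemma avoid2 : ∀ a b : Z3, ∃ k, k ≠ a ∧ k ≠ b := by decide

def ConTo {V : Type*} (G : SimpleGraph V) (X : Finset V) (r : V) : Prop :=
  ∀ x ∈ X, ∃ w : G.Walk x r, ∀ y ∈ w.support, y ∈ X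

section
variable {V : Type*} {G : SimpleGraph V}

lemma nbr_two (hG : Cub G) {x y : V} (h : G.Adj x y) : ∃ a b, ∀ w, G.Adj x w → w = y ∨ w = a ∨ w = b := by
  obtain ⟨a, b, c, _, _, _, h1⟩ := hG.exists3 x
  rcases (h1 y).1 h with rfl | rfl | rfl
  · exact ⟨b, c, fun w hw => (h1 w).1 hw⟩
  · exact ⟨a, c, fun w hw => by have := (h1 w).1 hw; tauto⟩
  · exact ⟨a, b, fun w hw => by have := (h1 w).1 hw; tauto⟩

lemma root_col (hG : Cub G) {r p q : V} (hp : G.Adj r p) (hq : G.Adj r q) (hpq : p ≠ q) (c : V → Z3)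
    (hc : c p = c q) : ∃ k, ∀ w, G.Adj r w → k ≠ c w := by
  obtain ⟨a, b, c', h12, h13, h23, h1⟩ := hG.exists3 r
  have : ∃ z, ∀ w, G.Adj r w → w = p ∨ w = q ∨ w = z := by
    rcases (h1 p).1 hp with rfl | rfl | rfl <;> rcases (h1 q).1 hq with rfl | rfl | rfl
    · exact absurd rfl hpq
    · exact ⟨c', fun w hw => by have := (h1 w).1 hw; tauto⟩
    · exact ⟨b, fun w hw => by have := (h1 w).1 hw; tauto⟩
    · exact ⟨c', fun w hw => by have := (h1 w).1 hw; tauto⟩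
    · exact absurd rfl hpq
    · exact ⟨a, fun w hw => by have := (h1 w).1 hw; tauto⟩
    · exact ⟨b, fun w hw => by have := (h1 w).1 hw; tauto⟩
    · exact ⟨a, fun w hw => by have := (h1 w).1 hw; tauto⟩
    · exact absurd rfl hpq
  obtain ⟨z, hz⟩ := this
  obtain ⟨k, hk1, hk2⟩ := avoid2 (c p) (c z)
  refine ⟨k, fun w hw => ?_⟩
  rcases hz w hw with rfl | rfl | rfl
  · exact hk1
  · rw [← hc]; exact hk1
  · exact hk2

lemma ext_aux (hG : Cub G) {r p q : V} (hp : G.Adj r p) (hq : G.Adj r q) (hpq : p ≠ q) (d : V → ℕ) (n : ℕ) :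
    ∀ (U : Finset V) (c : V → Z3), U.card = n → r ∈ U → p ∉ U → q ∉ U → c p = c q →
      (∀ x ∈ U, x ≠ r → ∃ y ∈ U, G.Adj x y ∧ d y < d x) →
      (∀ v w, v ∉ U → w ∉ U → G.Adj v w → c v ≠ c w) →
      ∃ c' : V → Z3, (∀ v, v ∉ U → c' v = c v) ∧ ∀ v w, G.Adj v w → c' v ≠ c' w := by
  classical
  induction n with
  | zero =>
    intro U c hU hr
    rw [Finset.card_eq_zero] at hU; subst hU; simp at hr
  | succ n ih =>
    intro U c hU hr hpU hqU hc hs hprop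
    -- colouring one vertex
    have upd : ∀ x k, x ∈ U → (∀ w, G.Adj x w → w ∉ U → k ≠ c w) → 
        ∀ v w, v ∉ U.erase x → w ∉ U.erase x → G.Adj v w →
          Function.update c x k v ≠ Function.update c x k w := by
      intro x k hx hk v w hv hw hvw
      simp only [mem_erase, not_and] at hv hw
      by_cases h1 : v = x
      · subst h1
        have h2 : w ≠ v := hvw.ne'
        simp [h2]
        exact hk w hvw (hw h2)
      · by_cases h2 : w = x
        · subst h2
          simp [h1]
          exact (hk v hvw.symm (hv h1)).symm
        · simp [h1, h2]; exact hprop v w (hv h1) (hw h2) hvw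
    by_cases hUr : (U.erase r).Nonempty
    · obtain ⟨x, hx, hmax⟩ := exists_max_image (U.erase r) d hUr
      simp only [mem_erase] at hx
      obtain ⟨y, hy, hxy, hdy⟩ := hs x hx.2 hx.1
      obtain ⟨a, b, hab⟩ := nbr_two hG hxy
      obtain ⟨k, hk1, hk2⟩ := avoid2 (c a) (c b)
      have hk : ∀ w, G.Adj x w → w ∉ U → k ≠ c w := by
        intro w hw hwU
        rcases hab w hw with rfl | rfl | rfl
        · exact absurd hy hwU
        · exact hk1
        · exact hk2
      have hpx : p ≠ x := by rintro rfl; exact hpU hx.2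
      have hqx : q ≠ x := by rintro rfl; exact hqU hx.2
      obtain ⟨c', h1, h2⟩ := ih (U.erase x) (Function.update c x k) (by rw [card_erase_of_mem hx.2]; omega)
        (by simp [hr]; exact fun h => hx.1 h.symm) (by simp [hpU]) (by simp [hqU]) (by simp [hpx, hqx, hc])
        (by
          intro z hz hzr
          simp only [mem_erase] at hz
          obtain ⟨y, hy1, hy2, hy3⟩ := hs z hz.2 hzr
          refine ⟨y, ?_, hy2, hy3⟩
          simp only [mem_erase]
          refine ⟨?_, hy1⟩
          rintro rfl
          have := hmax z (by simp [hzr, hz.2])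
          omega) (upd x k hx.2 hk)
      refine ⟨c', ?_, h2⟩
      intro v hv
      rw [h1 v (by simp [hv])]
      have : v ≠ x := by rintro rfl; exact hv hx.2
      simp [this]
    · obtain ⟨k, hk⟩ := root_col hG hp hq hpq c hc
      have hem : U.erase r = ∅ := not_nonempty_iff_eq_empty.1 hUr
      refine ⟨Function.update c r k, ?_, ?_⟩
      · intro v hv
        have : v ≠ r := by rintro rfl; exact hv hr
        simp [this]
      · intro v w hvw
        exact upd r k hr (fun w hw _ => hk w hw) v w (by simp [hem]) (by simp [hem]) hvw

lemma ConTo.rank {X : Finset V} {r : V} (h : ConTo G X r) :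
    ∃ d : V → ℕ, ∀ x ∈ X, x ≠ r → ∃ y ∈ X, G.Adj x y ∧ d y < d x := by
  classical
  let P : V → ℕ → Prop := fun x n => ∃ w : G.Walk x r, (∀ y ∈ w.support, y ∈ X) ∧ w.length = n
  refine ⟨fun x => if hx : ∃ n, P x n then Nat.find hx else 0, ?_⟩
  intro x hx hxr
  have hex : ∀ y ∈ X, ∃ n, P y n := fun y hy => by
    obtain ⟨w, hw⟩ := h y hy; exact ⟨_, w, hw, rfl⟩
  obtain ⟨w, hw, hl⟩ := Nat.find_spec (hex x hx)
  cases w with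
  | nil => exact absurd rfl hxr
  | cons hadj p =>
    rename_i y
    have hyX : y ∈ X := hw y (by simp)
    refine ⟨y, hyX, hadj, ?_⟩
    beta_reduce
    rw [dif_pos (hex x hx), dif_pos (hex y hyX)]
    have : Nat.find (hex y hyX) ≤ p.length := Nat.find_min' _ ⟨p, fun z hz => hw z (by simp [hz]), rfl⟩
    simp at hl
    omega

theorem core2 [Fintype V] (S : Sys G) (hG : Cub G) {r p q : V} (hr : r ∈ S.X) (hp : p ∉ S.X) (hq : q ∉ S.X)
    (hrp : G.Adj r p) (hrq : G.Adj r q) (hpq : p ≠ q) (hrb : ¬ Bad G (2 * S.R + 2) r) (hcon : ConTo G S.X r) :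
    ∃ c : V → Z3, (∀ v w, G.Adj v w → c v ≠ c w) ∧
      ∃ T : Finset V, 12 * T.card ≤ 4 * Fintype.card V + 90 * S.X.card + 12 * 4 ^ (2 * S.R + 1) ∧
      ∀ c2 : V → Z3, (∀ v w, G.Adj v w → c2 v ≠ c2 w) → (∀ v ∈ T, c2 v = c v) → ∀ v, c2 v = c v := by
  obtain ⟨c0, h1, h2, T, hT, h3⟩ := core S hG hr hp hq hrp hrq hpq hrb
  obtain ⟨d, hd⟩ := hcon.rank
  obtain ⟨c, h4, h5⟩ := ext_aux hG hrp hrq hpq d _ S.X c0 rfl hr hp hq h1 hd h2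
  exact ⟨c, h5, T, hT, fun c2 h6 h7 => h3 c c2 h5 h6 h4 h7⟩
end
end Sud

open SimpleGraph Finset

namespace Sud
section
open Classical
variable {V : Type*} {G : SimpleGraph V}

noncomputable def rootF (P : V → Prop) (rk : V → ℕ) (pv : V → V) (v : V) : V :=
  if h : P v ∧ rk (pv v) < rk v then rootF P rk pv (pv v) else v
termination_by rk v
decreasing_by exact h.2

lemma rootF_eq {P : V → Prop} {rk : V → ℕ} {pv : V → V} {v : V} (h : P v ∧ rk (pv v) < rk v) :
    rootF P rk pv v = rootF P rk pv (pv v) := by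
  rw [rootF, dif_pos h]
lemma rootF_eq' {P : V → Prop} {rk : V → ℕ} {pv : V → V} {v : V} (h : ¬ (P v ∧ rk (pv v) < rk v)) :
    rootF P rk pv v = v := by
  rw [rootF, dif_neg h]

lemma rootF_rtg (P : V → Prop) (rk : V → ℕ) (pv : V → V) (v : V) :
    Relation.ReflTransGen (fun a b => a = pv b ∧ P b ∧ rk a < rk b) (rootF P rk pv v) v := by
  induction hn : rk v using Nat.strong_induction_on generalizing v with
  | _ n ih =>
  by_cases h : P v ∧ rk (pv v) < rk v
  · rw [rootF_eq h]
    exact Relation.ReflTransGen.tail (ih _ (hn ▸ h.2) _ rfl) ⟨rfl, h.1, h.2⟩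
  · rw [rootF_eq' h]

lemma rtg_rk {E : V → V → Prop} {rk : V → ℕ} (hE : ∀ a b, E a b → rk a < rk b) {a b : V}
    (h : Relation.ReflTransGen E a b) : rk a ≤ rk b := by
  induction h with
  | refl => exact le_rfl
  | tail _ h2 ih => have := hE _ _ h2; omega

lemma rtg_wi {E : V → V → Prop} {rk : V → ℕ} (hE : ∀ a b, E a b → G.Adj a b ∧ rk a < rk b) {a b : V}
    (h : Relation.ReflTransGen E a b) : Wi G (rk b) a b := by
  induction h with
  | refl => exact Wi.refl _ _
  | tail h1 h2 ih => exact (ih.trans (Wi.of_adj (hE _ _ h2).1)).mono (hE _ _ h2).2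

def Tof (D : ℕ) : ℕ := 4 * D + 3
def Rof (D : ℕ) : ℕ := 4 ^ (2 * Tof D + 1) * (Tof D + 1) + Tof D

lemma third_nbr (hG : Cub G) {v a b : V} (ha : G.Adj v a) (hb : G.Adj v b) (hab : a ≠ b) :
    ∃ z, a ≠ z ∧ b ≠ z ∧ ∀ w, G.Adj v w ↔ w = a ∨ w = b ∨ w = z := by
  obtain ⟨x, y, z, h12, h13, h23, h1⟩ := hG.exists3 v
  rcases (h1 a).1 ha with rfl | rfl | rfl <;> rcases (h1 b).1 hb with rfl | rfl | rfl
  · exact absurd rfl hab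
  · exact ⟨z, h13, h23, fun w => by rw [h1]⟩
  · exact ⟨y, h12, h23.symm, fun w => by rw [h1]; tauto⟩
  · exact ⟨z, h23, h13, fun w => by rw [h1]; tauto⟩
  · exact absurd rfl hab
  · exact ⟨x, h12.symm, h13.symm, fun w => by rw [h1]; tauto⟩
  · exact ⟨y, h23.symm, h12, fun w => by rw [h1]; tauto⟩
  · exact ⟨x, h13.symm, h12.symm, fun w => by rw [h1]; tauto⟩
  · exact absurd rfl hab

theorem sys_exists [Fintype V] (hG : Cub G) (m : V → V) (hm : ∀ v, m (m v) = v) (X : Finset V)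
    (hmX : ∀ v, v ∉ X → G.Adj v (m v)) (D : ℕ) (f : V → ℕ) (hfD : ∀ v, f v ≤ D)
    (hf : ∀ v, v ∉ X → ∃ u, G.Adj v u ∧ u ≠ m v ∧ f u < f v)
    (hbad : ∀ v, Bad G (2 * Rof D + 2) v → v ∈ X) :
    ∃ S : Sys G, S.X = X ∧ S.R = Rof D ∧ S.m = m := by
  obtain ⟨col, hc3, hcol⟩ := greedy (fun a b => G.Adj a b) (fun a b h => h.symm) (fun a h => h.ne rfl) 3
    (fun v => (hG v).le)
  set T := Tof D with hT
  have hpow : ∀ v, {w | v ≠ w ∧ Wi G (2 * T + 1) v w}.ncard ≤ 4 ^ (2 * T + 1) := by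
    intro v
    refine le_trans ?_ (Ball_card hG (2 * T + 1) v)
    rw [← Set.ncard_coe_finset]
    apply Set.ncard_le_ncard
    · intro w hw; exact mem_Ball.2 hw.2
    · exact Set.toFinite _
  obtain ⟨β0, hβ1, hβ2⟩ := greedy (fun a b => a ≠ b ∧ Wi G (2 * T + 1) a b)
    (fun a b h => ⟨h.1.symm, h.2.symm⟩) (fun a h => h.1 rfl) _ hpow
  have hch : ∀ v, ∃ ab : V × V, v ∉ X → m v ≠ ab.1 ∧ m v ≠ ab.2 ∧ ab.1 ≠ ab.2 ∧ f ab.1 < f v ∧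
      ∀ w, G.Adj v w ↔ w = m v ∨ w = ab.1 ∨ w = ab.2 := by
    intro v
    by_cases hv : v ∈ X
    · exact ⟨(v, v), fun h => absurd hv h⟩
    · obtain ⟨u, h1, h2, h3⟩ := hf v hv
      obtain ⟨z, h4, h5, h6⟩ := third_nbr hG (hmX v hv) h1 h2.symm
      exact ⟨(u, z), fun _ => ⟨h2.symm, h4, h5, h3, h6⟩⟩
  choose ab hab using hch
  set nx : V → V := fun v => (ab v).1 with hnxd
  set pv : V → V := fun v => (ab v).2 with hpvd
  set rk0 : V → ℕ := fun v => (D - f v) * 4 + col v with hrk0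
  have rkT : ∀ v, rk0 v ≤ T := by
    intro v; simp only [hrk0, hT, Tof]; have := hc3 v; omega
  have rknx : ∀ v, v ∉ X → rk0 v < rk0 (nx v) := by
    intro v hv
    have h := (hab v hv).2.2.2.1
    have := hc3 v; have := hfD v; 
    simp only [hrk0]; simp only [hnxd] at h ⊢; omega
  have rkd : ∀ v w, G.Adj v w → rk0 v ≠ rk0 w := by
    intro v w h
    have := hcol v w h; have := hc3 v; have := hc3 w
    simp only [hrk0]; omega
  have adjp : ∀ v, v ∉ X → G.Adj v (pv v) := fun v hv => ((hab v hv).2.2.2.2 _).2 (by tauto)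
  have adjn : ∀ v, v ∉ X → G.Adj v (nx v) := fun v hv => ((hab v hv).2.2.2.2 _).2 (by tauto)
  have pvnx : ∀ v, v ∉ X → nx v ∉ X → pv (nx v) = v := by
    intro v hv hn
    rcases ((hab _ hn).2.2.2.2 v).1 (adjn v hv).symm with h | h | h
    · have := congrArg m h; rw [hm] at this
      exact absurd this (hab v hv).1
    · have h1 := rknx v hv
      have h2 := rknx _ hn
      change v = nx (nx v) at h
      rw [← h] at h2; omega
    · exact h.symm
  set P : V → Prop := fun v => v ∉ X ∧ pv v ∉ X with hP
  set rt : V → V := rootF P rk0 pv with hrt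
  have rtE : ∀ v, Relation.ReflTransGen (fun a b => a = pv b ∧ P b ∧ rk0 a < rk0 b) (rt v) v :=
    fun v => rootF_rtg P rk0 pv v
  have hEE : ∀ a b, (a = pv b ∧ P b ∧ rk0 a < rk0 b) → G.Adj a b ∧ rk0 a < rk0 b := by
    rintro a b ⟨rfl, h2, h3⟩; exact ⟨(adjp b h2.1).symm, h3⟩
  have rtn : ∀ v, v ∉ X → nx v ∉ X → rt (nx v) = rt v := by
    intro v hv hn
    have := rootF_eq (P := P) (rk := rk0) (pv := pv) (v := nx v)
      ⟨⟨hn, by rw [pvnx v hv hn]; exact hv⟩, by rw [pvnx v hv hn]; exact rknx v hv⟩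
    rw [pvnx v hv hn] at this
    exact this
  have rtp : ∀ v, v ∉ X → pv v ∉ X → rt (pv v) = rt v := by
    intro v hv hp
    rcases lt_or_gt_of_ne (rkd v (pv v) (adjp v hv)) with h | h
    · have e : v = pv (pv v) := by
        rcases ((hab _ hp).2.2.2.2 v).1 (adjp v hv).symm with h' | h' | h'
        · have := congrArg m h'; rw [hm] at this
          exact absurd this (hab v hv).2.1
        · have := rknx _ hp; change v = nx (pv v) at h'; rw [← h'] at this; omega
        · exact h'
      have := rootF_eq (P := P) (rk := rk0) (pv := pv) (v := pv v)
        ⟨⟨hp, by rw [← e]; exact hv⟩, by rw [← e]; exact h⟩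
      rw [← e] at this
      exact this
    · exact (rootF_eq (P := P) (rk := rk0) (pv := pv) ⟨⟨hv, hp⟩, h⟩).symm
  have RT : T * 2 + 2 ≤ 2 * Rof D + 2 := by
    simp only [Rof, ← hT]; omega
  have chord : ∀ b, b ∉ X → m b ∉ X → rk0 (m b) < rk0 b → rt (m b) ≠ rt b := by
    intro b hb hmb hlt heq
    by_cases h : P b ∧ rk0 (pv b) < rk0 b
    · have e : rt b = rt (pv b) := rootF_eq h
      have w1 := WA_of_rtg (G := G) hEE (rtE (m b)) hlt
      have w2 := WA_of_rtg (G := G) hEE (rtE (pv b)) h.2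
      rw [heq, e] at w1
      have := bad_of_WA (hmX b hb) (adjp b hb) (hab b hb).2.1 (w1.symm.trans w2)
      refine hb (hbad b (this.mono ?_))
      have := rkT b; have := h.2
      omega
    · have e : rt b = b := rootF_eq' h
      have := rtg_rk (fun a b h => (hEE a b h).2) (rtE (m b))
      rw [heq, e] at this; omega
  have chord' : ∀ b, b ∉ X → m b ∉ X → rt (m b) ≠ rt b := by
    intro b hb hmb
    rcases lt_or_gt_of_ne (rkd b (m b) (hmX b hb)) with h | h
    · have := chord (m b) hmb (by rw [hm]; exact hb) (by rw [hm]; exact h)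
      rw [hm] at this; exact this.symm
    · exact chord b hb hmb h
  have chβ : ∀ b, b ∉ X → m b ∉ X → β0 (rt (m b)) ≠ β0 (rt b) := by
    intro b hb hmb
    refine hβ2 _ _ ⟨chord' b hb hmb, ?_⟩
    have w1 := rtg_wi (G := G) hEE (rtE (m b))
    have w2 := rtg_wi (G := G) hEE (rtE b)
    have w3 := Wi.of_adj (hmX b hb).symm
    refine ((w1.trans w3).trans w2.symm).mono ?_
    have := rkT b; have := rkT (m b); omega
  refine ⟨{ X := X, m := m, nx := nx, pv := pv, rk := fun v => β0 (rt v) * (T + 1) + rk0 v,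
            β := fun v => β0 (rt v), R := Rof D, hm := hm,
            adj := fun v hv => (hab v hv).2.2.2.2
            ne1 := fun v hv => (hab v hv).1, ne2 := fun v hv => (hab v hv).2.1
            ne3 := fun v hv => (hab v hv).2.2.1
            hnx := ?_, hnxb := ?_, hpv := ?_, hdist := ?_, hch := ?_, rkR := ?_, hbad := hbad }, rfl, rfl, rfl⟩
  · intro v hv hn
    simp only [rtn v hv hn]; have := rknx v hv; omega
  · intro v hv hn; simp only [rtn v hv hn]
  · intro v hv hn; simp only [rtp v hv hn]
  · intro v w _ _ h heq
    apply rkd v w h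
    have h1 := congrArg (· % (T + 1)) heq
    simp only [Nat.mul_add_mod_self_right] at h1
    rwa [Nat.mod_eq_of_lt (by have := rkT v; omega), Nat.mod_eq_of_lt (by have := rkT w; omega)] at h1
  · intro v hv hmv h
    refine lt_of_le_of_ne ?_ (chβ v hv hmv)
    by_contra hlt
    push Not at hlt
    have h1 : (β0 (rt v) + 1) * (T + 1) ≤ β0 (rt (m v)) * (T + 1) := Nat.mul_le_mul_right _ hlt
    have := rkT v
    rw [add_mul] at h1
    omega
  · intro v
    have h1 : β0 (rt v) * (T + 1) ≤ 4 ^ (2 * T + 1) * (T + 1) := Nat.mul_le_mul_right _ (hβ1 _)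
    have := rkT v
    simp only [Rof, ← hT]; omega
end
end Sud

open SimpleGraph Finset

namespace Sud
section
open Classical
variable {V : Type*} {G : SimpleGraph V}

lemma crossing {P : V → Prop} {a b : V} (w : G.Walk a b) (ha : ¬ P a) (hb : P b) :
    ∃ x y, G.Adj x y ∧ ¬ P x ∧ P y := by
  induction w with
  | nil => exact absurd hb ha
  | cons h p ih =>
    rename_i u v w
    by_cases hv : P v
    · exact ⟨u, v, h, ha, hv⟩
    · exact ih hv hb

lemma ConTo.add {X : Finset V} {r x y : V} (h : ConTo G X r) (hx : x ∈ X) (w : G.Walk y x) :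
    ConTo G (X ∪ w.support.toFinset) r := by
  intro z hz
  rw [mem_union, List.mem_toFinset] at hz
  rcases hz with hz | hz
  · obtain ⟨w', hw'⟩ := h z hz
    exact ⟨w', fun y hy => mem_union_left _ (hw' y hy)⟩
  · obtain ⟨w', hw'⟩ := h x hx
    refine ⟨(w.dropUntil z hz).append w', ?_⟩
    intro y hy
    rw [Walk.mem_support_append_iff] at hy
    rw [mem_union, List.mem_toFinset]
    rcases hy with hy | hy
    · exact Or.inr (Walk.support_dropUntil_subset_support _ _ hy)
    · exact Or.inl (hw' y hy)

lemma ConTo.reroot {X : Finset V} {r s : V} (h : ConTo G X r) (hs : s ∈ X) : ConTo G X s := by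
  intro x hx
  obtain ⟨w, hw⟩ := h x hx
  obtain ⟨w', hw'⟩ := h s hs
  refine ⟨w.append w'.reverse, ?_⟩
  intro y hy
  rw [Walk.mem_support_append_iff] at hy
  rcases hy with hy | hy
  · exact hw y hy
  · exact hw' y (by simpa using hy)

lemma supp_card {a b : V} (w : G.Walk a b) : w.support.toFinset.card ≤ w.length + 1 := by
  have := List.toFinset_card_le w.support
  rwa [Walk.length_support] at this

lemma attach {X : Finset V} {r : V} (hX : ConTo G X r) (s : ℕ) (hs : ∀ v, ∃ x ∈ X, Wi G s v x)
    (W : Finset V) : ∃ X' : Finset V, X ⊆ X' ∧ W ⊆ X' ∧ ConTo G X' r ∧ X'.card ≤ X.card + (s + 1) * W.card := by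
  induction W using Finset.induction_on with
  | empty => exact ⟨X, by simp, by simp, hX, by simp⟩
  | insert a W ha ih =>
    obtain ⟨X', h1, h2, h3, h4⟩ := ih
    obtain ⟨x, hx, w, hw⟩ := hs a
    refine ⟨X' ∪ w.support.toFinset, h1.trans subset_union_left, ?_, h3.add (h1 hx) w, ?_⟩
    · intro y hy
      rw [mem_insert] at hy
      rcases hy with rfl | hy
      · simp
      · exact mem_union_left _ (h2 hy)
    · rw [card_insert_of_notMem ha]
      have := card_union_le X' w.support.toFinset
      have := supp_card w
      rw [mul_add]; omega

variable [Fintype V]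

lemma sep_count (H : SimpleGraph V) (k K : ℕ) (C B : Finset V)
    (hC : ∀ a ∈ C, ∀ b ∈ C, a ≠ b → ¬ Wi H (2 * k) a b)
    (h : ∀ c ∈ C, (∃ b ∈ B, Wi H k c b) ∨ K ≤ (Ball H k c).card) :
    C.card * K ≤ Fintype.card V + B.card * K := by
  have hs := card_filter_add_card_filter_not (s := C) (fun c => ∃ b ∈ B, Wi H k c b)
  have h1 : (C.filter (fun c => ∃ b ∈ B, Wi H k c b)).card ≤ B.card := by
    have : ∀ c, ∃ b, (∃ b ∈ B, Wi H k c b) → b ∈ B ∧ Wi H k c b := by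
      intro c
      by_cases hc : ∃ b ∈ B, Wi H k c b
      · obtain ⟨b, hb⟩ := hc; exact ⟨b, fun _ => hb⟩
      · exact ⟨c, fun h => absurd h hc⟩
    choose g hg using this
    apply card_le_card_of_injOn g
    · intro c hc
      simp only [coe_filter, Set.mem_ofPred_eq] at hc
      exact (hg c hc.2).1
    · intro c hc d hd hcd
      simp only [coe_filter, Set.mem_ofPred_eq] at hc hd
      by_contra hne
      have w1 := (hg c hc.2).2
      have w2 := (hg d hd.2).2
      rw [← hcd] at w2
      exact hC c hc.1 d hd.1 hne ((w1.trans w2.symm).mono (by omega))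
  have h2 : (C.filter (fun c => ¬ ∃ b ∈ B, Wi H k c b)).card * K ≤ Fintype.card V := by
    have hd : ((C.filter (fun c => ¬ ∃ b ∈ B, Wi H k c b) : Finset V) : Set V).PairwiseDisjoint (Ball H k) := by
      intro c hc d hd hne
      simp only [coe_filter, Set.mem_ofPred_eq] at hc hd
      rw [Function.onFun, Finset.disjoint_left]
      intro x hx hx'
      rw [mem_Ball] at hx hx'
      exact hC c hc.1 d hd.1 hne ((hx.trans hx'.symm).mono (by omega))
    rw [← smul_eq_mul]
    refine le_trans ?_ (card_le_univ ((C.filter (fun c => ¬ ∃ b ∈ B, Wi H k c b)).biUnion (Ball H k)))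
    rw [card_biUnion hd]
    refine card_nsmul_le_sum _ _ _ (fun c hc => ?_)
    simp only [mem_filter] at hc
    exact (h c hc.1).resolve_left hc.2
  rw [← hs, add_mul]
  have := Nat.mul_le_mul_right K h1
  omega

noncomputable def Br (G : SimpleGraph V) (v u : V) (k : ℕ) : Finset V := univ.filter (fun w => WA G v k u w)

lemma branch (hG : Cub G) (k L : ℕ) (hL : 2 * k + 2 ≤ L) : ∀ v u, G.Adj v u →
    (∀ x, Wi G k u x → ¬ Bad G L x) → 2 ^ k ≤ (Br G v u k).card := by
  induction k with
  | zero =>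
    intro v u h _
    have : u ∈ Br G v u 0 := by
      simp only [Br, mem_filter, mem_univ, true_and]
      exact ⟨Walk.nil, by simp [h.ne], by simp⟩
    simpa using card_pos.2 ⟨u, this⟩
  | succ k ih =>
    intro v u h hb
    have hub : ¬ Bad G L u := hb u (Wi.refl _ _)
    obtain ⟨x, y, z, h12, h13, h23, h1⟩ := hG.exists3 u
    have : ∃ a b, G.Adj u a ∧ G.Adj u b ∧ a ≠ b ∧ a ≠ v ∧ b ≠ v := by
      rcases (h1 v).1 h.symm with rfl | rfl | rfl
      · exact ⟨y, z, (h1 _).2 (by tauto), (h1 _).2 (by tauto), h23, h12.symm, h13.symm⟩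
      · exact ⟨x, z, (h1 _).2 (by tauto), (h1 _).2 (by tauto), h13, h12, h23.symm⟩
      · exact ⟨x, y, (h1 _).2 (by tauto), (h1 _).2 (by tauto), h12, h13, h23⟩
    obtain ⟨a, b, ha, hb', hab, hav, hbv⟩ := this
    have i1 := ih (by omega) u a ha (fun x hx => hb x (by
      rw [Wi_succ]; exact Or.inr ⟨a, ha, hx⟩))
    have i2 := ih (by omega) u b hb' (fun x hx => hb x (by
      rw [Wi_succ]; exact Or.inr ⟨b, hb', hx⟩))
    have hdis : Disjoint (Br G u a k) (Br G u b k) := by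
      rw [Finset.disjoint_left]
      intro w h3 h4
      simp only [Br, mem_filter, mem_univ, true_and] at h3 h4
      exact hub ((bad_of_WA ha hb' hab (h3.trans h4.symm)).mono (by omega))
    have hsub : ∀ c, G.Adj u c → c ≠ v → Br G u c k ⊆ Br G v u (k + 1) := by
      intro c hc hcv w hw
      simp only [Br, mem_filter, mem_univ, true_and] at hw ⊢
      obtain ⟨p, hp1, hp2⟩ := hw
      refine ⟨Walk.cons hc p, ?_, by simpa using hp2⟩
      simp only [Walk.support_cons, List.mem_cons, not_or]
      refine ⟨h.ne, fun hv => ?_⟩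
      refine hub ((bad_of_WA hc h.symm hcv (k := k) ⟨p.takeUntil v hv, ?_, ?_⟩).mono (by omega))
      · exact fun hh => hp1 (Walk.support_takeUntil_subset_support _ _ hh)
      · exact (Walk.length_takeUntil_le_length _ _).trans hp2
    have := card_le_card (union_subset (hsub a ha hav) (hsub b hb' hbv))
    rw [card_union_of_disjoint hdis] at this
    rw [pow_succ]; omega

lemma growth (hG : Cub G) (k L : ℕ) (hL : 2 * k + 2 ≤ L) (v : V)
    (hb : ∀ x, Wi G (k + 1) v x → ¬ Bad G L x) : 2 ^ k ≤ (Ball G (k + 1) v).card := by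
  obtain ⟨u, _, _, _, _, _, h1⟩ := hG.exists3 v
  have hu : G.Adj v u := (h1 u).2 (by tauto)
  refine (branch hG k L hL v u hu (fun x hx => hb x (Wi_succ.2 (Or.inr ⟨u, hu, hx⟩)))).trans ?_
  apply card_le_card
  intro w hw
  simp only [Br, mem_filter, mem_univ, true_and] at hw
  exact mem_Ball.2 (Wi_succ.2 (Or.inr ⟨u, hu, hw.wi⟩))

lemma steiner (hc : G.Connected) (s : ℕ) : ∃ (X C : Finset V) (r : V), r ∈ X ∧ C ⊆ X ∧ ConTo G X r ∧
    X.card ≤ (s + 2) * C.card ∧ (∀ a ∈ C, ∀ b ∈ C, a ≠ b → ¬ Wi G s a b) ∧ ∀ v, ∃ x ∈ X, Wi G s v x := by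
  obtain ⟨r⟩ := hc.nonempty
  let P : ℕ → Prop := fun n => ∃ X C : Finset V, C.card = n ∧ r ∈ X ∧ C ⊆ X ∧ ConTo G X r ∧
    X.card ≤ (s + 2) * C.card ∧ (∀ a ∈ C, ∀ b ∈ C, a ≠ b → ¬ Wi G s a b)
  have hP : P 1 := by
    refine ⟨{r}, {r}, by simp, by simp, by simp, ?_, by simp, ?_⟩
    · intro x hx; rw [mem_singleton] at hx; subst hx; exact ⟨Walk.nil, by simp⟩
    · intro a ha b hb hab; simp at ha hb; exact absurd (ha.trans hb.symm) hab
  have hbd : ∀ n, P n → n ≤ Fintype.card V := by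
    rintro n ⟨X, C, rfl, _⟩; exact card_le_univ _
  obtain ⟨n, hn, hmax⟩ : ∃ n, P n ∧ ¬ P (n + 1) := by
    by_contra hcon
    push Not at hcon
    have : ∀ k, P (k + 1) := by
      intro k; induction k with
      | zero => exact hP
      | succ k ih => exact hcon _ ih
    have := hbd _ (this (Fintype.card V)); omega
  obtain ⟨X, C, h1, h2, h3, h4, h5, h6⟩ := hn
  refine ⟨X, C, r, h2, h3, h4, h5, h6, ?_⟩
  by_contra hcon
  push Not at hcon
  obtain ⟨v, hv⟩ := hcon
  obtain ⟨w⟩ := hc.preconnected v r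
  obtain ⟨x, y, hxy, hx, hy⟩ := crossing (P := fun v => ∃ x ∈ X, Wi G s v x) w (by push Not; exact hv)
    ⟨r, h2, Wi.refl _ _⟩
  obtain ⟨z, hz, w', hw'⟩ := hy
  have hxX : x ∉ C := fun h => hx ⟨x, h3 h, Wi.refl _ _⟩
  apply hmax
  refine ⟨X ∪ (Walk.cons hxy w').support.toFinset, insert x C, ?_, ?_, ?_, ?_, ?_, ?_⟩
  · rw [card_insert_of_notMem hxX, h1]
  · exact mem_union_left _ h2
  · intro c hc
    rw [mem_insert] at hc
    rcases hc with rfl | hc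
    · simp
    · exact mem_union_left _ (h3 hc)
  · exact h4.add hz _
  · rw [card_insert_of_notMem hxX]
    have := card_union_le X (Walk.cons hxy w').support.toFinset
    have := supp_card (Walk.cons hxy w')
    simp only [Walk.length_cons] at this
    rw [mul_add]; omega
  · intro a ha b hb hab hw
    rw [mem_insert] at ha hb
    rcases ha with rfl | ha <;> rcases hb with rfl | hb
    · exact hab rfl
    · exact hx ⟨b, h3 hb, hw⟩
    · exact hx ⟨a, h3 ha, hw.symm⟩
    · exact h6 a ha b hb hab hw

theorem getX (hG : Cub G) (hc : G.Connected) (k L : ℕ) (hL : 2 * k + 2 ≤ L) (W B : Finset V)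
    (hB : ∀ v, v ∈ B ↔ Bad G L v) (hBW : B ⊆ W) :
    ∃ X0 : ℕ, X0 * 2 ^ k ≤ (2 * k + 4) * (Fintype.card V + B.card * 2 ^ k) ∧
    (4 * (X0 + (2 * k + 3) * W.card) < Fintype.card V →
    ∃ (X : Finset V) (r p q : V), W ⊆ X ∧ X.card ≤ X0 + (2 * k + 3) * W.card + 2 ∧ r ∈ X ∧ p ∉ X ∧ q ∉ X ∧
      G.Adj r p ∧ G.Adj r q ∧ p ≠ q ∧ ConTo G X r ∧ ¬ Bad G L r) := by
  obtain ⟨X, C, r, h1, h2, h3, h4, h5, h6⟩ := steiner hc (2 * (k + 1))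
  refine ⟨X.card, ?_, ?_⟩
  · have := sep_count G (k + 1) (2 ^ k) C B h5 (fun c _ => by
      by_cases h : ∃ b ∈ B, Wi G (k + 1) c b
      · exact Or.inl h
      · push Not at h
        refine Or.inr (growth hG k L hL c (fun x hx hb => h x ((hB x).2 hb) hx)))
    calc X.card * 2 ^ k ≤ (2 * (k + 1) + 2) * C.card * 2 ^ k := Nat.mul_le_mul_right _ h4
      _ = (2 * k + 4) * (C.card * 2 ^ k) := by ring
      _ ≤ _ := Nat.mul_le_mul_left _ this
  · intro hN
    obtain ⟨X1, a1, a2, a3, a4⟩ := attach h3 _ h6 W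
    have a4' : X1.card ≤ X.card + (2 * k + 3) * W.card := by
      rw [show 2 * k + 3 = 2 * (k + 1) + 1 by ring]; exact a4
    have hcard : (X1.biUnion (Ball G 1)).card < Fintype.card V := by
      refine lt_of_le_of_lt card_biUnion_le ?_
      refine lt_of_le_of_lt (sum_le_card_nsmul _ _ 4 (fun x _ => by simpa using Ball_card hG 1 x)) ?_
      rw [smul_eq_mul]; omega
    have : ∃ z, z ∉ X1.biUnion (Ball G 1) := by
      by_contra hcon
      push Not at hcon
      rw [eq_univ_iff_forall.2 hcon, card_univ] at hcard; omega
    obtain ⟨z, hz⟩ := this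
    obtain ⟨w⟩ := hc.preconnected z r
    obtain ⟨y, y1, hyy, hy, hy1⟩ := crossing (P := fun v => v ∈ X1.biUnion (Ball G 1)) w hz (by
      rw [mem_biUnion]; exact ⟨r, a1 h1, mem_Ball.2 (Wi.refl _ _)⟩)
    simp only [mem_biUnion, mem_Ball, not_exists, not_and] at hy hy1
    obtain ⟨x1, hx1, hx1y⟩ := hy1
    have hy1X : y1 ∉ X1 := fun h => hy y1 h (Wi.of_adj hyy.symm)
    have hadj : G.Adj y1 x1 := by
      rw [Wi_succ] at hx1y
      rcases hx1y with rfl | ⟨x, h, h'⟩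
      · exact absurd hx1 hy1X
      · rw [Wi_zero] at h'; subst h'; exact h.symm
    have hyX : y ∉ X1 := fun h => hy y h (Wi.refl _ _)
    set w2 : G.Walk y x1 := Walk.cons hyy (Walk.cons hadj Walk.nil) with hw2
    have hsupp : ∀ u, u ∈ X1 ∪ w2.support.toFinset ↔ u ∈ X1 ∨ u = y ∨ u = y1 := by
      intro u
      simp only [hw2, mem_union, List.mem_toFinset, Walk.support_cons, Walk.support_nil, List.mem_cons,
        List.not_mem_nil, or_false]
      constructor
      · rintro (h | h | h | rfl) <;> tauto
      · tauto
    have hcard2 : (X1 ∪ w2.support.toFinset).card ≤ X1.card + 2 := by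
      have : X1 ∪ w2.support.toFinset = X1 ∪ {y, y1} := by
        ext u; rw [hsupp]; simp; tauto
      rw [this]
      exact (card_union_le _ _).trans (by have := card_le_two (a := y) (b := y1); omega)
    have hpq : ∃ p q, G.Adj y p ∧ G.Adj y q ∧ p ≠ q ∧ p ≠ y1 ∧ q ≠ y1 := by
      obtain ⟨a, b, c, h12, h13, h23, h⟩ := hG.exists3 y
      rcases (h y1).1 hyy with rfl | rfl | rfl
      · exact ⟨b, c, (h _).2 (by tauto), (h _).2 (by tauto), h23, h12.symm, h13.symm⟩
      · exact ⟨a, c, (h _).2 (by tauto), (h _).2 (by tauto), h13, h12, h23.symm⟩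
      · exact ⟨a, b, (h _).2 (by tauto), (h _).2 (by tauto), h12, h13, h23⟩
    obtain ⟨p, q, hp, hq, hpq, hp1, hq1⟩ := hpq
    have out : ∀ p, G.Adj y p → p ≠ y1 → p ∉ X1 ∪ w2.support.toFinset := by
      intro p hp hp1 h
      rw [hsupp] at h
      rcases h with h | h | h
      · exact hy p h (Wi.of_adj hp.symm)
      · exact hp.ne h.symm
      · exact hp1 h
    refine ⟨X1 ∪ w2.support.toFinset, y, p, q, a2.trans subset_union_left, by omega, ?_, out p hp hp1,
      out q hq hq1, hp, hq, hpq, ?_, ?_⟩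
    · rw [hsupp]; tauto
    · exact (a3.add hx1 w2).reroot (by rw [hsupp]; tauto)
    · intro hb
      exact hyX (a2 (hBW ((hB y).2 hb)))
end
end Sud

open SimpleGraph Finset

namespace Sud
section
open Classical
variable {V : Type*} {G : SimpleGraph V} [Fintype V]

lemma nb_card (hG : Cub G) (x : V) : (univ.filter (fun v => G.Adj x v)).card = 3 := by
  have := hG x
  rw [Set.ncard_eq_toFinset_card'] at this
  rw [← this]
  congr 1
  ext y; simp

lemma exists_perm (hG : Cub G) : ∃ σ : Equiv.Perm V, ∀ v, G.Adj v (σ v) := by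
  have := (Finset.all_card_le_biUnion_card_iff_exists_injective
    (fun v => univ.filter (fun w => G.Adj v w))).1 ?_
  · obtain ⟨f, hf, h⟩ := this
    refine ⟨Equiv.ofBijective f (Finite.injective_iff_bijective.1 hf), fun v => ?_⟩
    simpa using h v
  · intro s
    have := card_mul_le_card_mul (s := s) (t := s.biUnion (fun v => univ.filter (fun w => G.Adj v w)))
      (m := 3) (n := 3) (fun a b => G.Adj a b) ?_ ?_
    · omega
    · intro a ha
      rw [← nb_card hG a]
      apply card_le_card
      intro b hb
      simp only [mem_filter, mem_univ, true_and] at hb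
      simp only [mem_bipartiteAbove, mem_biUnion, mem_filter, mem_univ, true_and]
      exact ⟨⟨a, ha, hb⟩, hb⟩
    · intro b _
      rw [← nb_card hG b]
      apply card_le_card
      intro a ha
      simp only [mem_bipartiteBelow] at ha
      simp only [mem_filter, mem_univ, true_and]
      exact ha.2.symm

lemma exists_matching (hG : Cub G) (L : ℕ) (B : Finset V) (hB : ∀ v, v ∈ B ↔ Bad G L v) :
    ∃ m : V → V, (∀ v, m (m v) = v) ∧ (∀ v, m v ≠ v → G.Adj v (m v)) ∧
      (univ.filter (fun v => m v = v)).card * L ≤ Fintype.card V + B.card * L := by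
  obtain ⟨σ, hσ⟩ := exists_perm hG
  have hrep : ∃ r : V → V, (∀ v, r (σ v) = r v) ∧ ∀ v, ∃ i : ℕ, (σ ^ i) (r v) = v := by
    refine ⟨fun v => Quotient.out (Quotient.mk (Equiv.Perm.SameCycle.setoid σ) v), ?_, ?_⟩
    · intro v
      have : Quotient.mk (Equiv.Perm.SameCycle.setoid σ) (σ v) = Quotient.mk (Equiv.Perm.SameCycle.setoid σ) v := by
        apply Quotient.sound
        change σ.SameCycle (σ v) v
        rw [Equiv.Perm.sameCycle_apply_left]
      simp only [this]
    · intro v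
      have : σ.SameCycle (Quotient.out (Quotient.mk (Equiv.Perm.SameCycle.setoid σ) v)) v :=
        Quotient.mk_out (s := Equiv.Perm.SameCycle.setoid σ) v
      obtain ⟨i, _, hi⟩ := this.exists_pow_eq'
      exact ⟨i, hi⟩
  obtain ⟨r, hr, hi⟩ := hrep
  set ix : V → ℕ := fun v => Nat.find (hi v) with hix
  have ix_spec : ∀ v, (σ ^ ix v) (r v) = v := fun v => Nat.find_spec (hi v)
  have ix_min : ∀ v j, (σ ^ j) (r v) = v → ix v ≤ j := fun v j h => Nat.find_min' _ h
  have ix_succ : ∀ v, σ v ≠ r v → ix (σ v) = ix v + 1 := by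
    intro v hv
    apply le_antisymm
    · apply ix_min; rw [hr, pow_succ', Equiv.Perm.mul_apply, ix_spec]
    · have h := ix_spec (σ v)
      rw [hr] at h
      rcases hj : ix (σ v) with _ | j
      · rw [hj] at h; exact absurd h.symm hv
      · rw [hj, pow_succ', Equiv.Perm.mul_apply] at h
        have := ix_min v j (σ.injective h)
        omega
  have ix0 : ∀ v, v = r v → ix v = 0 := by
    intro v hv; have := ix_min v 0 (by simpa using hv.symm); omega
  have rinv : ∀ v, r (σ.symm v) = r v := by
    intro v; rw [← hr (σ.symm v), Equiv.apply_symm_apply]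
  set m : V → V := fun v => if ix v % 2 = 1 then σ.symm v else if σ v ≠ r v then σ v else v with hm
  have m1 : ∀ v, ix v % 2 = 1 → m v = σ.symm v := fun v h => by simp [hm, h]
  have m2 : ∀ v, ix v % 2 ≠ 1 → σ v ≠ r v → m v = σ v := fun v h h' => by
    simp only [hm, if_neg h, if_pos h']
  have m3 : ∀ v, ix v % 2 ≠ 1 → σ v = r v → m v = v := fun v h h' => by
    simp [hm, h, h']
  have hsy : ∀ v, G.Adj v (σ.symm v) := fun v => by
    have := hσ (σ.symm v); rw [Equiv.apply_symm_apply] at this; exact this.symm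
  have hfix : ∀ v, m v = v → ix v % 2 ≠ 1 ∧ σ v = r v := by
    intro v hv
    by_cases h1 : ix v % 2 = 1
    · rw [m1 v h1] at hv; exact absurd hv (hsy v).ne'
    · refine ⟨h1, ?_⟩
      by_contra h2
      rw [m2 v h1 h2] at hv; exact absurd hv (hσ v).ne'
  refine ⟨m, ?_, ?_, ?_⟩
  · intro v
    by_cases h1 : ix v % 2 = 1
    · rw [m1 v h1]
      have h2 : σ (σ.symm v) ≠ r (σ.symm v) := by
        rw [rinv, Equiv.apply_symm_apply]; intro h; rw [ix0 v h] at h1; omega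
      have h3 := ix_succ _ h2
      rw [Equiv.apply_symm_apply] at h3
      rw [m2 _ (by omega) h2, Equiv.apply_symm_apply]
    · by_cases h2 : σ v = r v
      · rw [m3 v h1 h2, m3 v h1 h2]
      · rw [m2 v h1 h2, m1, Equiv.symm_apply_apply]
        have := ix_succ v h2; omega
  · intro v hv
    by_cases h1 : ix v % 2 = 1
    · rw [m1 v h1]; exact hsy v
    · by_cases h2 : σ v = r v
      · exact absurd (m3 v h1 h2) hv
      · rw [m2 v h1 h2]; exact hσ v
  · -- counting
    have pow_ix : ∀ v j, j ≤ ix v → ix ((σ ^ j) (r v)) = j ∧ r ((σ ^ j) (r v)) = r v := by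
      intro v j hj
      have hrj : ∀ j : ℕ, r ((σ ^ j) (r v)) = r v := by
        have h0 : r (r v) = r v := by
          have : ∀ j : ℕ, ∀ u, r ((σ ^ j) u) = r u := by
            intro j u; induction j with
            | zero => rfl
            | succ j ih => rw [pow_succ', Equiv.Perm.mul_apply, hr, ih]
          rw [← this (ix v) (r v), ix_spec]
        intro j; induction j with
        | zero => exact h0
        | succ j ih => rw [pow_succ', Equiv.Perm.mul_apply, hr, ih]
      refine ⟨?_, hrj j⟩
      have h1 : ix ((σ ^ j) (r v)) ≤ j := ix_min _ _ (by rw [hrj])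
      by_contra hne
      have h2 := ix_spec ((σ ^ j) (r v))
      rw [hrj] at h2
      set j' := ix ((σ ^ j) (r v))
      have h3 : (σ ^ (ix v - j + j')) (r v) = v := by
        rw [pow_add, Equiv.Perm.mul_apply, h2, ← Equiv.Perm.mul_apply, ← pow_add,
          Nat.sub_add_cancel hj, ix_spec]
      have := ix_min v _ h3
      omega
    have big : ∀ v, m v = v → v ∉ B → L ≤ ix v + 1 := by
      intro v hv hvB
      obtain ⟨h1, h2⟩ := hfix v hv
      by_contra hlt
      have hne0 : ix v ≠ 0 := by
        intro h
        have := ix_spec v; rw [h] at this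
        have h4 : r v = v := this
        rw [h4] at h2; exact (hσ v).ne' h2
      have hsp : (σ ^ (ix v - 1)) (r v) = σ.symm v := by
        apply σ.injective
        rw [Equiv.apply_symm_apply, ← Equiv.Perm.mul_apply, ← pow_succ', Nat.sub_add_cancel (by omega), ix_spec]
      have wa : ∀ j, j < ix v → WA G v j (r v) ((σ ^ j) (r v)) := by
        intro j; induction j with
        | zero =>
          intro _
          change WA G v 0 (r v) (r v)
          refine ⟨Walk.nil, ?_, by simp⟩
          simp only [Walk.support_nil, List.mem_singleton]
          intro h; exact hne0 (ix0 v h)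
        | succ j ih =>
          intro hj
          obtain ⟨w, hw1, hw2⟩ := ih (by omega)
          have hadj : G.Adj ((σ ^ j) (r v)) ((σ ^ (j + 1)) (r v)) := by
            rw [pow_succ', Equiv.Perm.mul_apply]; exact hσ _
          refine ⟨w.concat hadj, ?_, by simp [Walk.length_concat]; omega⟩
          rw [Walk.support_concat]
          simp only [List.mem_append, List.mem_singleton, not_or]
          refine ⟨hw1, fun h => ?_⟩
          have := ix_min v _ h.symm; omega
      have w1 := wa (ix v - 1) (by omega)
      rw [hsp, ← h2] at w1
      have hne : σ v ≠ σ.symm v := by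
        intro h
        rw [h2, ← hsp] at h
        have := (pow_ix v (ix v - 1) (by omega)).1
        rw [← h] at this
        have h5 := (pow_ix v 0 (by omega)).1
        simp only [pow_zero, Equiv.Perm.one_apply] at h5
        omega
      have := bad_of_WA (hσ v) (hsy v) hne w1
      exact hvB ((hB v).2 (this.mono (by omega)))
    have hinj : ((univ.filter (fun v => m v = v ∧ v ∉ B)) ×ˢ Finset.range L).card ≤ (univ : Finset V).card := by
      apply card_le_card_of_injOn (fun x => (σ ^ x.2) (r x.1)) (by intro x _; simp)
      rintro ⟨v, i⟩ hv ⟨w, j⟩ hw heq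
      simp only [coe_product, Set.mem_prod, mem_coe, mem_filter, mem_univ, true_and, mem_range] at hv hw heq
      have b1 := big v hv.1.1 hv.1.2
      have b2 := big w hw.1.1 hw.1.2
      have p1 := pow_ix v i (by omega)
      have p2 := pow_ix w j (by omega)
      rw [heq] at p1
      have e1 : r v = r w := p1.2.symm.trans p2.2
      have e2 : i = j := p1.1.symm.trans p2.1
      have e3 : σ v = σ w := by rw [(hfix v hv.1.1).2, (hfix w hw.1.1).2, e1]
      rw [σ.injective e3, e2]
    rw [card_product, card_range, card_univ] at hinj
    have hsub : univ.filter (fun v => m v = v) ⊆ univ.filter (fun v => m v = v ∧ v ∉ B) ∪ B := by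
      intro v hv
      simp only [mem_filter, mem_univ, true_and, mem_union] at hv ⊢
      tauto
    have := Nat.mul_le_mul_right L ((card_le_card hsub).trans (card_union_le _ _))
    rw [add_mul] at this
    omega
end
end Sud

open SimpleGraph Finset

namespace Sud
section
open Classical
variable {V : Type*} {G : SimpleGraph V} [Fintype V]

def HG (G : SimpleGraph V) (m : V → V) (hm : ∀ v, m (m v) = v) : SimpleGraph V where
  Adj a b := G.Adj a b ∧ b ≠ m a
  symm := ⟨fun a b h => ⟨h.1.symm, fun h' => h.2 (by rw [h', hm])⟩⟩
  loopless := ⟨fun a h => h.1.ne rfl⟩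


lemma HG_le (m : V → V) (hm : ∀ v, m (m v) = v) : HG G m hm ≤ G := fun _ _ h => h.1


lemma WA.monoG {G' : SimpleGraph V} (hG : G ≤ G') {v : V} {k : ℕ} {a b : V} (h : WA G v k a b) :
    WA G' v k a b := by
  obtain ⟨w, h1, hw⟩ := h; exact ⟨w.mapLe hG, by simpa using h1, by simpa using hw⟩


lemma HG_nb (hG : Cub G) (m : V → V) (hm : ∀ v, m (m v) = v) (u v : V) :
    ∃ a, (HG G m hm).Adj u a ∧ a ≠ v := by
  obtain ⟨x, y, z, h12, h13, h23, h⟩ := hG.exists3 u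
  by_contra hcon
  push Not at hcon
  have hx : x = m u ∨ x = v := by
    by_contra hc; push Not at hc; exact hc.2 (hcon x ⟨(h x).2 (by tauto), hc.1⟩)
  have hy : y = m u ∨ y = v := by
    by_contra hc; push Not at hc; exact hc.2 (hcon y ⟨(h y).2 (by tauto), hc.1⟩)
  have hz : z = m u ∨ z = v := by
    by_contra hc; push Not at hc; exact hc.2 (hcon z ⟨(h z).2 (by tauto), hc.1⟩)
  rcases hx with hx | hx <;> rcases hy with hy | hy <;> rcases hz with hz | hz <;> subst_vars <;>
    simp_all

lemma branchH (hG : Cub G) (m : V → V) (hm : ∀ v, m (m v) = v) (k L : ℕ) (hL : 2 * k + 2 ≤ L) : ∀ v u, (HG G m hm).Adj v u →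
    (∀ x, Wi (HG G m hm) k u x → ¬ Bad G L x) → k + 1 ≤ (Br (HG G m hm) v u k).card := by
  induction k with
  | zero =>
    intro v u h _
    have : u ∈ Br (HG G m hm) v u 0 := by
      simp only [Br, mem_filter, mem_univ, true_and]
      exact ⟨Walk.nil, by simp [h.ne], by simp⟩
    simpa using card_pos.2 ⟨u, this⟩
  | succ k ih =>
    intro v u h hb
    have hub : ¬ Bad G L u := hb u (Wi.refl _ _)
    obtain ⟨a, ha, hav⟩ := HG_nb hG m hm u v
    have i1 := ih (by omega) u a ha (fun x hx => hb x (by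
      rw [Wi_succ]; exact Or.inr ⟨a, ha, hx⟩))
    have hu : u ∉ Br (HG G m hm) u a k := by
      simp only [Br, mem_filter, mem_univ, true_and]
      rintro ⟨w, hw, _⟩
      exact hw (Walk.end_mem_support _)
    have hsub : insert u (Br (HG G m hm) u a k) ⊆ Br (HG G m hm) v u (k + 1) := by
      intro w hw
      rw [mem_insert] at hw
      rcases hw with rfl | hw
      · simp only [Br, mem_filter, mem_univ, true_and]
        exact ⟨Walk.nil, by simp [h.ne], by simp⟩
      simp only [Br, mem_filter, mem_univ, true_and] at hw ⊢
      obtain ⟨p, hp1, hp2⟩ := hw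
      refine ⟨Walk.cons ha p, ?_, by simpa using hp2⟩
      simp only [Walk.support_cons, List.mem_cons, not_or]
      refine ⟨h.ne, fun hv => ?_⟩
      have wa : WA (HG G m hm) u k a v := ⟨p.takeUntil v hv, fun hh => hp1 (Walk.support_takeUntil_subset_support _ _ hh),
        (Walk.length_takeUntil_le_length _ _).trans hp2⟩
      exact hub ((bad_of_WA ha.1 h.1.symm hav (wa.monoG (HG_le m hm))).mono (by omega))
    have := card_le_card hsub
    rw [card_insert_of_notMem hu] at this
    omega


lemma exists_max_sep [Fintype V] (H : SimpleGraph V) (s : ℕ) : ∃ C : Finset V, (∀ a ∈ C, ∀ b ∈ C, a ≠ b → ¬ Wi H s a b) ∧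
    ∀ v, ∃ w ∈ C, Wi H s v w := by
  let F : Finset (Finset V) := univ.filter (fun C => ∀ a ∈ C, ∀ b ∈ C, a ≠ b → ¬ Wi H s a b)
  have hF : F.Nonempty := ⟨∅, by simp [F]⟩
  obtain ⟨C, hC, hmax⟩ := exists_max_image F card hF
  simp only [F, mem_filter, mem_univ, true_and] at hC hmax
  refine ⟨C, hC, ?_⟩
  intro v
  by_contra hcon
  push Not at hcon
  have hv : v ∉ C := fun h => hcon v h (Wi.refl _ _)
  have := hmax (insert v C) (by
    intro a ha b hb hab hw
    rw [mem_insert] at ha hb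
    rcases ha with rfl | ha <;> rcases hb with rfl | hb
    · exact hab rfl
    · exact hcon b hb hw
    · exact hcon a ha hw.symm
    · exact hC a ha b hb hab hw)
  rw [card_insert_of_notMem hv] at this
  omega

lemma getW (hG : Cub G) (m : V → V) (hm : ∀ v, m (m v) = v) (k L : ℕ) (hL : 2 * k + 2 ≤ L) (B : Finset V)
    (hB : ∀ v, v ∈ B ↔ Bad G L v) : ∃ C : Finset V, C.card * (k + 1) ≤ Fintype.card V + B.card * (k + 1) ∧
    ∀ v, ∃ w ∈ C, Wi (HG G m hm) (2 * (k + 1)) v w := by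
  obtain ⟨C, h1, h2⟩ := exists_max_sep (HG G m hm) (2 * (k + 1))
  refine ⟨C, ?_, h2⟩
  apply sep_count (HG G m hm) (k + 1) (k + 1) C B h1
  intro c _
  by_cases h : ∃ b ∈ B, Wi (HG G m hm) (k + 1) c b
  · exact Or.inl h
  · right
    push Not at h
    obtain ⟨u, hu, _⟩ := HG_nb hG m hm c c
    refine (branchH hG m hm k L hL c u hu (fun x hx hb => h x ((hB x).2 hb) (Wi_succ.2 (Or.inr ⟨u, hu, hx⟩)))).trans ?_
    apply card_le_card
    intro w hw
    simp only [Br, mem_filter, mem_univ, true_and] at hw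
    exact mem_Ball.2 (Wi_succ.2 (Or.inr ⟨u, hu, hw.wi⟩))

/-- main connected theorem, raw form -/
theorem conn_raw (hG : Cub G) (hc : G.Connected) (k l L : ℕ) (hL1 : 2 * k + 2 ≤ L) (hL2 : 2 * l + 2 ≤ L)
    (hL3 : 2 * Rof (2 * (k + 1)) + 2 ≤ L) (B : Finset V) (hB : ∀ v, v ∈ B ↔ Bad G L v) :
    ∃ U C X0 : ℕ, U * L ≤ Fintype.card V + B.card * L ∧ C * (k + 1) ≤ Fintype.card V + B.card * (k + 1) ∧
      X0 * 2 ^ l ≤ (2 * l + 4) * (Fintype.card V + B.card * 2 ^ l) ∧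
      (4 * (X0 + (2 * l + 3) * (B.card + U + C)) < Fintype.card V →
      ∃ c : V → Z3, (∀ v w, G.Adj v w → c v ≠ c w) ∧
      ∃ T : Finset V, 12 * T.card ≤ 4 * Fintype.card V + 90 * (X0 + (2 * l + 3) * (B.card + U + C) + 2)
          + 12 * 4 ^ (2 * Rof (2 * (k + 1)) + 1) ∧
      ∀ c2 : V → Z3, (∀ v w, G.Adj v w → c2 v ≠ c2 w) → (∀ v ∈ T, c2 v = c v) → ∀ v, c2 v = c v) := by
  obtain ⟨m, hm, hma, hU⟩ := exists_matching hG L B hB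
  obtain ⟨C, hC1, hC2⟩ := getW hG m hm k L hL1 B hB
  set U := univ.filter (fun v => m v = v) with hUd
  set W := B ∪ U ∪ C with hW
  have hWc : W.card ≤ B.card + U.card + C.card := by
    have := card_union_le (B ∪ U) C
    have := card_union_le B U
    rw [hW]
    omega
  obtain ⟨X0, hX0, hX⟩ := getX hG hc l L hL2 W B hB (by rw [hW, union_assoc]; exact subset_union_left)
  refine ⟨U.card, C.card, X0, hU, hC1, hX0, ?_⟩
  intro hN
  have hmul : (2 * l + 3) * W.card ≤ (2 * l + 3) * (B.card + U.card + C.card) := Nat.mul_le_mul_left _ hWc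
  obtain ⟨X, r, p, q, hWX, hXc, hr, hp, hq, hrp, hrq, hpq, hcon, hrb⟩ := hX (by omega)
  have hBX : ∀ v, Bad G L v → v ∈ X := fun v hv => hWX (by
    rw [hW]; exact mem_union_left _ (mem_union_left _ ((hB v).2 hv)))
  have hex : ∀ v, ∃ n, ∃ w ∈ W, Wi (HG G m hm) n v w := by
    intro v; obtain ⟨w, hw, h⟩ := hC2 v
    exact ⟨_, w, mem_union_right _ hw, h⟩
  obtain ⟨S, hSX, hSR, _⟩ := sys_exists hG m hm X
    (fun v hv => hma v (fun h => hv (hWX (by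
      rw [hW]; exact mem_union_left _ (mem_union_right _ (by simp [hUd, h]))))))
    (2 * (k + 1)) (fun v => Nat.find (hex v))
    (fun v => Nat.find_min' _ (by
      obtain ⟨w, hw, h⟩ := hC2 v; exact ⟨w, mem_union_right _ hw, h⟩))
    (by
      intro v hv
      obtain ⟨w, hw, h⟩ := Nat.find_spec (hex v)
      rcases hn : Nat.find (hex v) with _ | n
      · rw [hn, Wi_zero] at h
        subst h; exact absurd (hWX hw) hv
      · rw [hn, Wi_succ] at h
        rcases h with rfl | ⟨x, hx, hx'⟩
        · exact absurd (hWX hw) hv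
        · refine ⟨x, hx.1, hx.2, ?_⟩
          have : Nat.find (hex x) ≤ n := Nat.find_min' _ ⟨w, hw, hx'⟩
          omega)
    (fun v hv => hBX v (hv.mono hL3))
  rw [← hSX] at hr hp hq hcon hXc
  obtain ⟨c, hc1, T, hT, hT2⟩ := core2 S hG hr hp hq hrp hrq hpq
    (by rw [hSR]; exact fun h => hrb (h.mono hL3)) hcon
  refine ⟨c, hc1, T, ?_, hT2⟩
  rw [hSR] at hT
  omega
end
end Sud

open SimpleGraph Finset

namespace Sud
section
open Classical

set_option maxHeartbeats 1000000 in
theorem conn_main (ε : ℝ) (hε : 0 < ε) : ∃ (L : ℕ) (δ : ℝ) (N0 : ℕ), 0 < δ ∧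
    ∀ (V : Type) [Fintype V] (G : SimpleGraph V), Cub G → G.Connected → N0 ≤ Fintype.card V →
    ∀ B : Finset V, (∀ v, v ∈ B ↔ Bad G L v) → (B.card : ℝ) ≤ δ * Fintype.card V →
    ∃ c : V → Z3, (∀ v w, G.Adj v w → c v ≠ c w) ∧
      ∃ T : Finset V, (T.card : ℝ) ≤ (1/3 + ε) * Fintype.card V ∧
      ∀ c2 : V → Z3, (∀ v w, G.Adj v w → c2 v ≠ c2 w) → (∀ v ∈ T, c2 v = c v) → ∀ v, c2 v = c v := by
  obtain ⟨η, hη, hη1, hη2⟩ : ∃ η : ℝ, 0 < η ∧ η ≤ ε / 60 ∧ η ≤ 1/20 :=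
    ⟨min (ε/60) (1/20), by positivity, min_le_left _ _, min_le_right _ _⟩
  obtain ⟨l, hl⟩ : ∃ l : ℕ, ((2 * l + 4 : ℕ) : ℝ) / 2 ^ l ≤ η := by
    have h1 := tendsto_pow_const_div_const_pow_of_one_lt 1 (r := (2:ℝ)) (by norm_num)
    have h0 := tendsto_pow_const_div_const_pow_of_one_lt 0 (r := (2:ℝ)) (by norm_num)
    have h := (h1.const_mul 2).add (h0.const_mul 4)
    simp only [mul_zero, add_zero] at h
    obtain ⟨l, hl⟩ := ((tendsto_order.1 h).2 η hη).exists
    refine ⟨l, le_trans (le_of_eq ?_) hl.le⟩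
    push_cast; ring
  set a : ℝ := ((2 * l + 4 : ℕ) : ℝ) with ha
  have ha0 : 0 < a := by rw [ha]; positivity
  obtain ⟨k, hk⟩ : ∃ k : ℕ, a / η < k := exists_nat_gt _
  have hk' : a ≤ η * (k + 1) := by
    rw [div_lt_iff₀ hη] at hk; nlinarith
  set L := (2 * k + 2) + (2 * l + 2) + (2 * Rof (2 * (k + 1)) + 2) with hL
  have hLk : (k + 1 : ℝ) ≤ L := by
    have : k + 1 ≤ L := by omega
    exact_mod_cast this
  set K : ℝ := 4 ^ (2 * Rof (2 * (k + 1)) + 1) with hK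
  obtain ⟨N0, hN0⟩ := exists_nat_gt ((15 + K) * 2 / ε)
  refine ⟨L, η / (4 * a), N0 + 1, by positivity, ?_⟩
  intro V _ G hG hc hN B hB hBc
  obtain ⟨U, C, X0, hU, hC, hX, h⟩ := conn_raw hG hc k l L (by omega) (by omega) (by omega) B hB
  set N := Fintype.card V with hNd
  have hNr : (15 + K) * 2 / ε < (N : ℝ) := hN0.trans_le (by exact_mod_cast (by omega : N0 ≤ N))
  have hNp : (0:ℝ) < N := by
    have : 0 < N := by omega
    exact_mod_cast this
  have hb : 4 * a * (B.card : ℝ) ≤ η * N := by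
    have := mul_le_mul_of_nonneg_left hBc (by positivity : 0 ≤ 4 * a)
    refine this.trans (le_of_eq ?_); field_simp
  have hUr : (U : ℝ) * L ≤ N + B.card * L := by exact_mod_cast hU
  have hCr : (C : ℝ) * (k + 1) ≤ N + B.card * (k + 1) := by exact_mod_cast hC
  have hXr : (X0 : ℝ) * 2 ^ l ≤ a * (N + B.card * 2 ^ l) := by rw [ha]; exact_mod_cast hX
  have hk0 : (0:ℝ) < k + 1 := by positivity
  have hL0 : (0:ℝ) < L := by linarith
  have hU2 : a * (U : ℝ) ≤ η * N + a * B.card := by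
    have : a * (U:ℝ) * L ≤ (η * N + a * B.card) * L := by
      have h1 : a * N ≤ η * N * L := by nlinarith [mul_pos hη hNp]
      nlinarith
    exact le_of_mul_le_mul_right this hL0
  have hC2 : a * (C : ℝ) ≤ η * N + a * B.card := by
    have : a * (C:ℝ) * (k + 1) ≤ (η * N + a * B.card) * (k + 1) := by
      have h1 : a * N ≤ η * N * (k + 1) := by nlinarith [mul_pos hη hNp]
      nlinarith
    exact le_of_mul_le_mul_right this hk0
  have hX2 : (X0 : ℝ) ≤ η * N + a * B.card := by
    have h2 : (0:ℝ) < 2 ^ l := by positivity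
    have : (X0:ℝ) * 2 ^ l ≤ (η * N + a * B.card) * 2 ^ l := by
      rw [div_le_iff₀ h2] at hl
      nlinarith
    exact le_of_mul_le_mul_right this h2
  have hE : ((X0 + (2 * l + 3) * (B.card + U + C) : ℕ) : ℝ) ≤ 4 * η * N := by
    have h1 : ((X0 + (2 * l + 3) * (B.card + U + C) : ℕ) : ℝ) ≤ X0 + a * (B.card + U + C) := by
      have : X0 + (2 * l + 3) * (B.card + U + C) ≤ X0 + (2 * l + 4) * (B.card + U + C) := by gcongr; omega
      rw [ha]; exact_mod_cast this
    refine h1.trans ?_; rw [mul_add, mul_add]; linarith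
  set E := X0 + (2 * l + 3) * (B.card + U + C) with hEd
  obtain ⟨c, hc1, T, hT, hT2⟩ := h (by
    have : (4 * E : ℝ) < N := by linarith [mul_le_mul_of_nonneg_right hη2 hNp.le]
    exact_mod_cast this)
  refine ⟨c, hc1, T, ?_, hT2⟩
  have hTr : (12:ℝ) * T.card ≤ 4 * N + 90 * (E + 2) + 12 * K := by rw [hK]; exact_mod_cast hT
  rw [div_lt_iff₀ hε] at hNr
  linarith [mul_le_mul_of_nonneg_right hη1 hNp.le]
end
end Sud

open SimpleGraph Finset

namespace Sud
section
open Classical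
variable {V : Type} {G : SimpleGraph V} [Fintype V]

lemma sum_comp (G : SimpleGraph V) :
    ∑ C : G.ConnectedComponent, Fintype.card C.supp = Fintype.card V := by
  rw [← card_univ, Finset.card_eq_sum_card_fiberwise (f := G.connectedComponentMk) (t := univ)
    (fun _ _ => mem_coe.2 (mem_univ _))]
  refine sum_congr rfl fun C _ => ?_
  rw [Fintype.card_subtype]
  congr 1
  ext v
  simp [ConnectedComponent.mem_supp_iff]

lemma cub_comp (hG : Cub G) (C : G.ConnectedComponent) : Cub C.toSimpleGraph := by
  intro v
  rw [← hG v.1, ← Set.ncard_image_of_injective _ Subtype.val_injective]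
  congr 1
  ext w
  constructor
  · rintro ⟨x, hx, rfl⟩; exact hx
  · intro hw
    have : w ∈ C.supp := C.mem_supp_of_adj_mem_supp v.2 hw
    exact ⟨⟨w, this⟩, hw, rfl⟩

lemma bad_comp {L : ℕ} (C : G.ConnectedComponent) (v : C.supp) (h : Bad C.toSimpleGraph L v) :
    Bad G L v.1 := by
  obtain ⟨c, hc, hl⟩ := h
  refine ⟨c.map C.toSimpleGraph_hom, ?_, (Walk.length_map _ _).le.trans hl⟩
  exact (Walk.isCycle_map_iff_of_injective (f := C.toSimpleGraph_hom) Subtype.val_injective).2 hc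

theorem glue (ε : ℝ) (L : ℕ) (δ : ℝ) (N0 M : ℕ) (hδ : 0 < δ)
    (H : ∀ (V : Type) [Fintype V] (G : SimpleGraph V), Cub G → G.Connected → N0 ≤ Fintype.card V →
    ∀ B : Finset V, (∀ v, v ∈ B ↔ Bad G L v) → (B.card : ℝ) ≤ δ * Fintype.card V →
    ∃ c : V → Z3, (∀ v w, G.Adj v w → c v ≠ c w) ∧
      ∃ T : Finset V, (T.card : ℝ) ≤ (1/3 + ε) * Fintype.card V ∧
      ∀ c2 : V → Z3, (∀ v w, G.Adj v w → c2 v ≠ c2 w) → (∀ v ∈ T, c2 v = c v) → ∀ v, c2 v = c v)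
    (hG : Cub G) (hM : N0 ≤ M) (hC : ∀ C : G.ConnectedComponent, M ≤ Fintype.card C.supp)
    (B : Finset V) (hB : ∀ v, Bad G L v → v ∈ B) (hBM : (B.card : ℝ) ≤ δ * M) :
    ∃ c : V → Z3, (∀ v w, G.Adj v w → c v ≠ c w) ∧
      ∃ T : Finset V, (T.card : ℝ) ≤ (1/3 + ε) * Fintype.card V ∧
      ∀ c2 : V → Z3, (∀ v w, G.Adj v w → c2 v ≠ c2 w) → (∀ v ∈ T, c2 v = c v) → ∀ v, c2 v = c v := by
  have key : ∀ C : G.ConnectedComponent, ∃ c : C.supp → Z3, (∀ v w, C.toSimpleGraph.Adj v w → c v ≠ c w) ∧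
      ∃ T : Finset C.supp, (T.card : ℝ) ≤ (1/3 + ε) * Fintype.card C.supp ∧
      ∀ c2 : C.supp → Z3, (∀ v w, C.toSimpleGraph.Adj v w → c2 v ≠ c2 w) → (∀ v ∈ T, c2 v = c v) →
        ∀ v, c2 v = c v := by
    intro C
    refine H C.supp C.toSimpleGraph (cub_comp hG C) C.connected_toSimpleGraph (hM.trans (hC C))
      (univ.filter (fun v => Bad C.toSimpleGraph L v)) (by simp) ?_
    have h1 : (univ.filter (fun v : C.supp => Bad C.toSimpleGraph L v)).card ≤ B.card := by
      refine card_le_card_of_injOn Subtype.val ?_ (Subtype.val_injective.injOn)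
      intro v hv
      exact hB _ (bad_comp C v (by simpa using hv))
    have h2 : (M : ℝ) ≤ Fintype.card C.supp := by exact_mod_cast hC C
    calc _ ≤ (B.card : ℝ) := by exact_mod_cast h1
      _ ≤ δ * M := hBM
      _ ≤ _ := by gcongr
  choose c hc T hT hu using key
  have hadj : ∀ {v w}, G.Adj v w → ∃ C : G.ConnectedComponent, ∃ hv : v ∈ C.supp, ∃ hw : w ∈ C.supp,
      C.toSimpleGraph.Adj ⟨v, hv⟩ ⟨w, hw⟩ := by
    intro v w h
    refine ⟨G.connectedComponentMk v, rfl, ?_, h⟩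
    exact (ConnectedComponent.eq.2 h.reachable).symm
  set cc : V → Z3 := fun v => c (G.connectedComponentMk v) ⟨v, rfl⟩ with hcc
  have hval : ∀ (C : G.ConnectedComponent) v (hv : v ∈ C.supp), cc v = c C ⟨v, hv⟩ := by
    intro C v hv
    have : G.connectedComponentMk v = C := hv
    subst this; rfl
  refine ⟨cc, ?_, univ.biUnion (fun C => (T C).map (Function.Embedding.subtype _)), ?_, ?_⟩
  · intro v w h
    obtain ⟨C, hv, hw, h⟩ := hadj h
    rw [hval C v hv, hval C w hw]
    exact hc C _ _ h
  · calc _ ≤ ((∑ C : G.ConnectedComponent, (T C).card : ℕ) : ℝ) := by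
          refine Nat.cast_le.2 (card_biUnion_le.trans (sum_le_sum fun C _ => ?_))
          rw [card_map]
      _ ≤ ∑ C : G.ConnectedComponent, (1/3 + ε) * (Fintype.card C.supp : ℝ) := by
          push_cast; exact sum_le_sum fun C _ => hT C
      _ = _ := by rw [← mul_sum, ← sum_comp G]; push_cast; rfl
  · intro c2 h2 hT2 v
    rw [hval _ v rfl]
    refine hu (G.connectedComponentMk v) (fun x => c2 x.1) (fun a b h => h2 _ _ h) ?_ ⟨v, rfl⟩
    intro x hx
    rw [← hval]
    apply hT2
    simp only [mem_biUnion, mem_univ, true_and, mem_map]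
    exact ⟨_, x, hx, rfl⟩

lemma sud3 (h3 : G.chromaticNumber.toNat = 3) (T : Finset V) (c : V → Z3)
    (hc : ∀ v w, G.Adj v w → c v ≠ c w)
    (hu : ∀ c2 : V → Z3, (∀ v w, G.Adj v w → c2 v ≠ c2 w) → (∀ v ∈ T, c2 v = c v) → ∀ v, c2 v = c v) :
    IsSudokuSet G T := by
  unfold IsSudokuSet
  rw [h3]
  refine ⟨c, Coloring.mk c (fun {v w} h => hc v w h), fun v _ => rfl, ?_⟩
  intro c2 h2
  ext1 v
  exact hu c2 (fun v w h => c2.valid h) h2 v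

lemma sud2 (h3 : G.chromaticNumber.toNat = 2) (hcol : G.Colorable 2) (M : ℕ)
    (hC : ∀ C : G.ConnectedComponent, M ≤ Fintype.card C.supp) :
    ∃ T : Finset V, IsSudokuSet G T ∧ T.card * M ≤ Fintype.card V := by
  obtain ⟨c⟩ := hcol
  refine ⟨univ.image (fun C : G.ConnectedComponent => Quot.out C), ?_, ?_⟩
  · unfold IsSudokuSet
    rw [h3]
    refine ⟨c, c, fun v _ => rfl, ?_⟩
    intro c2 h2
    ext1 v
    have step : ∀ a b, G.Adj a b → c2 a = c a → c2 b = c b := by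
      intro a b h h1
      have e1 := c.valid h
      have e2 := c2.valid h
      rw [h1] at e2
      revert e1 e2
      generalize c a = x; generalize c b = y; generalize c2 b = z
      revert x y z; decide
    have hr : G.Reachable (Quot.out (G.connectedComponentMk v)) v :=
      ConnectedComponent.eq.1 (Quot.out_eq (G.connectedComponentMk v))
    obtain ⟨w⟩ := hr
    have h0 := h2 (Quot.out (G.connectedComponentMk v)) (mem_image_of_mem _ (mem_univ _))
    revert h0
    generalize Quot.out (G.connectedComponentMk v) = u at w
    induction w with
    | nil => exact id
    | cons h p ih => exact fun h0 => ih (step _ _ h h0)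
  · rw [← sum_comp G]
    calc _ ≤ (Fintype.card G.ConnectedComponent) * M := Nat.mul_le_mul_right _ card_image_le
      _ ≤ _ := by
        rw [← smul_eq_mul, ← card_univ, ← sum_const]
        exact sum_le_sum fun C _ => hC C

theorem sud_le (ε : ℝ) (hε : 0 < ε) : ∃ L : ℕ, ∀ Bd : ℕ, ∃ M : ℕ, ∀ (V : Type) [Fintype V] [Nonempty V] (G : SimpleGraph V),
    Cub G → (∀ C : G.ConnectedComponent, M ≤ Fintype.card C.supp) →
    ∀ B : Finset V, (∀ v, Bad G L v → v ∈ B) → B.card ≤ Bd → 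
    (sudokuNumber G : ℝ) ≤ (1/3 + ε) * Fintype.card V := by
  obtain ⟨L, δ, N0, hδ, H⟩ := conn_main ε hε
  refine ⟨L, fun Bd => ?_⟩
  obtain ⟨M1, hM1⟩ := exists_nat_gt ((Bd : ℝ) / δ)
  refine ⟨max (max N0 3) M1, ?_⟩
  intro V _ _ G hG hC B hB hBd
  set M := max (max N0 3) M1 with hM
  have hM3 : 3 ≤ M := by omega
  have hBM : (B.card : ℝ) ≤ δ * M := by
    rw [div_lt_iff₀ hδ] at hM1
    have h1 : (M1 : ℝ) ≤ M := by exact_mod_cast le_max_right _ _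
    have h2 : (B.card : ℝ) ≤ Bd := by exact_mod_cast hBd
    nlinarith
  obtain ⟨c, hc, T, hT, hu⟩ := glue ε L δ N0 M hδ H hG (by omega) hC B hB hBM
  have hcol3 : G.Colorable 3 := ⟨Coloring.mk (α := Fin 3) c (fun {v w} h => hc v w h)⟩
  have hle : G.chromaticNumber ≤ 3 := hcol3.chromaticNumber_le
  have hsud : ∀ S : Finset V, IsSudokuSet G S → sudokuNumber G ≤ S.card :=
    fun S hS => Nat.sInf_le ⟨S, hS, rfl⟩
  have hedge : ∃ a b, G.Adj a b := by
    obtain ⟨v⟩ := ‹Nonempty V›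
    obtain ⟨x, _, _, _, _, _, h⟩ := hG.exists3 v
    exact ⟨v, x, (h x).2 (Or.inl rfl)⟩
  have hge : 2 ≤ G.chromaticNumber := by
    obtain ⟨a, b, h⟩ := hedge
    exact two_le_chromaticNumber_of_adj h
  by_cases h2 : G.Colorable 2
  · have hle2 : G.chromaticNumber = 2 := le_antisymm h2.chromaticNumber_le hge
    obtain ⟨S, hS, hc⟩ := sud2 (by rw [hle2]; rfl) h2 M hC
    have h1 := hsud S hS
    have : sudokuNumber G * 3 ≤ Fintype.card V := 
      (Nat.mul_le_mul h1 hM3).trans hc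
    have : (sudokuNumber G : ℝ) * 3 ≤ Fintype.card V := by exact_mod_cast this
    nlinarith [mul_nonneg hε.le (Nat.cast_nonneg (α := ℝ) (Fintype.card V))]
  · have : G.chromaticNumber = 3 := by
      refine le_antisymm hle ?_
      by_contra hlt
      push Not at hlt
      apply h2
      refine chromaticNumber_le_iff_colorable.1 ?_
      refine Order.le_of_lt_add_one ?_
      have e : ((2:ℕ) : ℕ∞) + 1 = 3 := by norm_num
      rw [e]; exact hlt
    have h1 := hsud T (sud3 (by rw [this]; rfl) T c hc hu)
    exact le_trans (by exact_mod_cast h1) hT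
end
end Sud

open SimpleGraph Finset

namespace Sud
section
open Classical
variable {V : Type} [Fintype V]

noncomputable def cgS (F : Finset (Sym2 V)) : Finset (SimpleGraph V) :=
  univ.filter (fun G => Cub G ∧ ∀ e ∈ F, e ∈ G.edgeSet)

lemma mem_cgS {F : Finset (Sym2 V)} {G : SimpleGraph V} : G ∈ cgS F ↔ Cub G ∧ ∀ e ∈ F, e ∈ G.edgeSet := by
  simp [cgS]

lemma ord_le (F : Finset (Sym2 V)) : (univ.filter (fun p : V × V => s(p.1, p.2) ∈ F)).card ≤ 2 * F.card := by
  refine card_le_mul_card_image_of_maps_to (f := fun p : V × V => s(p.1, p.2)) (by simp) _ ?_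
  intro e _
  induction e with
  | _ a b =>
  refine (card_le_card (t := {(a, b), (b, a)}) ?_).trans card_le_two
  rintro ⟨x, y⟩ h
  simp only [mem_filter, Sym2.eq_iff] at h
  simp only [mem_insert, mem_singleton, Prod.mk.injEq]
  exact h.2

lemma card_fst {G : SimpleGraph V} (hG : Cub G) (P : V → Prop) :
    (univ.filter (fun p : V × V => P p.1 ∧ G.Adj p.1 p.2)).card = 3 * (univ.filter P).card := by
  have : univ.filter (fun p : V × V => P p.1 ∧ G.Adj p.1 p.2) =
      (univ.filter P).biUnion (fun x => (univ.filter (fun v => G.Adj x v)).image (fun y => (x, y))) := by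
    ext ⟨a, b⟩
    simp
  rw [this, card_biUnion]
  · have hc : ∀ x : V, ((univ.filter (fun v => G.Adj x v)).image (fun y => (x, y))).card = 3 := fun x => by
      rw [card_image_of_injective _ (fun _ _ h => (Prod.mk.inj h).2), nb_card hG]
    simp only [hc]
    rw [sum_const, smul_eq_mul, mul_comm]
  · intro x _ y _ hxy
    simp only [Function.onFun]
    rw [Finset.disjoint_left]
    rintro ⟨a, b⟩ h1 h2
    simp at h1 h2
    grind

lemma card_snd {G : SimpleGraph V} (hG : Cub G) (P : V → Prop) :
    (univ.filter (fun p : V × V => P p.2 ∧ G.Adj p.1 p.2)).card = 3 * (univ.filter P).card := by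
  rw [← card_fst hG P]
  refine card_bij (fun p _ => p.swap) ?_ ?_ ?_
  · rintro ⟨a, b⟩ h; simp at h ⊢; exact ⟨h.1, h.2.symm⟩
  · rintro ⟨a, b⟩ _ ⟨c, d⟩ _ h; simp at h ⊢; tauto
  · rintro ⟨a, b⟩ h; simp at h; exact ⟨(b, a), by simp; exact ⟨h.1, h.2.symm⟩, rfl⟩

/-- switching -/
def sw (G : SimpleGraph V) (u v x y : V) : SimpleGraph V :=
  fromEdgeSet ((G.edgeSet \ {s(u, v), s(x, y)}) ∪ {s(u, x), s(v, y)})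

lemma sw_edge {G : SimpleGraph V} {u v x y : V} (h1 : x ≠ u) (h2 : y ≠ v) (e : Sym2 V) :
    e ∈ (sw G u v x y).edgeSet ↔ (e ∈ G.edgeSet ∧ e ≠ s(u, v) ∧ e ≠ s(x, y)) ∨ e = s(u, x) ∨ e = s(v, y) := by
  unfold sw
  rw [edgeSet_fromEdgeSet]
  simp only [Set.mem_sdiff, Set.mem_union, Set.mem_insert_iff, Set.mem_singleton_iff, not_or]
  constructor
  · rintro ⟨h, _⟩; exact h
  · intro h
    refine ⟨h, ?_⟩
    rcases h with h | rfl | rfl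
    · exact G.not_isDiag_of_mem_edgeSet h.1
    · simpa using h1.symm
    · simpa using h2.symm

lemma sw_cub {G : SimpleGraph V} (hG : Cub G) {u v x y : V} (huv : G.Adj u v) (hxy : G.Adj x y)
    (h1 : x ≠ u) (h2 : y ≠ v) (h3 : ¬ G.Adj u x) (h4 : ¬ G.Adj v y) : Cub (sw G u v x y) := by
  have hxv : x ≠ v := fun h => h3 (h ▸ huv)
  have hyu : y ≠ u := fun h => h4 (h ▸ huv.symm)
  have huv' := huv.ne
  have hxy' := hxy.ne
  have key : ∀ a b, (sw G u v x y).Adj a b ↔ (G.Adj a b ∧ s(a,b) ≠ s(u, v) ∧ s(a,b) ≠ s(x, y)) ∨ s(a,b) = s(u, x) ∨ s(a,b) = s(v, y) := by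
    intro a b
    rw [← mem_edgeSet, sw_edge h1 h2]; rfl
  have ex : ∀ w a b, G.Adj w b → ¬ G.Adj w a → (∀ z, (sw G u v x y).Adj w z ↔ z = a ∨ (G.Adj w z ∧ z ≠ b)) →
      ((sw G u v x y).neighborSet w).ncard = 3 := by
    intro w a b hb ha h
    rw [← hG w, ← Set.ncard_exchange (s := G.neighborSet w) (a := a) (b := b) ha hb]
    congr 1
    ext z
    exact h z
  intro w
  by_cases hwu : w = u
  · subst hwu
    refine ex w x v huv h3 fun z => ?_
    rw [key]; simp only [Sym2.eq_iff, ne_eq]; grind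
  by_cases hwv : w = v
  · subst hwv
    refine ex w y u huv.symm h4 fun z => ?_
    rw [key]; simp only [Sym2.eq_iff, ne_eq]; grind
  by_cases hwx : w = x
  · subst hwx
    refine ex w u y hxy (fun h => h3 h.symm) fun z => ?_
    rw [key]; simp only [Sym2.eq_iff, ne_eq]; grind
  by_cases hwy : w = y
  · subst hwy
    refine ex w v x hxy.symm (fun h => h4 h.symm) fun z => ?_
    rw [key]; simp only [Sym2.eq_iff, ne_eq]; grind
  rw [← hG w]
  congr 1
  ext z
  simp only [mem_neighborSet]
  rw [key]; simp only [Sym2.eq_iff, ne_eq]; grind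

def Gd (F : Finset (Sym2 V)) (G : SimpleGraph V) (u v : V) (p : V × V) : Prop :=
  G.Adj p.1 p.2 ∧ p.1 ≠ u ∧ p.2 ≠ v ∧ ¬ G.Adj u p.1 ∧ ¬ G.Adj v p.2 ∧ s(p.1, p.2) ∉ F

lemma gd_card (F : Finset (Sym2 V)) {G : SimpleGraph V} (hG : Cub G) (u v : V) :
    3 * Fintype.card V ≤ (univ.filter (Gd F G u v)).card + (24 + 2 * F.card) := by
  have e0 := card_fst hG (fun x => x = x)
  have e1 := card_fst hG (fun x => x = u)
  have e2 := card_snd hG (fun x => x = v)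
  have e3 := card_fst hG (fun x => G.Adj u x)
  have e4 := card_snd hG (fun x => G.Adj v x)
  rw [nb_card hG] at e3 e4
  rw [filter_eq' univ u, if_pos (mem_univ _), card_singleton] at e1
  rw [filter_eq' univ v, if_pos (mem_univ _), card_singleton] at e2
  rw [filter_true_of_mem (fun _ _ => rfl), card_univ] at e0
  have e5 := ord_le F
  have hsub : univ.filter (fun p : V × V => p.1 = p.1 ∧ G.Adj p.1 p.2) ⊆
      univ.filter (Gd F G u v) ∪ (univ.filter (fun p : V × V => p.1 = u ∧ G.Adj p.1 p.2) ∪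
        (univ.filter (fun p : V × V => p.2 = v ∧ G.Adj p.1 p.2) ∪
        (univ.filter (fun p : V × V => G.Adj u p.1 ∧ G.Adj p.1 p.2) ∪
        (univ.filter (fun p : V × V => G.Adj v p.2 ∧ G.Adj p.1 p.2) ∪
        univ.filter (fun p : V × V => s(p.1, p.2) ∈ F))))) := by
    intro p hp
    simp only [mem_filter, mem_univ, true_and, mem_union, Gd] at hp ⊢
    tauto
  have h := card_le_card hsub
  have := h.trans (card_union_le _ _)
  have := card_union_le (univ.filter (fun p : V × V => p.1 = u ∧ G.Adj p.1 p.2)) 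
        (univ.filter (fun p : V × V => p.2 = v ∧ G.Adj p.1 p.2) ∪
        (univ.filter (fun p : V × V => G.Adj u p.1 ∧ G.Adj p.1 p.2) ∪
        (univ.filter (fun p : V × V => G.Adj v p.2 ∧ G.Adj p.1 p.2) ∪
        univ.filter (fun p : V × V => s(p.1, p.2) ∈ F))))
  have := card_union_le  (univ.filter (fun p : V × V => p.2 = v ∧ G.Adj p.1 p.2))
        (univ.filter (fun p : V × V => G.Adj u p.1 ∧ G.Adj p.1 p.2) ∪
        (univ.filter (fun p : V × V => G.Adj v p.2 ∧ G.Adj p.1 p.2) ∪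
        univ.filter (fun p : V × V => s(p.1, p.2) ∈ F)))
  have := card_union_le 
        (univ.filter (fun p : V × V => G.Adj u p.1 ∧ G.Adj p.1 p.2)) 
        (univ.filter (fun p : V × V => G.Adj v p.2 ∧ G.Adj p.1 p.2) ∪
        univ.filter (fun p : V × V => s(p.1, p.2) ∈ F))
  have := card_union_le 
        (univ.filter (fun p : V × V => G.Adj v p.2 ∧ G.Adj p.1 p.2)) 
        (univ.filter (fun p : V × V => s(p.1, p.2) ∈ F))
  omega

lemma switch (F : Finset (Sym2 V)) (e : Sym2 V) (he : e ∉ F) (hn : 12 + F.card ≤ Fintype.card V) :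
    (cgS (insert e F)).card * Fintype.card V ≤ 9 * (cgS F).card := by
  induction e with
  | _ u v =>
  have hA : (cgS (insert s(u, v) F)).card * Fintype.card V ≤
      ((cgS (insert s(u, v) F)).sigma (fun G => univ.filter (Gd F G u v))).card := by
    rw [card_sigma, ← smul_eq_mul, ← sum_const]
    refine sum_le_sum fun G hG => ?_
    have := gd_card F (mem_cgS.1 hG).1 u v
    omega
  have hB : ((cgS F).sigma (fun G => (univ.filter (fun x => G.Adj u x)) ×ˢ (univ.filter (fun x => G.Adj v x)))).card
      = 9 * (cgS F).card := by
    rw [card_sigma, mul_comm, ← smul_eq_mul, ← sum_const]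
    refine sum_congr rfl fun G hG => ?_
    rw [card_product, nb_card (mem_cgS.1 hG).1, nb_card (mem_cgS.1 hG).1]
  refine hA.trans (le_trans ?_ hB.le)
  refine card_le_card_of_injOn (fun q => ⟨sw q.1 u v q.2.1 q.2.2, q.2⟩) ?_ ?_
  · rintro ⟨G, x, y⟩ h
    simp only [coe_sigma, Set.mem_sigma_iff, mem_coe, mem_cgS, mem_filter, mem_univ, true_and, Gd, mem_product] at h ⊢
    obtain ⟨⟨hG, hF⟩, hxy, h1, h2, h3, h4, h5⟩ := h
    have huv : G.Adj u v := hF _ (mem_insert_self _ _)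
    refine ⟨⟨sw_cub hG huv hxy h1 h2 h3 h4, ?_⟩, ?_, ?_⟩
    · intro e heF
      rw [sw_edge h1 h2]
      exact Or.inl ⟨hF e (mem_insert_of_mem heF), fun h => he (h ▸ heF), fun h => h5 (h ▸ heF)⟩
    · rw [← mem_edgeSet, sw_edge h1 h2]; simp
    · rw [← mem_edgeSet, sw_edge h1 h2]; simp
  · rintro ⟨G, x, y⟩ h ⟨G', x', y'⟩ h' heq
    simp only [coe_sigma, Set.mem_sigma_iff, mem_coe, mem_cgS, mem_filter, mem_univ, true_and, Gd] at h h'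
    simp only [Sigma.mk.injEq, heq_eq_eq, Prod.mk.injEq] at heq
    obtain ⟨heq, rfl, rfl⟩ := heq
    obtain ⟨⟨hG, hF⟩, hxy, h1, h2, h3, h4, h5⟩ := h
    obtain ⟨⟨hG', hF'⟩, hxy', h1', h2', h3', h4', h5'⟩ := h'
    have huv : s(u, v) ∈ G.edgeSet := hF _ (mem_insert_self _ _)
    have huv' : s(u, v) ∈ G'.edgeSet := hF' _ (mem_insert_self _ _)
    have : G = G' := by
      apply SimpleGraph.edgeSet_injective
      ext e
      have hh : e ∈ (sw G u v x y).edgeSet ↔ e ∈ (sw G' u v x y).edgeSet := by rw [heq]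
      rw [sw_edge h1 h2, sw_edge h1 h2] at hh
      have i1 : s(x, y) ∈ G.edgeSet := hxy
      have i1' : s(x, y) ∈ G'.edgeSet := hxy'
      have i3 : s(u, x) ∉ G.edgeSet := h3
      have i4 : s(v, y) ∉ G.edgeSet := h4
      have i3' : s(u, x) ∉ G'.edgeSet := h3'
      have i4' : s(v, y) ∉ G'.edgeSet := h4'
      grind
    rw [this]

theorem cg_bound (F : Finset (Sym2 V)) (hn : 12 + F.card ≤ Fintype.card V) :
    (cgS F).card * Fintype.card V ^ F.card ≤ 9 ^ F.card * (cgS (∅ : Finset (Sym2 V))).card := by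
  induction F using Finset.induction_on with
  | empty => simp
  | insert e F he ih =>
    rw [card_insert_of_notMem he] at hn ⊢
    have h1 := switch F e he (by omega)
    have h2 := ih (by omega)
    calc _ = ((cgS (insert e F)).card * Fintype.card V) * Fintype.card V ^ F.card := by ring
      _ ≤ (9 * (cgS F).card) * Fintype.card V ^ F.card := Nat.mul_le_mul_right _ h1
      _ = 9 * ((cgS F).card * Fintype.card V ^ F.card) := by ring
      _ ≤ 9 * (9 ^ F.card * (cgS (∅ : Finset (Sym2 V))).card) := Nat.mul_le_mul_left _ h2
      _ = _ := by ring

end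
end Sud

open SimpleGraph Finset

namespace Sud
section
open Classical
variable {V : Type} [Fintype V]

noncomputable def conf (V : Type) [Fintype V] (e k : ℕ) : Finset (Σ _ : Finset V, Finset (Sym2 V)) :=
  (powersetCard k univ).sigma (fun S => powersetCard e S.sym2)

def KK (e k : ℕ) : ℕ := ((k + 1).choose 2).choose e * 9 ^ e

lemma conf_bound (e k : ℕ) (hn : 12 + e ≤ Fintype.card V) :
    (∑ q ∈ conf V e k, (cgS q.2).card) * Fintype.card V ^ e ≤
      Fintype.card V ^ k * KK e k * (cgS (∅ : Finset (Sym2 V))).card := by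
  have hc : (conf V e k).card ≤ Fintype.card V ^ k * ((k + 1).choose 2).choose e := by
    unfold conf
    rw [card_sigma]
    have : ∀ S ∈ powersetCard k (univ : Finset V), (powersetCard e S.sym2).card = ((k + 1).choose 2).choose e := by
      intro S hS
      rw [card_powersetCard, Finset.card_sym2, (mem_powersetCard.1 hS).2]
    rw [sum_congr rfl this, sum_const, card_powersetCard, smul_eq_mul, card_univ]
    exact Nat.mul_le_mul_right _ (Nat.choose_le_pow _ _)
  rw [sum_mul]
  calc _ ≤ ∑ q ∈ conf V e k, 9 ^ e * (cgS (∅ : Finset (Sym2 V))).card := by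
        refine sum_le_sum fun q hq => ?_
        have h : q.2.card = e := by
          have := (mem_sigma.1 hq).2
          exact (mem_powersetCard.1 this).2
        have := cg_bound q.2 (by omega)
        rwa [h] at this
    _ = (conf V e k).card * (9 ^ e * (cgS (∅ : Finset (Sym2 V))).card) := by rw [sum_const, smul_eq_mul]
    _ ≤ _ := Nat.mul_le_mul_right _ hc
    _ = _ := by unfold KK; ring

lemma bad_conf {G : SimpleGraph V} (hG : Cub G) {L : ℕ} {v : V} (h : Bad G L v) :
    ∃ k ∈ range (L + 1), ∃ q ∈ conf V k k, G ∈ cgS q.2 ∧ v ∈ q.1 := by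
  obtain ⟨c, hc, hl⟩ := h
  have hnn : ¬ c.Nil := by
    have := hc.three_le_length
    intro h
    rw [← Walk.length_eq_zero_iff] at h
    omega
  have hv : v ∈ c.support.tail := c.end_mem_tail_support hnn
  have hmem : ∀ x ∈ c.support, x ∈ c.support.tail := by
    intro x hx
    rw [← Walk.cons_tail_support] at hx
    rcases List.mem_cons.1 hx with rfl | h
    · exact hv
    · exact h
  refine ⟨c.length, mem_range.2 (by omega), ⟨c.support.tail.toFinset, c.edges.toFinset⟩, ?_, ?_, ?_⟩
  · rw [conf, mem_sigma, mem_powersetCard, mem_powersetCard]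
    refine ⟨⟨subset_univ _, ?_⟩, ?_, ?_⟩
    · rw [List.toFinset_card_of_nodup hc.support_nodup]; simp
    · intro e he
      rw [List.mem_toFinset] at he
      induction e with
      | _ a b =>
      rw [mk_mem_sym2_iff]
      simp only [List.mem_toFinset]
      exact ⟨hmem _ (c.fst_mem_support_of_mem_edges he), hmem _ (c.snd_mem_support_of_mem_edges he)⟩
    · rw [List.toFinset_card_of_nodup hc.edges_nodup, Walk.length_edges]
  · rw [mem_cgS]
    refine ⟨hG, fun e he => ?_⟩
    exact c.edges_subset_edgeSet (List.mem_toFinset.1 he)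
  · exact List.mem_toFinset.2 hv

lemma comp_conf {G : SimpleGraph V} (hG : Cub G) {M : ℕ} (C : G.ConnectedComponent) (h : Fintype.card C.supp < M) :
    ∃ k ∈ range M, ∃ q ∈ conf V (k + 1) k, G ∈ cgS q.2 := by
  set S : Finset V := univ.filter (fun v => v ∈ C.supp) with hS
  have hSc : S.card = Fintype.card C.supp := by
    rw [Fintype.card_subtype]
  set F : Finset (Sym2 V) := S.sym2.filter (fun e => e ∈ G.edgeSet) with hF
  have h3 : 3 * S.card ≤ 2 * F.card := by
    have e := card_fst hG (fun v => v ∈ C.supp)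
    have e2 : 3 * S.card = (univ.filter (fun p : V × V => p.1 ∈ C.supp ∧ G.Adj p.1 p.2)).card := by
      rw [hS]; convert e.symm
    rw [e2]
    refine (card_le_card ?_).trans (ord_le F)
    rintro ⟨a, b⟩ hp
    simp only [mem_filter, mem_univ, true_and, hF, hS, mk_mem_sym2_iff, mem_edgeSet] at hp ⊢
    exact ⟨⟨hp.1, C.mem_supp_of_adj_mem_supp hp.1 hp.2⟩, hp.2⟩
  have h4 : 2 ≤ S.card := by
    obtain ⟨v, hv⟩ := C.nonempty_supp
    obtain ⟨x, _, _, _, _, _, hx⟩ := hG.exists3 v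
    have hvx := (hx x).2 (Or.inl rfl)
    refine Finset.one_lt_card.2 ⟨v, by simpa [hS] using hv, x, ?_, hvx.ne⟩
    have := C.mem_supp_of_adj_mem_supp hv hvx
    simpa [hS] using this
  obtain ⟨F', hF', hFc⟩ := exists_subset_card_eq (by omega : S.card + 1 ≤ F.card)
  refine ⟨S.card, mem_range.2 (by omega), ⟨S, F'⟩, ?_, ?_⟩
  · rw [conf, mem_sigma, mem_powersetCard, mem_powersetCard]
    exact ⟨⟨subset_univ _, rfl⟩, hF'.trans (filter_subset _ _), hFc⟩
  · rw [mem_cgS]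
    exact ⟨hG, fun e he => (mem_filter.1 (hF' he)).2⟩

lemma small_bound (M : ℕ) (hn : 12 + M ≤ Fintype.card V) :
    ((cgS (∅ : Finset (Sym2 V))).filter (fun G => ∃ C : G.ConnectedComponent, Fintype.card C.supp < M)).card
      * Fintype.card V ≤ (∑ k ∈ range M, KK (k + 1) k) * (cgS (∅ : Finset (Sym2 V))).card := by
  have h1 : ((cgS (∅ : Finset (Sym2 V))).filter (fun G => ∃ C : G.ConnectedComponent, Fintype.card C.supp < M)).card
      ≤ ∑ k ∈ range M, ∑ q ∈ conf V (k + 1) k, (cgS q.2).card := by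
    refine (card_le_card (t := (range M).biUnion fun k => (conf V (k + 1) k).biUnion fun q => cgS q.2) ?_).trans
      (card_biUnion_le.trans (sum_le_sum fun k _ => card_biUnion_le))
    intro G hG
    obtain ⟨hG, C, hC⟩ := mem_filter.1 hG
    obtain ⟨k, hk, q, hq, h⟩ := comp_conf (mem_cgS.1 hG).1 C hC
    exact mem_biUnion.2 ⟨k, hk, mem_biUnion.2 ⟨q, hq, h⟩⟩
  refine (Nat.mul_le_mul_right _ h1).trans ?_
  rw [sum_mul, sum_mul]
  refine sum_le_sum fun k hk => ?_
  have := conf_bound (V := V) (k + 1) k (by have := mem_range.1 hk; omega)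
  have hpos : 0 < Fintype.card V ^ k := by
    have : 0 < Fintype.card V := by omega
    positivity
  refine Nat.le_of_mul_le_mul_left ?_ hpos
  calc _ = _ := by ring
    _ ≤ _ := this
    _ = _ := by ring

lemma bad_bound (L : ℕ) (hn : 12 + L ≤ Fintype.card V) :
    ∑ G ∈ cgS (∅ : Finset (Sym2 V)), (univ.filter (fun v => Bad G L v)).card ≤
      (∑ k ∈ range (L + 1), k * KK k k) * (cgS (∅ : Finset (Sym2 V))).card := by
  have h1 : ∀ G ∈ cgS (∅ : Finset (Sym2 V)), (univ.filter (fun v => Bad G L v)).card ≤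
      ∑ k ∈ range (L + 1), ∑ q ∈ conf V k k, if G ∈ cgS q.2 then k else 0 := by
    intro G hG
    refine (card_le_card (t := (range (L + 1)).biUnion fun k => (conf V k k).biUnion fun q => if G ∈ cgS q.2 then q.1 else ∅) ?_).trans
      (card_biUnion_le.trans (sum_le_sum fun k _ => card_biUnion_le.trans (sum_le_sum fun q hq => ?_)))
    · intro v hv
      obtain ⟨k, hk, q, hq, h, h'⟩ := bad_conf (mem_cgS.1 hG).1 (mem_filter.1 hv).2
      refine mem_biUnion.2 ⟨k, hk, mem_biUnion.2 ⟨q, hq, ?_⟩⟩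
      rwa [if_pos h]
    · split_ifs
      · exact (mem_powersetCard.1 (mem_sigma.1 hq).1).2.le
      · simp
  refine (sum_le_sum h1).trans ?_
  rw [sum_comm, sum_mul]
  refine sum_le_sum fun k hk => ?_
  rw [sum_comm]
  have h2 : ∀ q ∈ conf V k k, (∑ G ∈ cgS (∅ : Finset (Sym2 V)), if G ∈ cgS q.2 then k else 0) ≤ k * (cgS q.2).card := by
    intro q _
    rw [← sum_filter, sum_const, smul_eq_mul, mul_comm]
    exact Nat.mul_le_mul_left _ (card_le_card fun G h => (mem_filter.1 h).2)
  refine (sum_le_sum h2).trans ?_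
  rw [← mul_sum, mul_assoc]
  refine Nat.mul_le_mul_left _ ?_
  have := conf_bound (V := V) k k (by have := mem_range.1 hk; omega)
  have hpos : 0 < Fintype.card V ^ k := by
    have : 0 < Fintype.card V := by omega
    positivity
  refine Nat.le_of_mul_le_mul_left ?_ hpos
  calc _ = _ := by ring
    _ ≤ _ := this
    _ = _ := by ring

lemma markov (L b : ℕ) (hn : 12 + L ≤ Fintype.card V) :
    ((cgS (∅ : Finset (Sym2 V))).filter (fun G => b < (univ.filter (fun v => Bad G L v)).card)).card * b ≤
      (∑ k ∈ range (L + 1), k * KK k k) * (cgS (∅ : Finset (Sym2 V))).card := by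
  refine le_trans ?_ (bad_bound L hn)
  rw [← smul_eq_mul, ← sum_const]
  refine (sum_le_sum fun G hG => (mem_filter.1 hG).2.le).trans ?_
  exact sum_le_sum_of_subset (filter_subset _ _)

/-- existence -/
lemma exists_cubic (m : ℕ) : ∃ G : SimpleGraph (Fin (2 * m + 4)), Cub G := by
  let A : Fin (2 * m + 4) → Fin (2 * m + 4) → Prop := fun i j =>
    j = i + 1 ∨ i = j + 1 ∨ j = i + (⟨m + 2, by omega⟩ : Fin (2 * m + 4))
  have hh : ∀ i : Fin (2 * m + 4), i + (⟨m + 2, by omega⟩ : Fin (2 * m + 4)) + (⟨m + 2, by omega⟩ : Fin (2 * m + 4)) = i := by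
    intro i
    rw [add_assoc]
    have : (⟨m + 2, by omega⟩ : Fin (2 * m + 4)) + (⟨m + 2, by omega⟩ : Fin (2 * m + 4)) = 0 := by
      ext
      rw [Fin.val_add]
      have : m + 2 + (m + 2) = 2 * m + 4 := by omega
      simp [this]
    rw [this, add_zero]
  have h1 : (1 : Fin (2 * m + 4)) ≠ 0 := by
    intro h; have := congrArg Fin.val h; simp at this
  have h2 : (⟨m + 2, by omega⟩ : Fin (2 * m + 4)) ≠ 0 := by
    intro h; have := congrArg Fin.val h; simp at this
  have h3 : (⟨m + 2, by omega⟩ : Fin (2 * m + 4)) ≠ 1 := by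
    intro h; have := congrArg Fin.val h; simp at this
  have h4 : (⟨m + 2, by omega⟩ : Fin (2 * m + 4)) + 1 ≠ 0 := by
    intro h; have := congrArg Fin.val h
    rw [Fin.val_add] at this
    simp at this
    rw [Nat.mod_eq_of_lt (by omega)] at this
    omega
  have h5 : (1 : Fin (2 * m + 4)) + 1 ≠ 0 := by
    intro h; have := congrArg Fin.val h
    rw [Fin.val_add] at this
    simp at this
    try rw [Nat.mod_eq_of_lt (by omega)] at this
    try omega
  generalize hhd : (⟨m + 2, by omega⟩ : Fin (2 * m + 4)) = d at *
  refine ⟨⟨A, ⟨?_⟩, ⟨?_⟩⟩, ?_⟩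
  · rintro i j (h | h | h)
    · exact Or.inr (Or.inl h)
    · exact Or.inl h
    · right; right; rw [h, hhd, hh]
  · rintro i (h | h | h)
    · exact h1 (by simpa using h)
    · exact h1 (by simpa using h)
    · rw [hhd] at h; exact h2 (by simpa using h)
  · intro i
    rw [Set.ncard_eq_three]
    refine ⟨i + 1, i - 1, i + d, ?_, ?_, ?_, ?_⟩
    · intro h
      apply h5
      have : i + 1 + 1 - i = i - 1 + 1 - i := by rw [h]
      simpa [add_assoc] using this
    · intro h; exact h3 (add_left_cancel h).symm
    · intro h
      apply h4
      have : i - 1 + 1 - i = i + d + 1 - i := by rw [h]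
      have := this.symm
      simpa [add_assoc] using this
    · ext j
      simp only [mem_neighborSet, Set.mem_insert_iff, Set.mem_singleton_iff]
      show (j = i + 1 ∨ i = j + 1 ∨ j = i + _) ↔ _
      rw [hhd, eq_sub_iff_add_eq, eq_comm (a := i)]
end
end Sud

open SimpleGraph Finset

namespace Sud
section
open Classical

lemma final_count (ε : ℝ) (hε : 0 < ε) (η : ℝ) (hη : 0 < η) : ∃ N : ℕ, ∀ (V : Type) [Fintype V] [Nonempty V],
    N ≤ Fintype.card V → ((cgS (∅ : Finset (Sym2 V))).card : ℝ) * (1 - η) ≤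
    ((cgS (∅ : Finset (Sym2 V))).filter
      (fun G => (sudokuNumber G : ℝ) ≤ (1/3 + ε) * Fintype.card V)).card := by
  obtain ⟨L, hL⟩ := sud_le ε hε
  set C2 : ℕ := ∑ k ∈ range (L + 1), k * KK k k with hC2
  obtain ⟨b, hb⟩ := exists_nat_gt ((C2 : ℝ) / (η / 2))
  obtain ⟨M, hM⟩ := hL b
  set C1 : ℕ := ∑ k ∈ range M, KK (k + 1) k with hC1
  obtain ⟨N1, hN1⟩ := exists_nat_gt ((C1 : ℝ) / (η / 2))
  refine ⟨(12 + L) + (12 + M) + N1, ?_⟩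
  intro V _ _ hN
  have hs := small_bound (V := V) M (by omega)
  have ht := markov (V := V) L b (by omega)
  rw [← hC1] at hs
  rw [← hC2] at ht
  set Z := (cgS (∅ : Finset (Sym2 V))) with hZ
  set s := Z.filter (fun G => ∃ C : G.ConnectedComponent, Fintype.card C.supp < M) with hsd
  set t := Z.filter (fun G => b < (univ.filter (fun v => Bad G L v)).card) with htd
  set g := Z.filter (fun G => (sudokuNumber G : ℝ) ≤ (1/3 + ε) * Fintype.card V) with hg
  have hsub : Z ⊆ g ∪ (s ∪ t) := by
    intro G hG
    by_cases h1 : G ∈ s ∪ t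
    · exact mem_union_right _ h1
    · apply mem_union_left
      rw [mem_union, not_or, hsd, htd, mem_filter, mem_filter] at h1
      obtain ⟨h1, h2⟩ := h1
      have h1' : ¬ ∃ C : G.ConnectedComponent, Fintype.card C.supp < M := fun h => h1 ⟨hG, h⟩
      have h2' : ¬ b < (univ.filter (fun v => Bad G L v)).card := fun h => h2 ⟨hG, h⟩
      push Not at h1' h2'
      refine mem_filter.2 ⟨hG, ?_⟩
      exact hM V G (mem_cgS.1 hG).1 h1' _ (fun v hv => by simpa using hv) h2'
  have hcard : Z.card ≤ g.card + (s.card + t.card) :=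
    (card_le_card hsub).trans ((card_union_le _ _).trans (Nat.add_le_add_left (card_union_le _ _) _))
  have hcr : (Z.card : ℝ) ≤ g.card + (s.card + t.card) := by exact_mod_cast hcard
  have aux : ∀ (C x y z : ℝ), 0 ≤ C → 0 ≤ z → C / (η / 2) < y → x * y ≤ C * z → x ≤ η / 2 * z := by
    intro C x y z hC hz h1 h2
    have hy : 0 < y := lt_of_le_of_lt (by positivity) h1
    rw [div_lt_iff₀ (by positivity)] at h1
    refine le_of_mul_le_mul_right (h2.trans ?_) hy
    nlinarith
  have e1 := aux C1 s.card (Fintype.card V) Z.card (by positivity) (by positivity)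
    (hN1.trans_le (by exact_mod_cast (by omega : N1 ≤ Fintype.card V))) (by exact_mod_cast hs)
  have e2 := aux C2 t.card b Z.card (by positivity) (by positivity) hb (by exact_mod_cast ht)
  linarith

end
end Sud

/-- A.a.s. (as `n → ∞` through even integers), a uniformly random 3-regular simple
graph on `n` vertices has Sudoku number at most `(1/3 + ε) n`. -/
theorem stmt0 (ε : ℝ) (hε : 0 < ε) :
    Filter.Tendsto (fun m : ℕ =>
      ((Nat.card {G : SimpleGraph (Fin (2 * m + 4)) //
          (∀ v, Nat.card (G.neighborSet v) = 3) ∧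
          (sudokuNumber G : ℝ) ≤ (1 / 3 + ε) * (2 * m + 4)} : ℝ) /
        (Nat.card {G : SimpleGraph (Fin (2 * m + 4)) //
          ∀ v, Nat.card (G.neighborSet v) = 3} : ℝ)))
      Filter.atTop (nhds 1) := by
  classical
  have hden : ∀ m : ℕ, Nat.card {G : SimpleGraph (Fin (2 * m + 4)) //
          ∀ v, Nat.card (G.neighborSet v) = 3} = (Sud.cgS (∅ : Finset (Sym2 (Fin (2 * m + 4))))).card := by
    intro m
    rw [Nat.card_eq_fintype_card, Fintype.card_subtype]
    congr 1
    ext G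
    rw [Sud.mem_cgS, mem_filter]
    exact ⟨fun h => ⟨h.2, by simp⟩, fun h => ⟨mem_univ _, h.1⟩⟩
  have hnum : ∀ m : ℕ, Nat.card {G : SimpleGraph (Fin (2 * m + 4)) //
          (∀ v, Nat.card (G.neighborSet v) = 3) ∧
          (sudokuNumber G : ℝ) ≤ (1 / 3 + ε) * (2 * m + 4)} =
      ((Sud.cgS (∅ : Finset (Sym2 (Fin (2 * m + 4))))).filter
      (fun G => (sudokuNumber G : ℝ) ≤ (1/3 + ε) * Fintype.card (Fin (2 * m + 4)))).card := by
    intro m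
    rw [Nat.card_eq_fintype_card, Fintype.card_subtype]
    congr 1
    ext G
    rw [mem_filter, mem_filter, Sud.mem_cgS, Fintype.card_fin]
    push_cast
    exact ⟨fun h => ⟨⟨h.2.1, by simp⟩, h.2.2⟩, fun h => ⟨mem_univ _, h.1.1, h.2⟩⟩
  have hpos : ∀ m : ℕ, 0 < ((Sud.cgS (∅ : Finset (Sym2 (Fin (2 * m + 4))))).card : ℝ) := by
    intro m
    obtain ⟨G, hG⟩ := Sud.exists_cubic m
    exact_mod_cast card_pos.2 ⟨G, Sud.mem_cgS.2 ⟨hG, by simp⟩⟩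
  simp only [hden, hnum]
  rw [tendsto_order]
  constructor
  · intro a ha
    obtain ⟨N, hN⟩ := Sud.final_count ε hε ((1 - a) / 2) (by linarith)
    filter_upwards [Filter.eventually_ge_atTop N] with m hm
    have h := hN (Fin (2 * m + 4)) (by rw [Fintype.card_fin]; omega)
    rw [lt_div_iff₀ (hpos m)]
    refine lt_of_lt_of_le ?_ h
    have := hpos m
    nlinarith
  · intro a ha
    filter_upwards with m
    refine lt_of_le_of_lt ?_ ha
    rw [div_le_one (hpos m)]
    exact_mod_cast card_le_card (filter_subset _ _)
end

section
/- Let n be even, let i ∈ {1,…,n}, let D ⊆ {1,…,i−1}, let σ be a fixed-point-free involution of D, and let U = {1,…,i−1} \ D. Let E be the event that p(d) = σ(d) for all d ∈ D and p(u) ≥ i for all u ∈ U. If P(E) > 0, then for every j ∈ U one has P(p(i) = j | E) = 1/(n−i+1), and consequently P(p(i) < i | E) = |U|/(n−i+1). -/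
/-- The probability, for a uniformly random perfect matching (fixed-point-free
involution) `p` of `Fin n`, that the event `A p` holds. -/
noncomputable def matchProb (n : ℕ) (A : (Fin n → Fin n) → Prop) : ℝ :=
  (Nat.card {p : Fin n → Fin n // Function.Involutive p ∧ (∀ x, p x ≠ x) ∧ A p} : ℝ) /
  (Nat.card {p : Fin n → Fin n // Function.Involutive p ∧ ∀ x, p x ≠ x} : ℝ)

lemma matchProb_eq (n : ℕ) (A Q : (Fin n → Fin n) → Prop) [DecidablePred Q]
    (h : ∀ p, (Function.Involutive p ∧ (∀ x, p x ≠ x) ∧ A p) ↔ Q p) : matchProb n A =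
    ((Finset.univ.filter Q).card : ℝ) /
    (Nat.card {p : Fin n → Fin n // Function.Involutive p ∧ ∀ x, p x ≠ x} : ℝ) := by
  unfold matchProb
  simp only [h]
  rw [Nat.card_eq_fintype_card, Fintype.card_subtype]

/-- The event. -/
def EvE (n : ℕ) (i : Fin n) (D : Finset (Fin n)) (σ p : Fin n → Fin n) : Prop :=
  Function.Involutive p ∧ (∀ x, p x ≠ x) ∧ (∀ d ∈ D, p d = σ d) ∧
    ∀ u : Fin n, u < i → u ∉ D → i ≤ p u

lemma EvE_conj (n : ℕ) (i : Fin n) (D : Finset (Fin n))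
    (hD : ∀ d ∈ D, d < i) (σ : Fin n → Fin n) (hσD : ∀ d ∈ D, σ d ∈ D)
    (v : Fin n) (hv : i ≤ v) (p : Fin n → Fin n) (hp : EvE n i D σ p) :
    EvE n i D σ (fun x => Equiv.swap i v (p (Equiv.swap i v x))) := by
  obtain ⟨h1, h2, h3, h4⟩ := hp
  have hlt : ∀ x, x < i → Equiv.swap i v x = x := fun x hx =>
    Equiv.swap_apply_of_ne_of_ne hx.ne (hx.trans_le hv).ne
  have hge : ∀ x, i ≤ x → i ≤ Equiv.swap i v x := by
    intro x hx
    rw [Equiv.swap_apply_def]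
    split_ifs <;> simp_all
  refine ⟨fun x => by simp [h1 _], fun x hx => ?_, fun d hd => ?_, fun u hu hud => ?_⟩
  · apply h2 (Equiv.swap i v x)
    apply (Equiv.swap i v).injective
    simpa using hx
  · simp only
    rw [hlt d (hD d hd), h3 d hd, hlt _ (hD _ (hσD d hd))]
  · simp only
    rw [hlt u hu]
    exact hge _ (h4 u hu hud)

open Classical in
lemma card_key (n : ℕ) (i : Fin n) (D : Finset (Fin n))
    (hD : ∀ d ∈ D, d < i) (σ : Fin n → Fin n) (hσD : ∀ d ∈ D, σ d ∈ D)
    (j : Fin n) (hj : j < i) (hjD : j ∉ D) :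
    (Finset.univ.filter (EvE n i D σ)).card =
      (n - i) * (Finset.univ.filter (fun p => EvE n i D σ p ∧ p i = j)).card := by
  have h := Finset.card_eq_sum_card_fiberwise (s := Finset.univ.filter (EvE n i D σ))
    (t := Finset.Ici i) (f := fun p => p j) (by
      intro p hp
      simp only [Finset.coe_filter, Finset.mem_univ, true_and, Set.mem_ofPred_eq] at hp
      simpa using hp.2.2.2 j hj hjD)
  rw [h, Finset.sum_const_nat (m := (Finset.univ.filter (fun p => EvE n i D σ p ∧ p i = j)).card)]
  · simp
  intro v hv
  have hv : i ≤ v := by simpa using hv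
  have hsj : Equiv.swap i v j = j :=
    Equiv.swap_apply_of_ne_of_ne hj.ne (hj.trans_le hv).ne
  refine Finset.card_bij' (fun p _ => fun x => Equiv.swap i v (p (Equiv.swap i v x)))
    (fun p _ => fun x => Equiv.swap i v (p (Equiv.swap i v x))) ?_ ?_ ?_ ?_
  · intro p hp
    simp only [Finset.mem_filter, Finset.mem_univ, true_and] at hp ⊢
    refine ⟨EvE_conj n i D hD σ hσD v hv p hp.1, ?_⟩
    rw [Equiv.swap_apply_left]
    have : p v = j := by rw [← hp.2, hp.1.1]
    rw [this, hsj]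
  · intro p hp
    simp only [Finset.mem_filter, Finset.mem_univ, true_and] at hp ⊢
    refine ⟨EvE_conj n i D hD σ hσD v hv p hp.1, ?_⟩
    have : p j = i := by rw [← hp.2, hp.1.1]
    rw [hsj, this, Equiv.swap_apply_left]
  · intro p hp; ext x; simp
  · intro p hp; ext x; simp

/-- Conditioned on the partners of a set `D` of vertices below `i` being given by a
fixed-point-free involution `σ` of `D`, and all other vertices below `i` having their
partner at or above `i`, the partner of `i` is uniform over the unsaturated vertices:
it equals any given unsaturated `j < i` with probability `1/(n - i + 1)` (1-based),
and is below `i` with probability `|U|/(n - i + 1)`.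
(Vertices are 0-indexed here, so the 1-based quantity `n - i + 1` is `n - i`.) -/
theorem stmt1 (n : ℕ) (hn : Even n) (i : Fin n) (D : Finset (Fin n))
    (hD : ∀ d ∈ D, d < i) (σ : Fin n → Fin n)
    (hσD : ∀ d ∈ D, σ d ∈ D) (hσinv : ∀ d ∈ D, σ (σ d) = d) (hσfpf : ∀ d ∈ D, σ d ≠ d)
    (hpos : 0 < matchProb n (fun p => (∀ d ∈ D, p d = σ d) ∧
      ∀ u : Fin n, u < i → u ∉ D → i ≤ p u)) :
    (∀ j : Fin n, j < i → j ∉ D →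
      matchProb n (fun p => p i = j ∧ (∀ d ∈ D, p d = σ d) ∧
          ∀ u : Fin n, u < i → u ∉ D → i ≤ p u) /
        matchProb n (fun p => (∀ d ∈ D, p d = σ d) ∧
          ∀ u : Fin n, u < i → u ∉ D → i ≤ p u)
        = 1 / ((n : ℝ) - (i : ℕ))) ∧
    matchProb n (fun p => p i < i ∧ (∀ d ∈ D, p d = σ d) ∧
        ∀ u : Fin n, u < i → u ∉ D → i ≤ p u) /
      matchProb n (fun p => (∀ d ∈ D, p d = σ d) ∧
        ∀ u : Fin n, u < i → u ∉ D → i ≤ p u)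
      = ((Finset.univ.filter (fun u : Fin n => u < i ∧ u ∉ D)).card : ℝ) /
        ((n : ℝ) - (i : ℕ)) := by
  classical
  have hni : (0 : ℝ) < (n : ℝ) - (i : ℕ) := by
    have := i.2
    have : ((i : ℕ) : ℝ) < n := by exact_mod_cast this
    linarith
  have hE := matchProb_eq n (fun p => (∀ d ∈ D, p d = σ d) ∧
      ∀ u : Fin n, u < i → u ∉ D → i ≤ p u) (EvE n i D σ) (fun p => Iff.rfl)
  have hA := fun j : Fin n => matchProb_eq n (fun p => p i = j ∧ (∀ d ∈ D, p d = σ d) ∧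
      ∀ u : Fin n, u < i → u ∉ D → i ≤ p u) (fun p => EvE n i D σ p ∧ p i = j)
      (fun p => by simp only [EvE]; tauto)
  have hB := matchProb_eq n (fun p => p i < i ∧ (∀ d ∈ D, p d = σ d) ∧
      ∀ u : Fin n, u < i → u ∉ D → i ≤ p u) (fun p => EvE n i D σ p ∧ p i < i)
      (fun p => by simp only [EvE]; tauto)
  simp only [hE, hA, hB] at hpos ⊢
  clear hE hA hB
  set T : ℝ := (Nat.card {p : Fin n → Fin n // Function.Involutive p ∧ ∀ x, p x ≠ x} : ℝ)
  have hT : T ≠ 0 := by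
    intro h
    rw [h] at hpos
    simp at hpos
  simp only [div_div_div_cancel_right₀ hT]
  set N : ℝ := ((Finset.univ.filter (EvE n i D σ)).card : ℝ) with hN
  have hN0 : N ≠ 0 := by
    intro h
    rw [h] at hpos
    simp at hpos
  have key : ∀ j : Fin n, j < i → j ∉ D →
      N = ((n : ℝ) - (i : ℕ)) *
        ((Finset.univ.filter (fun p => EvE n i D σ p ∧ p i = j)).card : ℝ) := by
    intro j hj hjD
    rw [hN, card_key n i D hD σ hσD j hj hjD, Nat.cast_mul, Nat.cast_sub i.2.le]
  constructor
  · intro j hj hjD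
    rw [div_eq_div_iff hN0 hni.ne', key j hj hjD]
    ring
  · have hsum := Finset.card_eq_sum_card_fiberwise
      (s := Finset.univ.filter (fun p => EvE n i D σ p ∧ p i < i))
      (t := Finset.univ.filter (fun u : Fin n => u < i ∧ u ∉ D)) (f := fun p => p i) (by
        intro p hp
        simp only [Finset.coe_filter, Finset.mem_univ, true_and, Set.mem_ofPred_eq] at hp ⊢
        refine ⟨hp.2, fun hd => ?_⟩
        have h1 := hp.1.2.2.1 _ hd
        rw [hp.1.1] at h1
        have h2 := hD _ (hσD _ hd)
        rw [← h1] at h2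
        exact lt_irrefl _ h2)
    rw [hsum, Nat.cast_sum, div_eq_div_iff hN0 hni.ne', Finset.sum_mul,
      Finset.sum_congr rfl (g := fun _ => N), Finset.sum_const, nsmul_eq_mul]
    intro j hj
    simp only [Finset.mem_filter, Finset.mem_univ, true_and] at hj
    rw [key j hj.1 hj.2, mul_comm]
    congr 3
    ext p
    simp only [Finset.mem_filter, Finset.mem_univ, true_and]
    constructor
    · rintro ⟨⟨h1, h2⟩, h3⟩; exact ⟨h1, h3⟩
    · rintro ⟨h1, h3⟩; exact ⟨⟨h1, h3 ▸ hj.1⟩, h3⟩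
end

section
/- Let S be a finite set of even cardinality s and let A ⊆ S with |A| = a and 2a ≤ s. Then the number of fixed-point-free involutions f of S such that f(x) ∉ A for every x ∈ A equals (s−a)!/(s−2a)! · M(s−2a), where M(2m) = (2m)!/(2^m · m!) denotes the number of fixed-point-free involutions of a 2m-element set. -/
/-- `numFPF m = (2m)! / (2^m · m!)` is the number of fixed-point-free involutions
(perfect matchings) of a `2m`-element set. -/
def numFPF (m : ℕ) : ℕ := (2 * m).factorial / (2 ^ m * m.factorial)

theorem numFPF_zero' : numFPF 0 = 1 := by simp [numFPF]

theorem numFPF_succ' (m : ℕ) : numFPF (m + 1) = (2 * m + 1) * numFPF m := by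
  have key : ∀ m, ∃ c, (2 * m).factorial = c * (2 ^ m * m.factorial) := by
    intro m
    induction m with
    | zero => exact ⟨1, by simp⟩
    | succ k ih =>
      obtain ⟨c, hc⟩ := ih
      refine ⟨(2 * k + 1) * c, ?_⟩
      rw [show 2 * (k + 1) = 2 * k + 1 + 1 by ring, Nat.factorial_succ, Nat.factorial_succ, hc,
        Nat.factorial_succ]
      ring
  obtain ⟨c, hc⟩ := key m
  have hpos : ∀ k : ℕ, 0 < 2 ^ k * k.factorial := fun k => by positivity
  have h1 : numFPF m = c := by
    unfold numFPF; rw [hc]; exact Nat.mul_div_cancel _ (hpos m)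
  have h2 : (2 * (m + 1)).factorial = ((2 * m + 1) * c) * (2 ^ (m + 1) * (m + 1).factorial) := by
    rw [show 2 * (m + 1) = 2 * m + 1 + 1 by ring, Nat.factorial_succ, Nat.factorial_succ, hc,
        Nat.factorial_succ]
    ring
  rw [h1]
  unfold numFPF; rw [h2]; exact Nat.mul_div_cancel _ (hpos (m + 1))

/-- extended involutions moving exactly `S`. -/
def GoodInv {β : Type*} (S A : Finset β) (f : β → β) : Prop :=
  (∀ z, f (f z) = z) ∧ (∀ z, f z ≠ z ↔ z ∈ S) ∧ ∀ z ∈ A, f z ∉ A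

open Classical in
theorem fiber_card {β : Type*} [Fintype β] (S A : Finset β) (x y : β) (hxy : x ≠ y)
    (hx : x ∈ S) (hy : y ∈ S) (hyA : y ∉ A) (hAS : A ⊆ S) :
    (Finset.univ.filter (fun f : β → β => GoodInv S A f ∧ f x = y)).card =
    (Finset.univ.filter (fun f : β → β => GoodInv ((S.erase x).erase y) (A.erase x) f)).card := by
  refine Finset.card_bij' (fun f _ z => if z = x then x else if z = y then y else f z)
    (fun f _ z => if z = x then y else if z = y then x else f z) ?_ ?_ ?_ ?_
  · intro f hf
    simp only [Finset.mem_filter, Finset.mem_univ, true_and] at hf ⊢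
    try unfold GoodInv at hf
    try unfold GoodInv
    obtain ⟨⟨h1, h2, h3⟩, h4⟩ := hf
    have h5 : f y = x := by rw [← h4, h1]
    refine ⟨?_, ?_, ?_⟩
    · intro z; grind
    · intro z; have := h2 z; grind
    · intro z hz; have := h3 z; grind
  · intro f hf
    simp only [Finset.mem_filter, Finset.mem_univ, true_and] at hf ⊢
    try unfold GoodInv at hf
    try unfold GoodInv
    obtain ⟨h1, h2, h3⟩ := hf
    have h5 : f y = y := by have := h2 y; grind
    have h6 : f x = x := by have := h2 x; grind
    refine ⟨⟨?_, ?_, ?_⟩, ?_⟩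
    · intro z; have := h1 z; grind
    · intro z; have := h2 z; grind
    · intro z hz; have := h3 z; have := h1 z; grind
    · simp
  · intro f hf
    simp only [Finset.mem_filter, Finset.mem_univ, true_and] at hf ⊢
    try unfold GoodInv at hf
    try unfold GoodInv
    obtain ⟨⟨h1, h2, h3⟩, h4⟩ := hf
    have h5 : f y = x := by rw [← h4, h1]
    funext z; grind
  · intro f hf
    simp only [Finset.mem_filter, Finset.mem_univ, true_and] at hf ⊢
    try unfold GoodInv at hf
    try unfold GoodInv
    obtain ⟨h1, h2, h3⟩ := hf
    have h5 : f y = y := by have := h2 y; grind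
    have h6 : f x = x := by have := h2 x; grind
    funext z; grind

open Classical in
theorem good_card {β : Type*} [Fintype β] (n : ℕ) : ∀ (S A : Finset β), A ⊆ S →
    S.card = 2 * n → A.card ≤ n →
    (Finset.univ.filter (fun f : β → β => GoodInv S A f)).card =
      (2 * n - A.card).factorial / (2 * n - 2 * A.card).factorial * numFPF (n - A.card) := by
  induction n with
  | zero =>
    intro S A hAS hS hA
    have hS' : S = ∅ := by simpa using hS
    have hA' : A = ∅ := by simpa using hA
    subst hS' hA'
    have : (Finset.univ.filter (fun f : β → β => GoodInv ∅ ∅ f)) = {id} := by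
      ext f
      simp only [Finset.mem_filter, Finset.mem_univ, true_and, Finset.mem_singleton]
      unfold GoodInv
      constructor
      · rintro ⟨-, h, -⟩
        funext z
        have := h z
        simpa using this
      · rintro rfl
        simp
    rw [this]
    simp [numFPF_zero']
  | succ n ih =>
    intro S A hAS hS hA
    rcases A.eq_empty_or_nonempty with rfl | ⟨x, hxA⟩
    · have : S.Nonempty := by rw [← Finset.card_pos]; omega
      obtain ⟨x, hx⟩ := this
      rw [Finset.card_eq_sum_card_fiberwise (f := fun f => f x) (t := S.erase x)]
      · rw [Finset.sum_congr rfl (g := fun _ => numFPF n)]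
        · rw [Finset.sum_const, Finset.card_erase_of_mem hx, hS]
          simp [numFPF_succ', Nat.div_self (Nat.factorial_pos _)]
          left; omega
        · intro y hy
          rw [Finset.mem_erase] at hy
          rw [Finset.filter_filter, fiber_card S ∅ x y hy.1.symm hx hy.2 (by simp) (by simp)]
          rw [ih _ _ (by simp)]
          · simp [Nat.div_self (Nat.factorial_pos _)]
          · rw [Finset.card_erase_of_mem (by simp [hy]), Finset.card_erase_of_mem hx]; omega
          · simp
      · intro f hf
        rw [Finset.mem_coe, Finset.mem_filter] at hf
        replace hf := hf.2
        unfold GoodInv at hf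
        have := hf.2.1
        have h1 := hf.1 x
        have h2 := this x
        have h3 := this (f x)
        simp only [Finset.mem_coe, Finset.mem_erase]
        grind
    · have hx := hAS hxA
      rw [Finset.card_eq_sum_card_fiberwise (f := fun f => f x) (t := S \ A)]
      · obtain ⟨a, ha⟩ : ∃ a, A.card = a + 1 :=
          Nat.exists_eq_succ_of_ne_zero (Finset.card_pos.2 ⟨x, hxA⟩).ne'
        rw [Finset.sum_congr rfl (g := fun _ => (2 * n - a).factorial / (2 * n - 2 * a).factorial
          * numFPF (n - a))]
        · rw [Finset.sum_const, Finset.card_sdiff_of_subset hAS, hS, ha]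
          rw [show 2 * (n + 1) - (a + 1) = (2 * n - a) + 1 by omega,
            show 2 * (n + 1) - 2 * (a + 1) = 2 * n - 2 * a by omega,
            show n + 1 - (a + 1) = n - a by omega, Nat.factorial_succ,
            Nat.mul_div_assoc _ (Nat.factorial_dvd_factorial (by omega)), smul_eq_mul, mul_assoc]
        · intro y hy
          rw [Finset.mem_sdiff] at hy
          have hxy : x ≠ y := by rintro rfl; exact hy.2 hxA
          rw [Finset.filter_filter, fiber_card S A x y hxy hx hy.1 hy.2 hAS]
          rw [ih]
          · rw [Finset.card_erase_of_mem hxA, ha]; simp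
          · intro z hz
            have := @hAS z
            grind
          · rw [Finset.card_erase_of_mem (by simp [hy, hxy.symm]), Finset.card_erase_of_mem hx]
            omega
          · rw [Finset.card_erase_of_mem hxA]; omega
      · intro f hf
        rw [Finset.mem_coe, Finset.mem_filter] at hf
        replace hf := hf.2
        unfold GoodInv at hf
        have := hf.2.1
        have h1 := hf.1 x
        have h2 := this x
        have h3 := this (f x)
        have h4 := hf.2.2 x hxA
        simp only [Finset.mem_coe, Finset.mem_sdiff]
        grind

/-- Let `S` be a finite set of even cardinality `s` and `A ⊆ S` with `|A| = a`,
`2a ≤ s`. The number of fixed-point-free involutions `f` of `S` with `f(x) ∉ A` for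
all `x ∈ A` is `(s-a)!/(s-2a)! · M(s-2a)`. -/
theorem stmt2 {α : Type*} (S A : Finset α) (hAS : A ⊆ S)
    (hs : Even S.card) (h2a : 2 * A.card ≤ S.card) :
    Nat.card {f : ↥S → ↥S // Function.Involutive f ∧ (∀ x, f x ≠ x) ∧
        ∀ x : ↥S, (x : α) ∈ A → (f x : α) ∉ A} =
      (S.card - A.card).factorial / (S.card - 2 * A.card).factorial *
        numFPF ((S.card - 2 * A.card) / 2) := by
  classical
  obtain ⟨n, hn⟩ := hs
  have hB : (A.subtype (· ∈ S)).card = A.card := by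
    rw [Finset.card_subtype, Finset.filter_true_of_mem (fun x hx => hAS hx)]
  have h := good_card (β := ↥S) n Finset.univ (A.subtype (· ∈ S)) (Finset.subset_univ _)
    (by simp; omega) (by omega)
  rw [hB] at h
  rw [hn, ← two_mul, show (2 * n - 2 * A.card) / 2 = n - A.card by omega, ← h,
    Nat.card_eq_fintype_card, Fintype.card_subtype]
  congr 1
  ext f
  rw [Finset.mem_filter, Finset.mem_filter]
  simp [GoodInv, Function.Involutive]
end

section
/- Let x(t) = t(1−t) and i₀ = i₀(n) = ⌊n / log log n⌋. For every function λ : ℕ → ℝ with λ(n) → ∞ as n → ∞, there exists a constant C > 0 such that, defining X = #{ j ∈ {1,…,i₀} : p(j) > i₀ }, the probability P( |X − n·x(i₀/n)| ≤ C·√(λ(n)·i₀) ) tends to 1 as n → ∞ through even integers. -/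
/-- `i₀ = i₀(n) = ⌊n / log log n⌋`. -/
noncomputable def burnIn (n : ℕ) : ℕ := ⌊(n : ℝ) / Real.log (Real.log (n : ℝ))⌋₊

open Classical in
/-- The finset of perfect matchings. -/
noncomputable def PMs (n : ℕ) : Finset (Fin n → Fin n) :=
  Finset.univ.filter (fun p => Function.Involutive p ∧ ∀ x, p x ≠ x)

lemma mem_PMs {n : ℕ} {p : Fin n → Fin n} :
    p ∈ PMs n ↔ Function.Involutive p ∧ ∀ x, p x ≠ x := by
  simp [PMs]

lemma PMs_conj {n : ℕ} (σ : Equiv.Perm (Fin n)) {p : Fin n → Fin n} (hp : p ∈ PMs n) :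
    (fun x => σ (p (σ.symm x))) ∈ PMs n := by
  rw [mem_PMs] at *
  refine ⟨fun x => by simp [hp.1 _], fun x h => hp.2 (σ.symm x) ?_⟩
  rw [Equiv.eq_symm_apply]; exact h

lemma card_conj {n : ℕ} (σ : Equiv.Perm (Fin n)) (P Q : (Fin n → Fin n) → Prop)
    [DecidablePred P] [DecidablePred Q]
    (h : ∀ p, P p → Q (fun x => σ (p (σ.symm x)))) :
    ((PMs n).filter P).card ≤ ((PMs n).filter Q).card := by
  apply Finset.card_le_card_of_injOn (fun p x => σ (p (σ.symm x)))
  · intro p hp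
    simp only [Finset.coe_filter, Set.mem_ofPred_eq] at hp ⊢
    exact ⟨PMs_conj σ hp.1, h p hp.2⟩
  · intro p _ q _ hpq
    funext x
    have := congrFun hpq (σ x)
    simpa using this

open Classical in
/-- the number of matchings with `p i = j`. -/
lemma count1 {n : ℕ} (hn : 4 ≤ n) (i j : Fin n) (hij : j ≠ i) :
    (((PMs n).filter (fun p => p i = j)).card : ℝ) = (PMs n).card / ((n : ℝ) - 1) := by
  have key : ∀ j' : Fin n, j' ≠ i →
      ((PMs n).filter (fun p => p i = j')).card = ((PMs n).filter (fun p => p i = j)).card := by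
    intro j' hj'
    apply le_antisymm
    · apply card_conj (Equiv.swap j' j)
      intro p hp
      simp [Equiv.swap_apply_of_ne_of_ne hj'.symm hij.symm, hp]
    · apply card_conj (Equiv.swap j' j)
      intro p hp
      simp [Equiv.swap_apply_of_ne_of_ne hj'.symm hij.symm, hp]
  have h0 : ((PMs n).filter (fun p => p i = i)).card = 0 := by
    rw [Finset.card_eq_zero, Finset.filter_eq_empty_iff]
    intro p hp
    exact (mem_PMs.1 hp).2 i
  have hs := Finset.card_eq_sum_card_fiberwise (s := PMs n) (t := Finset.univ)
    (f := fun p => p i) (by intro x _; simp)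
  rw [← Finset.add_sum_erase _ _ (Finset.mem_univ i), h0,
    Finset.sum_congr rfl (fun j' hj' => key j' (Finset.ne_of_mem_erase hj'))] at hs
  simp only [Finset.sum_const, Finset.card_erase_of_mem (Finset.mem_univ i), Finset.card_univ,
    Fintype.card_fin, smul_eq_mul, zero_add] at hs
  have h4 : (4 : ℝ) ≤ n := by exact_mod_cast hn
  rw [eq_div_iff (by linarith), hs]
  push_cast [Nat.cast_sub (show 1 ≤ n by omega)]
  ring

open Classical in
lemma count2 {n : ℕ} (hn : 4 ≤ n) (i j l q : Fin n) (hij : j ≠ i) (hil : l ≠ i) (hjl : l ≠ j)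
    (hqi : q ≠ i) (hqj : q ≠ j) (hql : q ≠ l) :
    (((PMs n).filter (fun p => p i = j ∧ p l = q)).card : ℝ)
      = (PMs n).card / ((n : ℝ) - 1) / ((n : ℝ) - 3) := by
  have key : ∀ q' : Fin n, q' ∉ ({i, j, l} : Finset (Fin n)) →
      ((PMs n).filter (fun p => p i = j ∧ p l = q')).card =
      ((PMs n).filter (fun p => p i = j ∧ p l = q)).card := by
    intro q' hq'
    simp only [Finset.mem_insert, Finset.mem_singleton, not_or] at hq'
    obtain ⟨h1, h2, h3⟩ := hq'
    apply le_antisymm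
    · apply card_conj (Equiv.swap q' q)
      intro p hp
      simp [Equiv.swap_apply_of_ne_of_ne (Ne.symm h1) hqi.symm,
        Equiv.swap_apply_of_ne_of_ne (Ne.symm h2) hqj.symm,
        Equiv.swap_apply_of_ne_of_ne (Ne.symm h3) hql.symm, hp.1, hp.2]
    · apply card_conj (Equiv.swap q' q)
      intro p hp
      simp [Equiv.swap_apply_of_ne_of_ne (Ne.symm h1) hqi.symm,
        Equiv.swap_apply_of_ne_of_ne (Ne.symm h2) hqj.symm,
        Equiv.swap_apply_of_ne_of_ne (Ne.symm h3) hql.symm, hp.1, hp.2]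
  have h0 : ∀ q' ∈ ({i, j, l} : Finset (Fin n)),
      ((PMs n).filter (fun p => p i = j ∧ p l = q')).card = 0 := by
    intro q' hq'
    rw [Finset.card_eq_zero, Finset.filter_eq_empty_iff]
    rintro p hp ⟨ha, hb⟩
    obtain ⟨hi, hf⟩ := mem_PMs.1 hp
    simp only [Finset.mem_insert, Finset.mem_singleton] at hq'
    rcases hq' with rfl | rfl | rfl
    · apply hjl; rw [← ha, ← hb, hi]
    · exact hil (hi.injective (hb.trans ha.symm))
    · exact hf _ hb
  have hs := Finset.card_eq_sum_card_fiberwise (s := (PMs n).filter (fun p => p i = j))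
    (t := Finset.univ) (f := fun p => p l) (by intro x _; simp)
  simp only [Finset.filter_filter] at hs
  rw [← Finset.sum_sdiff (Finset.subset_univ ({i, j, l} : Finset (Fin n))),
    Finset.sum_eq_zero h0,
    Finset.sum_congr rfl (fun j' hj' => key j' (Finset.mem_sdiff.1 hj').2)] at hs
  have hc : ({i, j, l} : Finset (Fin n)).card = 3 := by
    rw [Finset.card_eq_three]; exact ⟨i, j, l, hij.symm, hil.symm, hjl.symm, rfl⟩
  simp only [Finset.sum_const, Finset.card_sdiff_of_subset (Finset.subset_univ _), hc,
    Finset.card_univ, Fintype.card_fin, smul_eq_mul, add_zero] at hs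
  have h4 : (4 : ℝ) ≤ n := by exact_mod_cast hn
  rw [← count1 hn i j hij, eq_div_iff (by linarith), hs]
  push_cast [Nat.cast_sub (show 3 ≤ n by omega)]
  ring

open Classical in
lemma pair_bound {n : ℕ} (hn : 4 ≤ n) (S : Finset (Fin n)) (i l : Fin n) (hi : i ∈ S) (hl : l ∈ S)
    (hil : l ≠ i) :
    (((PMs n).filter (fun p => p i ∈ S ∧ p l ∈ S)).card : ℝ)
      ≤ (PMs n).card / ((n : ℝ) - 1) + (PMs n).card * ((S.card : ℝ) ^ 2 / (n : ℝ) ^ 2) := by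
  have h4 : (4 : ℝ) ≤ n := by exact_mod_cast hn
  have hkn : (S.card : ℝ) ≤ n := by
    have := Finset.card_le_univ S
    rw [Fintype.card_fin] at this
    exact_mod_cast this
  set N : ℝ := ((PMs n).card : ℝ) with hN
  have hN0 : 0 ≤ N := by positivity
  set k : ℝ := (S.card : ℝ) with hk
  have hk2 : (2 : ℝ) ≤ k := by
    have : 1 < S.card := Finset.one_lt_card.2 ⟨l, hl, i, hi, hil⟩
    rw [hk]; exact_mod_cast this
  -- inner bound
  have inner : ∀ j ∈ (S.erase i).erase l,
      (((PMs n).filter (fun p => p i = j ∧ p l ∈ S)).card : ℝ) ≤ N / (n - 1) * (k / n) := by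
    intro j hj
    simp only [Finset.mem_erase] at hj
    obtain ⟨hjl, hji, hjS⟩ := hj
    have hc : ({i, j, l} : Finset (Fin n)).card = 3 := by
      rw [Finset.card_eq_three]; exact ⟨i, j, l, hji.symm, hil.symm, hjl, rfl⟩
    have hsub : ({i, j, l} : Finset (Fin n)) ⊆ S := by
      intro x hx
      simp only [Finset.mem_insert, Finset.mem_singleton] at hx
      rcases hx with rfl | rfl | rfl <;> assumption
    have h3 : 3 ≤ S.card := hc ▸ Finset.card_le_card hsub
    have hss : ((PMs n).filter (fun p => p i = j ∧ p l ∈ S)) ⊆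
        (S \ {i, j, l}).biUnion (fun q => (PMs n).filter (fun p => p i = j ∧ p l = q)) := by
      intro p hp
      simp only [Finset.mem_filter] at hp
      obtain ⟨hpM, ha, hb⟩ := hp
      obtain ⟨hinv, hf⟩ := mem_PMs.1 hpM
      simp only [Finset.mem_biUnion, Finset.mem_filter, Finset.mem_sdiff, Finset.mem_insert,
        Finset.mem_singleton, not_or]
      refine ⟨p l, ⟨hb, ?_, ?_, hf l⟩, hpM, ha, rfl⟩
      · intro h; apply hjl; rw [← ha, ← h, hinv]
      · intro h; exact hil (hinv.injective (h.trans ha.symm))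
    have h1 : (((PMs n).filter (fun p => p i = j ∧ p l ∈ S)).card : ℝ) ≤
        ∑ q ∈ S \ {i, j, l}, (((PMs n).filter (fun p => p i = j ∧ p l = q)).card : ℝ) := by
      exact_mod_cast (Finset.card_le_card hss).trans Finset.card_biUnion_le
    refine h1.trans ?_
    rw [Finset.sum_congr rfl (g := fun _ => N / (n - 1) / (n - 3))]
    · rw [Finset.sum_const, Finset.card_sdiff_of_subset hsub, hc, nsmul_eq_mul]
      push_cast [Nat.cast_sub h3]
      rw [← hk, mul_comm, div_mul_eq_mul_div, mul_div_assoc]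
      apply mul_le_mul_of_nonneg_left
      · rw [div_le_div_iff₀ (by linarith) (by linarith)]; nlinarith
      · apply div_nonneg hN0; linarith
    · intro q hq
      simp only [Finset.mem_sdiff, Finset.mem_insert, Finset.mem_singleton, not_or] at hq
      exact count2 hn i j l q hji hil hjl.symm hq.2.1 hq.2.2.1 hq.2.2.2
  have hss : ((PMs n).filter (fun p => p i ∈ S ∧ p l ∈ S)) ⊆
      ((PMs n).filter (fun p => p i = l)) ∪
      ((S.erase i).erase l).biUnion (fun j => (PMs n).filter (fun p => p i = j ∧ p l ∈ S)) := by
    intro p hp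
    simp only [Finset.mem_filter] at hp
    obtain ⟨hpM, ha, hb⟩ := hp
    obtain ⟨hinv, hf⟩ := mem_PMs.1 hpM
    simp only [Finset.mem_union, Finset.mem_biUnion, Finset.mem_filter, Finset.mem_erase]
    by_cases h : p i = l
    · exact Or.inl ⟨hpM, h⟩
    · exact Or.inr ⟨p i, ⟨h, hf i, ha⟩, hpM, rfl, hb⟩
  have h1 : (((PMs n).filter (fun p => p i ∈ S ∧ p l ∈ S)).card : ℝ) ≤
      (((PMs n).filter (fun p => p i = l)).card : ℝ) +
      ∑ j ∈ (S.erase i).erase l, (((PMs n).filter (fun p => p i = j ∧ p l ∈ S)).card : ℝ) := by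
    exact_mod_cast (Finset.card_le_card hss).trans ((Finset.card_union_le _ _).trans
      (Nat.add_le_add_left Finset.card_biUnion_le _))
  refine h1.trans ?_
  rw [count1 hn i l hil]
  gcongr
  refine (Finset.sum_le_sum inner).trans ?_
  have hcc : (((S.erase i).erase l).card : ℝ) = k - 2 := by
    have h2 : 2 ≤ S.card := by rw [hk] at hk2; exact_mod_cast hk2
    rw [Finset.card_erase_of_mem (by simp [hil, hl]), Finset.card_erase_of_mem hi, Nat.sub_sub,
      Nat.cast_sub h2]
    norm_num [hk]
  rw [Finset.sum_const, nsmul_eq_mul, hcc]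
  have e1 : (k - 2) * (N / (n - 1) * (k / n)) = N * (((k - 2) / (n - 1)) * (k / n)) := by ring
  have e2 : k ^ 2 / (n : ℝ) ^ 2 = (k / n) * (k / n) := by ring
  rw [e1, e2]
  have : (k - 2) / ((n : ℝ) - 1) ≤ k / n := by
    rw [div_le_div_iff₀ (by linarith) (by linarith)]; nlinarith
  gcongr

open Classical in
/-- number of vertices in `S` matched inside `S` -/
noncomputable def YY {n : ℕ} (S : Finset (Fin n)) (p : Fin n → Fin n) : ℝ :=
  ∑ i ∈ S, if p i ∈ S then (1 : ℝ) else 0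

open Classical in
lemma first_moment {n : ℕ} (hn : 4 ≤ n) (S : Finset (Fin n)) :
    ∑ p ∈ PMs n, YY S p = (PMs n).card * ((S.card : ℝ) * (S.card - 1) / (n - 1)) := by
  unfold YY
  rw [Finset.sum_comm]
  have : ∀ i ∈ S, (∑ p ∈ PMs n, if p i ∈ S then (1 : ℝ) else 0) =
      (PMs n).card * (((S.card : ℝ) - 1) / (n - 1)) := by
    intro i hi
    have h1 : ∀ p ∈ PMs n, (if p i ∈ S then (1 : ℝ) else 0) =
        ∑ j ∈ S.erase i, if p i = j then (1 : ℝ) else 0 := by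
      intro p hp
      rw [Finset.sum_ite_eq]
      simp [(mem_PMs.1 hp).2 i]
    rw [Finset.sum_congr rfl h1, Finset.sum_comm,
      Finset.sum_congr rfl (g := fun _ => ((PMs n).card : ℝ) / (n - 1))]
    · rw [Finset.sum_const, Finset.card_erase_of_mem hi, nsmul_eq_mul,
        Nat.cast_sub (Finset.card_pos.2 ⟨i, hi⟩)]
      push_cast; ring
    · intro j hj
      rw [Finset.sum_boole]
      exact count1 hn i j (Finset.ne_of_mem_erase hj)
  rw [Finset.sum_congr rfl this, Finset.sum_const, nsmul_eq_mul]
  ring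

open Classical in
lemma second_moment {n : ℕ} (hn : 4 ≤ n) (S : Finset (Fin n)) :
    ∑ p ∈ PMs n, (YY S p) ^ 2 ≤
      (PMs n).card * (2 * (S.card : ℝ) + (S.card : ℝ) ^ 4 / (n : ℝ) ^ 2) := by
  have h4 : (4 : ℝ) ≤ n := by exact_mod_cast hn
  have hkn : (S.card : ℝ) ≤ n := by
    have := Finset.card_le_univ S
    rw [Fintype.card_fin] at this
    exact_mod_cast this
  have e : ∀ p ∈ PMs n, (YY S p) ^ 2 =
      ∑ i ∈ S, ∑ l ∈ S, if (p i ∈ S ∧ p l ∈ S) then (1 : ℝ) else 0 := by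
    intro p _
    unfold YY
    rw [sq, Finset.sum_mul_sum]
    refine Finset.sum_congr rfl fun i _ => Finset.sum_congr rfl fun l _ => ?_
    by_cases h1 : p i ∈ S <;> by_cases h2 : p l ∈ S <;> simp [h1, h2]
  rw [Finset.sum_congr rfl e, Finset.sum_comm]
  set N : ℝ := ((PMs n).card : ℝ) with hN
  have hN0 : 0 ≤ N := by positivity
  set k : ℝ := (S.card : ℝ) with hk
  have hk0 : 0 ≤ k := by positivity
  have b : ∀ i ∈ S, (∑ p ∈ PMs n, ∑ l ∈ S, if (p i ∈ S ∧ p l ∈ S) then (1 : ℝ) else 0) ≤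
      N + (k - 1) * (N / (n - 1) + N * (k ^ 2 / (n : ℝ) ^ 2)) := by
    intro i hi
    rw [Finset.sum_comm, ← Finset.add_sum_erase _ _ hi]
    apply add_le_add
    · rw [Finset.sum_boole, hN]
      exact_mod_cast Finset.card_filter_le _ _
    · have : ∀ l ∈ S.erase i, (∑ p ∈ PMs n, if (p i ∈ S ∧ p l ∈ S) then (1 : ℝ) else 0) ≤
          N / (n - 1) + N * (k ^ 2 / (n : ℝ) ^ 2) := by
        intro l hl
        rw [Finset.sum_boole]
        exact pair_bound hn S i l hi (Finset.mem_of_mem_erase hl) (Finset.ne_of_mem_erase hl)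
      refine (Finset.sum_le_sum this).trans ?_
      rw [Finset.sum_const, Finset.card_erase_of_mem hi, nsmul_eq_mul,
        Nat.cast_sub (Finset.card_pos.2 ⟨i, hi⟩)]
      push_cast; rfl
  refine (Finset.sum_le_sum b).trans ?_
  rw [Finset.sum_const, nsmul_eq_mul, ← hk]
  have hA : (k - 1) * (N / (n - 1)) ≤ N := by
    rw [← mul_div_assoc, div_le_iff₀ (by linarith)]; nlinarith
  have hB : (k - 1) * (N * (k ^ 2 / (n : ℝ) ^ 2)) ≤ k * (N * (k ^ 2 / (n : ℝ) ^ 2)) := by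
    apply mul_le_mul_of_nonneg_right (by linarith) (by positivity)
  calc k * (N + (k - 1) * (N / (n - 1) + N * (k ^ 2 / (n : ℝ) ^ 2)))
      ≤ k * (N + (N + k * (N * (k ^ 2 / (n : ℝ) ^ 2)))) := by
        apply mul_le_mul_of_nonneg_left _ hk0; rw [mul_add]; linarith
    _ = _ := by ring

lemma var_bound {n : ℕ} (hn : 4 ≤ n) (S : Finset (Fin n)) :
    ∑ p ∈ PMs n, (YY S p - (S.card : ℝ) ^ 2 / n) ^ 2 ≤ (PMs n).card * (4 * (S.card : ℝ)) := by
  have h4 : (4 : ℝ) ≤ n := by exact_mod_cast hn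
  have hkn : (S.card : ℝ) ≤ n := by
    have := Finset.card_le_univ S
    rw [Fintype.card_fin] at this
    exact_mod_cast this
  have h2 := second_moment hn S
  have h1 := first_moment hn S
  have e : ∑ p ∈ PMs n, (YY S p - (S.card : ℝ) ^ 2 / n) ^ 2 =
      ∑ p ∈ PMs n, (YY S p) ^ 2 - 2 * ((S.card : ℝ) ^ 2 / n) * ∑ p ∈ PMs n, YY S p +
        (PMs n).card * ((S.card : ℝ) ^ 2 / n) ^ 2 := by
    rw [Finset.mul_sum, ← Finset.sum_sub_distrib, ← nsmul_eq_mul, ← Finset.sum_const,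
      ← Finset.sum_add_distrib]
    exact Finset.sum_congr rfl fun p _ => by ring
  rw [e, h1]
  rcases Nat.eq_zero_or_pos S.card with h0 | h0
  · simp only [h0] at h2 ⊢; simpa using h2
  have hk1 : (1 : ℝ) ≤ S.card := by exact_mod_cast h0
  set N : ℝ := ((PMs n).card : ℝ) with hN
  have hN0 : 0 ≤ N := by positivity
  set k : ℝ := (S.card : ℝ) with hk
  have hm : k / n - 1 / n ≤ (k - 1) / ((n : ℝ) - 1) := by
    rw [← sub_div]
    apply div_le_div_of_nonneg_left <;> linarith
  have hx : k ^ 3 / (n : ℝ) ^ 2 ≤ k := by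
    rw [div_le_iff₀ (by positivity)]
    have : k ^ 2 ≤ (n : ℝ) ^ 2 := by gcongr
    nlinarith
  have hy : 2 * (k ^ 2 / n) * (k * (k / n - 1 / n)) ≤
      2 * (k ^ 2 / n) * (k * ((k - 1) / ((n : ℝ) - 1))) := by gcongr
  have fin : (2 * k + k ^ 4 / (n : ℝ) ^ 2) - 2 * (k ^ 2 / n) * (k * ((k - 1) / ((n : ℝ) - 1))) +
      (k ^ 2 / n) ^ 2 ≤ 4 * k := by
    have : 2 * (k ^ 2 / n) * (k * (k / n - 1 / n)) =
      2 * (k ^ 4 / (n : ℝ) ^ 2) - 2 * (k ^ 3 / (n : ℝ) ^ 2) := by ring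
    have e3 : (k ^ 2 / (n : ℝ)) ^ 2 = k ^ 4 / (n : ℝ) ^ 2 := by ring
    linarith
  have := mul_le_mul_of_nonneg_left fin hN0
  rw [mul_div_assoc]
  linarith

lemma PMs_pos (m : ℕ) : 0 < (PMs (2 * m)).card := by
  apply Finset.card_pos.2
  refine ⟨Fin.rev, mem_PMs.2 ⟨Fin.rev_involutive, fun x h => ?_⟩⟩
  have := congrArg Fin.val h
  rw [Fin.val_rev] at this
  omega

open Classical in
lemma matchProb_eq_s3 (n : ℕ) (A : (Fin n → Fin n) → Prop) :
    matchProb n A = (((PMs n).filter A).card : ℝ) / (PMs n).card := by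
  unfold matchProb PMs
  rw [Nat.card_eq_fintype_card, Nat.card_eq_fintype_card, Fintype.card_subtype,
    Fintype.card_subtype, Finset.filter_filter]
  simp only [and_assoc]

open Classical in
lemma X_eq {n k : ℕ} (hk : k ≤ n) (p : Fin n → Fin n) :
    (Nat.card {j : Fin n // (j : ℕ) < k ∧ k ≤ (p j : ℕ)} : ℝ) =
      k - YY (Finset.univ.filter (fun j : Fin n => (j : ℕ) < k)) p := by
  have hc : (Finset.univ.filter (fun j : Fin n => (j : ℕ) < k)).card = k := by
    rw [Fin.card_filter_val_lt]; exact min_eq_right hk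
  have : (Nat.card {j : Fin n // (j : ℕ) < k ∧ k ≤ (p j : ℕ)}) +
    ((Finset.univ.filter (fun j : Fin n => (j : ℕ) < k)).filter (fun j => (p j : ℕ) < k)).card
      = k := by
    rw [Nat.card_eq_fintype_card, Fintype.card_subtype]
    conv_rhs => rw [← hc]
    rw [← Finset.card_filter_add_card_filter_not (fun j => (p j : ℕ) < k)
      (s := Finset.univ.filter (fun j : Fin n => (j : ℕ) < k)), add_comm,
      Finset.filter_filter, Finset.filter_filter]
    simp only [not_lt]
  unfold YY
  rw [Finset.sum_boole, eq_sub_iff_add_eq]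
  simp only [Finset.mem_filter, Finset.mem_univ, true_and] at this ⊢
  exact_mod_cast this

open Classical in
lemma main_bound {m k : ℕ} (hm : 2 ≤ m) (hk : k ≤ 2 * m) (L : ℝ) (hL : 0 < L) :
    1 - 4 / L ≤ matchProb (2 * m) (fun p =>
          |(Nat.card {j : Fin (2 * m) // (j : ℕ) < k ∧ k ≤ (p j : ℕ)} : ℝ) -
            (2 * m : ℝ) * ((k : ℝ) / (2 * m : ℝ) * (1 - (k : ℝ) / (2 * m : ℝ)))| ≤
          1 * Real.sqrt (L * (k : ℝ))) := by
  set S := Finset.univ.filter (fun j : Fin (2 * m) => (j : ℕ) < k) with hS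
  have hc : S.card = k := by
    rw [hS, Fin.card_filter_val_lt]; exact min_eq_right hk
  have hm0 : (2 : ℝ) ≤ m := by exact_mod_cast hm
  have hv := var_bound (n := 2 * m) (by omega) S
  rw [hc] at hv
  have hN : (0 : ℝ) < (PMs (2 * m)).card := by exact_mod_cast PMs_pos m
  rw [matchProb_eq_s3]
  have hA : ∀ p : Fin (2 * m) → Fin (2 * m),
      (|(Nat.card {j : Fin (2 * m) // (j : ℕ) < k ∧ k ≤ (p j : ℕ)} : ℝ) -
            (2 * m : ℝ) * ((k : ℝ) / (2 * m : ℝ) * (1 - (k : ℝ) / (2 * m : ℝ)))| ≤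
          1 * Real.sqrt (L * (k : ℝ))) ↔ (YY S p - (k : ℝ) ^ 2 / (2 * m : ℕ)) ^ 2 ≤ L * k := by
    intro p
    rw [X_eq hk, one_mul, ← sq_abs (YY S p - _), ← Real.le_sqrt (abs_nonneg _) (by positivity),
      abs_sub_comm (YY S p)]
    have : (k : ℝ) - YY S p - (2 * m : ℝ) * ((k : ℝ) / (2 * m : ℝ) * (1 - (k : ℝ) / (2 * m : ℝ)))
        = (k : ℝ) ^ 2 / (2 * m : ℕ) - YY S p := by
      push_cast
      field_simp
      ring
    rw [this]
  simp only [hA]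
  set G := (PMs (2 * m)).filter (fun p => (YY S p - (k : ℝ) ^ 2 / (2 * m : ℕ)) ^ 2 ≤ L * k) with hG
  set B := (PMs (2 * m)).filter (fun p => ¬ (YY S p - (k : ℝ) ^ 2 / (2 * m : ℕ)) ^ 2 ≤ L * k)
    with hB
  have hGB : (G.card : ℝ) + B.card = (PMs (2 * m)).card := by
    exact_mod_cast Finset.card_filter_add_card_filter_not _
  have hBb : (B.card : ℝ) * (L * k) ≤ (PMs (2 * m)).card * (4 * (k : ℝ)) := by
    refine le_trans ?_ hv
    rw [← nsmul_eq_mul]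
    refine le_trans (Finset.card_nsmul_le_sum B
      (fun p => (YY S p - (k : ℝ) ^ 2 / (2 * m : ℕ)) ^ 2) _ ?_) ?_
    · intro p hp
      exact (not_le.1 (Finset.mem_filter.1 hp).2).le
    · exact Finset.sum_le_sum_of_subset_of_nonneg (Finset.filter_subset _ _)
        (fun _ _ _ => sq_nonneg _)
  have hfin : (B.card : ℝ) * L ≤ (PMs (2 * m)).card * 4 := by
    rcases Nat.eq_zero_or_pos k with h0 | h0
    · have : B = ∅ := by
        rw [hB, Finset.filter_eq_empty_iff]
        intro p _
        have hSe : S = ∅ := by rw [← Finset.card_eq_zero, hc, h0]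
        simp [h0, hSe, YY]
      rw [this]; simp
    · have hk0 : (0 : ℝ) < k := by exact_mod_cast h0
      nlinarith
  rw [le_div_iff₀ hN]
  have : (B.card : ℝ) ≤ 4 / L * (PMs (2 * m)).card := by
    rw [div_mul_eq_mul_div, le_div_iff₀ hL]; linarith
  linarith

lemma burnIn_le : ∀ᶠ n : ℕ in Filter.atTop, burnIn n ≤ n := by
  have h : Filter.Tendsto (fun n : ℕ => Real.log (Real.log (n : ℝ))) Filter.atTop Filter.atTop :=
    Real.tendsto_log_atTop.comp (Real.tendsto_log_atTop.comp tendsto_natCast_atTop_atTop)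
  filter_upwards [h.eventually_ge_atTop 1] with n hn
  unfold burnIn
  apply Nat.floor_le_of_le
  exact div_le_self (by positivity) hn

theorem stmt3 (lam : ℕ → ℝ) (hlam : Filter.Tendsto lam Filter.atTop Filter.atTop) :
    ∃ C : ℝ, 0 < C ∧
      Filter.Tendsto (fun m : ℕ =>
        matchProb (2 * m) (fun p =>
          |(Nat.card {j : Fin (2 * m) // (j : ℕ) < burnIn (2 * m) ∧
              burnIn (2 * m) ≤ (p j : ℕ)} : ℝ) -
            (2 * m : ℝ) * ((burnIn (2 * m) : ℝ) / (2 * m : ℝ) *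
              (1 - (burnIn (2 * m) : ℝ) / (2 * m : ℝ)))| ≤
          C * Real.sqrt (lam (2 * m) * (burnIn (2 * m) : ℝ))))
        Filter.atTop (nhds 1) := by
  refine ⟨1, one_pos, ?_⟩
  have h2 : Filter.Tendsto (fun m : ℕ => 2 * m) Filter.atTop Filter.atTop :=
    Filter.tendsto_id.const_mul_atTop' (by norm_num)
  have hl := hlam.comp h2
  have hlow : Filter.Tendsto (fun m : ℕ => 1 - 4 / lam (2 * m)) Filter.atTop (nhds 1) := by
    have := (hl.const_div_atTop 4).const_sub 1
    simpa using this
  refine tendsto_of_tendsto_of_tendsto_of_le_of_le' hlow tendsto_const_nhds ?_ ?_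
  · filter_upwards [hl.eventually_gt_atTop 0, h2.eventually burnIn_le,
      Filter.eventually_ge_atTop 2] with m h1 h3 h4
    exact main_bound h4 h3 _ h1
  · refine Filter.Eventually.of_forall fun m => ?_
    classical
    rw [matchProb_eq_s3]
    apply div_le_one_of_le₀ _ (by positivity)
    exact_mod_cast Finset.card_filter_le _ _
end
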